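/- Let n ≥ 3, m ≥ 1, and let f = (f^1,…,f^m) : ℝ^n → ℝ^m be a C³ map such that there exist constants C > 0 and p > (n−2)/2 with |f_i^α(x)| ≤ C|x|^{−p/2} and |f_{ij}^α(x)| ≤ C|x|^{−p/2−1} for all |x| ≥ 1, and such that S = g^{ij} g^{kl} U^{αβ} (f_{ij}^β f_{kl}^α − f_{ik}^β f_{jl}^α) is Lebesgue integrable over ℝ^n. Assume that S(x) ≥ 0 for all x ∈ ℝ^n and that S^⊥ = U^{αγ} U^{βμ} (⟨Df_k^γ, Df_i^μ⟩ + U^{θν} ⟨Df_i^μ, Df^ν⟩ ⟨Df_k^γ, Df^θ⟩)(f_i^α f_k^β − f_i^β f_k^α) vanishes identically on ℝ^n (as is the case when the graph of f has flat normal bundle). Then the ADM mass m_ADM = lim_{r→∞} (1/(2(n−1)ω_{n−1})) ∫_{S_r} (∂_i g_{ij} − ∂_j g_{ii}) (x_j/r) dσ_r exists and is nonnegative. -/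

import Mathlib

open MeasureTheory Filter Matrix
open scoped Topology

noncomputable section

/-- Partial derivative ∂φ/∂x_i. -/
def pd {n : ℕ} (φ : EuclideanSpace ℝ (Fin n) → ℝ) (i : Fin n)
    (x : EuclideanSpace ℝ (Fin n)) : ℝ :=
  fderiv ℝ φ x (EuclideanSpace.single i 1)

/-- Second partial derivative ∂²φ/∂x_i∂x_j. -/
def pd2 {n : ℕ} (φ : EuclideanSpace ℝ (Fin n) → ℝ) (i j : Fin n)
    (x : EuclideanSpace ℝ (Fin n)) : ℝ :=
  pd (pd φ j) i x

/-- Induced metric of the graph of `f`: g_{ij} = δ_{ij} + f_i^α f_j^α. -/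
def gmat {n m : ℕ} (f : Fin m → EuclideanSpace ℝ (Fin n) → ℝ)
    (x : EuclideanSpace ℝ (Fin n)) : Matrix (Fin n) (Fin n) ℝ :=
  Matrix.of fun i j => (if i = j then (1:ℝ) else 0) + ∑ α, pd (f α) i x * pd (f α) j x

/-- Gram matrix of the normal frame: U_{αβ} = δ_{αβ} + ⟨Df^α, Df^β⟩. -/
def Umat {n m : ℕ} (f : Fin m → EuclideanSpace ℝ (Fin n) → ℝ)
    (x : EuclideanSpace ℝ (Fin n)) : Matrix (Fin m) (Fin m) ℝ :=
  Matrix.of fun α β => (if α = β then (1:ℝ) else 0) + ∑ i, pd (f α) i x * pd (f β) i x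

/-- Scalar curvature of the graph of `f`:
S = g^{ij} g^{kl} U^{αβ} (f_{ij}^β f_{kl}^α − f_{ik}^β f_{jl}^α). -/
def Sc {n m : ℕ} (f : Fin m → EuclideanSpace ℝ (Fin n) → ℝ)
    (x : EuclideanSpace ℝ (Fin n)) : ℝ :=
  ∑ i, ∑ j, ∑ k, ∑ l, ∑ α, ∑ β,
    (gmat f x)⁻¹ i j * (gmat f x)⁻¹ k l * (Umat f x)⁻¹ α β *
      (pd2 (f β) i j x * pd2 (f α) k l x - pd2 (f β) i k x * pd2 (f α) j l x)

/-- Contraction S^⊥ of the normal curvature tensor of the graph of `f`: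
S^⊥ = U^{αγ} U^{βμ} (⟨Df_k^γ, Df_i^μ⟩ + U^{θν} ⟨Df_i^μ, Df^ν⟩ ⟨Df_k^γ, Df^θ⟩)
        (f_i^α f_k^β − f_i^β f_k^α). -/
def Sperp {n m : ℕ} (f : Fin m → EuclideanSpace ℝ (Fin n) → ℝ)
    (x : EuclideanSpace ℝ (Fin n)) : ℝ :=
  ∑ i, ∑ k, ∑ α, ∑ β, ∑ γ, ∑ μ,
    (Umat f x)⁻¹ α γ * (Umat f x)⁻¹ β μ *
      ((∑ l, pd2 (f γ) k l x * pd2 (f μ) i l x) +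
        ∑ θ, ∑ ν, (Umat f x)⁻¹ θ ν * (∑ l, pd2 (f μ) i l x * pd (f ν) l x) *
          (∑ l, pd2 (f γ) k l x * pd (f θ) l x)) *
      (pd (f α) i x * pd (f β) k x - pd (f β) i x * pd (f α) k x)

/-- ω_{n−1}: the (n−1)-dimensional (Hausdorff) volume of the unit sphere in ℝ^n. -/
def sphereVol (n : ℕ) : ℝ :=
  (μH[(n:ℝ) - 1] (Metric.sphere (0 : EuclideanSpace ℝ (Fin n)) 1)).toReal

/-- The ADM mass integrand (∂_i g_{ij} − ∂_j g_{ii}) (x_j/r), summed over i, j. -/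
def admIntegrand {n m : ℕ} (f : Fin m → EuclideanSpace ℝ (Fin n) → ℝ) (r : ℝ)
    (x : EuclideanSpace ℝ (Fin n)) : ℝ :=
  ∑ i, ∑ j, (pd (fun y => gmat f y i j) i x - pd (fun y => gmat f y i i) j x) * (x j / r)

local notation "𝔼" k:max => EuclideanSpace ℝ (Fin k)

theorem rotinv_unique {n : ℕ} (μ ν : Measure (𝔼 n)) [IsFiniteMeasure μ]
    [IsFiniteMeasure ν]
    (hμ : ∀ L : (𝔼 n) ≃ₗᵢ[ℝ] (𝔼 n), μ.map L = μ)
    (hν : ∀ L : (𝔼 n) ≃ₗᵢ[ℝ] (𝔼 n), ν.map L = ν)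
    (sμ : ∀ᵐ x ∂μ, ‖x‖ = 1) (sν : ∀ᵐ x ∂ν, ‖x‖ = 1) :
    ν Set.univ • μ = μ Set.univ • ν := by
  have key : ∀ (μ : Measure (𝔼 n)) [IsFiniteMeasure μ],
      (∀ L : (𝔼 n) ≃ₗᵢ[ℝ] (𝔼 n), μ.map L = μ) →
      ∀ s t, ‖s‖ = ‖t‖ → charFun μ s = charFun μ t := by
    intro μ _ hμ s t hst
    set L := Submodule.reflection (ℝ ∙ (t - s))ᗮ
    have hL : L t = s := Submodule.reflection_sub hst.symm
    have : charFun (μ.map L) s = charFun μ t := by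
      rw [charFun_apply, charFun_apply, integral_map L.continuous.measurable.aemeasurable
        (by fun_prop)]
      congr 1; ext x
      rw [← hL, L.inner_map_map]
    rw [← this, hμ]
  have h2 : ∀ t, (ν Set.univ).toReal * charFun μ t = (μ Set.univ).toReal * charFun ν t := by
    intro t
    have e1 : ∫ y, (∫ x, Complex.exp (((inner ℝ x (‖t‖ • y) : ℝ) : ℂ) * Complex.I) ∂μ) ∂ν
        = (ν Set.univ).toReal * charFun μ t := by
      have : ∀ᵐ y ∂ν, (∫ x, Complex.exp (((inner ℝ x (‖t‖ • y) : ℝ) : ℂ) * Complex.I) ∂μ)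
          = charFun μ t := by
        filter_upwards [sν] with y hy
        rw [← charFun_apply]
        exact key μ hμ _ _ (by simp [norm_smul, hy])
      rw [integral_congr_ae this]; simp [Measure.real]
    have e2 : ∫ x, (∫ y, Complex.exp (((inner ℝ x (‖t‖ • y) : ℝ) : ℂ) * Complex.I) ∂ν) ∂μ
        = (μ Set.univ).toReal * charFun ν t := by
      have : ∀ᵐ x ∂μ, (∫ y, Complex.exp (((inner ℝ x (‖t‖ • y) : ℝ) : ℂ) * Complex.I) ∂ν)
          = charFun ν t := by
        filter_upwards [sμ] with x hx
        have := key ν hν (‖t‖ • x) t (by simp [norm_smul, hx])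
        rw [← this, charFun_apply]
        congr 1; ext y
        rw [inner_smul_right, inner_smul_right, real_inner_comm]
      rw [integral_congr_ae this]; simp [Measure.real]
    rw [← e1, ← e2]
    refine integral_integral_swap ?_
    refine Integrable.of_bound (C := 1) ?_ ?_
    · apply Continuous.aestronglyMeasurable
      fun_prop
    · refine Eventually.of_forall fun z => ?_
      simp [Function.uncurry, Complex.norm_exp_ofReal_mul_I]
  have : IsFiniteMeasure (ν Set.univ • μ) := ⟨by simp [ENNReal.mul_lt_top_iff]⟩
  have : IsFiniteMeasure (μ Set.univ • ν) := ⟨by simp [ENNReal.mul_lt_top_iff]⟩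
  apply Measure.ext_of_charFun
  ext t
  have := h2 t
  rw [charFun_apply, charFun_apply] at *
  rw [integral_smul_measure, integral_smul_measure]
  simpa using this

theorem polar_integral {n : ℕ} (hn : 1 ≤ n) (f : (𝔼 n) → ℝ)
    (hf : Integrable f) :
    ∫ x, f x = ∫ s in Set.Ioi (0:ℝ), s ^ (n - 1) *
      ∫ ω, f (s • ω.1) ∂((volume : Measure (𝔼 n)).toSphere) := by
  set μ : Measure (𝔼 n) := volume with hμ
  set F : (Metric.sphere (0:(𝔼 n)) 1) × Set.Ioi (0:ℝ) → ℝ :=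
    fun z => f (z.2.1 • z.1.1) with hF
  have mp := μ.measurePreserving_homeomorphUnitSphereProd
  have hFc : ∀ x : ({(0)}ᶜ : Set (𝔼 n)),
      F (homeomorphUnitSphereProd _ x) = f x.1 := by
    intro x
    have hx : ‖x.1‖ ≠ 0 := norm_ne_zero_iff.2 x.2
    simp only [hF, homeomorphUnitSphereProd_apply_snd_coe, homeomorphUnitSphereProd_apply_fst_coe]
    rw [smul_smul, mul_inv_cancel₀ hx, one_smul]
  have hd : Module.finrank ℝ (𝔼 n) = n := by simp
  rw [hd] at mp
  have i1 : Integrable F (μ.toSphere.prod (.volumeIoiPow (n - 1))) := by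
    rw [← mp.integrable_comp_emb (Homeomorph.measurableEmbedding _)]
    have : (F ∘ (homeomorphUnitSphereProd (𝔼 n)))
      = f ∘ Subtype.val := by ext x; exact hFc x
    rw [this, ← integrableOn_iff_comap_subtypeVal (measurableSet_singleton _).compl]
    exact hf.integrableOn
  have n0 : Nonempty (Fin n) := ⟨⟨0, hn⟩⟩
  calc ∫ x, f x ∂μ = ∫ x : ({(0)}ᶜ : Set (𝔼 n)), f x.1 ∂(μ.comap (↑)) := by
        rw [integral_subtype_comap (measurableSet_singleton _).compl fun x ↦ f x,
          restrict_compl_singleton]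
    _ = ∫ z, F z ∂μ.toSphere.prod (.volumeIoiPow (n - 1)) := by
        rw [← mp.integral_comp (Homeomorph.measurableEmbedding _)]
        exact integral_congr_ae (Eventually.of_forall fun x => (hFc x).symm)
    _ = ∫ s, (∫ ω, F (ω, s) ∂μ.toSphere) ∂(.volumeIoiPow (n - 1)) := integral_prod_symm _ i1
    _ = _ := by
      simp only [Measure.volumeIoiPow, ENNReal.ofReal]
      rw [integral_withDensity_eq_integral_smul,
        integral_subtype_comap measurableSet_Ioi fun a ↦ Real.toNNReal (a ^ (n - 1)) •
          ∫ ω, f (a • ω.1) ∂μ.toSphere,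
        setIntegral_congr_fun measurableSet_Ioi fun x hx ↦ ?_]
      · rw [NNReal.smul_def, Real.coe_toNNReal _ (pow_nonneg hx.out.le _), smul_eq_mul]
      · exact (measurable_subtype_coe.pow_const _).real_toNNReal

theorem st_deriv_zero {t : ℝ} (h : t ≤ 0 ∨ 1 ≤ t) : deriv Real.smoothTransition t = 0 := by
  have hc : DifferentiableAt ℝ Real.smoothTransition t :=
    (Real.smoothTransition.contDiffAt (n := 1)).differentiableAt (by norm_num)
  rcases h with h | h
  · apply IsLocalMin.deriv_eq_zero
    refine Eventually.of_forall fun s => ?_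
    rw [Real.smoothTransition.zero_of_nonpos h]; exact Real.smoothTransition.nonneg s
  · apply IsLocalMax.deriv_eq_zero
    refine Eventually.of_forall fun s => ?_
    rw [Real.smoothTransition.one_of_one_le h]; exact Real.smoothTransition.le_one s

theorem st_hasDeriv (t : ℝ) :
    HasDerivAt Real.smoothTransition (deriv Real.smoothTransition t) t :=
  ((Real.smoothTransition.contDiffAt (n := 1)).differentiableAt (by norm_num)).hasDerivAt

theorem st_deriv_cont : Continuous (deriv Real.smoothTransition) :=
  (Real.smoothTransition.contDiff (n := 1)).continuous_deriv (by norm_num)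

theorem st_deriv_nonneg (t : ℝ) : 0 ≤ deriv Real.smoothTransition t :=
  Real.smoothTransition.monotone.deriv_nonneg

theorem pd_continuous {n : ℕ} {φ : (𝔼 n) → ℝ} (h : ContDiff ℝ 1 φ)
    (i : Fin n) : Continuous (pd φ i) := by
  unfold pd
  exact (h.continuous_fderiv (by norm_num)).clm_apply continuous_const

theorem peak_limit (H : ℝ → ℝ) (hH : Continuous H) {r : ℝ} (hr : 0 < r) :
    Tendsto (fun k : ℝ => ∫ s in Set.Ioi (0:ℝ),
      (2 * k * s * deriv Real.smoothTransition (k * (r ^ 2 - s ^ 2))) * H s) atTop (𝓝 (H r)) := by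
  have e : ∀ᶠ k : ℝ in atTop, ∫ s in Set.Icc (0:ℝ) r,
      (2 * k * s * deriv Real.smoothTransition (k * (r ^ 2 - s ^ 2))) • H s =
      ∫ s in Set.Ioi (0:ℝ),
      (2 * k * s * deriv Real.smoothTransition (k * (r ^ 2 - s ^ 2))) * H s := by
    filter_upwards [eventually_ge_atTop 0] with k hk
    rw [integral_Icc_eq_integral_Ioc]
    symm
    refine setIntegral_eq_of_subset_of_forall_sdiff_eq_zero measurableSet_Ioi
      (fun x hx => hx.1) ?_
    intro x hx
    have hx1 : 0 < x := hx.1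
    have hx2 : r < x := by
      by_contra hc
      exact hx.2 ⟨hx1, not_lt.1 hc⟩
    rw [st_deriv_zero (Or.inl _)]
    · simp
    · apply mul_nonpos_of_nonneg_of_nonpos hk; nlinarith
  refine Tendsto.congr' e ?_
  apply tendsto_setIntegral_peak_smul_of_integrableOn_of_tendsto (x₀ := r) measurableSet_Icc
    measurableSet_Icc subset_rfl self_mem_nhdsWithin (by simp)
  · filter_upwards [eventually_ge_atTop 0] with k hk x hx
    have := hx.1
    have := st_deriv_nonneg (k * (r ^ 2 - x ^ 2))
    positivity
  · intro u hu hru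
    obtain ⟨ε, hε, hb⟩ := Metric.isOpen_iff.1 hu r hru
    have : ∀ᶠ k : ℝ in atTop, 1 ≤ k * (ε * r) :=
      (tendsto_id.atTop_mul_const (by positivity)).eventually_ge_atTop 1
    rw [Metric.tendstoUniformlyOn_iff]
    intro δ hδ
    filter_upwards [this, eventually_ge_atTop 0] with k hk hk0 x hx
    have hx2 : x ≤ r - ε := by
      by_contra hc
      apply hx.2
      apply hb
      rw [Metric.mem_ball, Real.dist_eq, abs_lt]
      constructor <;> linarith [hx.1.1, hx.1.2]
    have h0 := hx.1.1
    rw [st_deriv_zero (Or.inr _)]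
    · simpa using hδ
    · refine hk.trans ?_
      apply mul_le_mul_of_nonneg_left _ hk0
      nlinarith
  · have : ∀ᶠ k : ℝ in atTop, 1 ≤ k * r ^ 2 :=
      (tendsto_id.atTop_mul_const (by positivity)).eventually_ge_atTop 1
    apply tendsto_const_nhds.congr'
    filter_upwards [this] with k hk
    rw [integral_Icc_eq_integral_Ioc, ← intervalIntegral.integral_of_le hr.le]
    have hd : ∀ s ∈ Set.uIcc 0 r, HasDerivAt
        (fun s => - Real.smoothTransition (k * (r ^ 2 - s ^ 2)))
        (2 * k * s * deriv Real.smoothTransition (k * (r ^ 2 - s ^ 2))) s := by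
      intro s _
      have h1 : HasDerivAt (fun s : ℝ => k * (r ^ 2 - s ^ 2)) (k * (-(2 * s))) s := by
        have := ((hasDerivAt_pow 2 s).const_sub (r ^ 2)).const_mul k
        simpa using this
      have := ((st_hasDeriv (k * (r ^ 2 - s ^ 2))).comp s h1).neg
      exact this.congr_deriv (by ring)
    rw [intervalIntegral.integral_eq_sub_of_hasDerivAt hd]
    · simp [Real.smoothTransition.one_of_one_le hk]
    · apply Continuous.intervalIntegrable
      have := st_deriv_cont
      fun_prop
  · refine Eventually.of_forall fun k => ?_
    apply Continuous.aestronglyMeasurable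
    have := st_deriv_cont
    fun_prop
  · exact hH.continuousOn.integrableOn_Icc
  · exact hH.continuousWithinAt

theorem norm_sq_hasFDeriv {n : ℕ} (x : (𝔼 n)) (j : Fin n) :
    pd (fun x => ‖x‖ ^ 2) j x = 2 * x j := by
  unfold pd
  rw [(hasStrictFDerivAt_norm_sq x).hasFDerivAt.fderiv]
  simp [EuclideanSpace.inner_single_right]

theorem pd_comp {n : ℕ} {φ : (𝔼 n) → ℝ} {h : ℝ → ℝ} {h' : ℝ}
    {x : (𝔼 n)} (hh : HasDerivAt h h' (φ x)) (hφ : DifferentiableAt ℝ φ x)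
    (j : Fin n) : pd (fun x => h (φ x)) j x = h' * pd φ j x := by
  unfold pd
  have := (hh.comp_hasFDerivAt x hφ.hasFDerivAt).fderiv
  simp only [Function.comp_def] at this
  rw [this]; simp

theorem pd_mul {n : ℕ} {a b : (𝔼 n) → ℝ}
    {x : (𝔼 n)} (ha : DifferentiableAt ℝ a x) (hb : DifferentiableAt ℝ b x)
    (j : Fin n) : pd (fun x => a x * b x) j x = a x * pd b j x + pd a j x * b x := by
  unfold pd
  rw [fderiv_fun_mul ha hb]; simp; ring

theorem int_pd_zero {n : ℕ} {φ : (𝔼 n) → ℝ} (h : ContDiff ℝ 1 φ)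
    (hc : HasCompactSupport φ) (j : Fin n) : ∫ x, pd φ j x = 0 := by
  have hpc : HasCompactSupport (pd φ j) := hc.fderiv_apply (𝕜 := ℝ) _
  have := integral_mul_fderiv_eq_neg_fderiv_mul_of_integrable (μ := volume) (f := fun _ => (1:ℝ))
    (g := φ) (v := EuclideanSpace.single j 1) (𝕜 := ℝ) (by simp) (by
      have := (pd_continuous h j).integrable_of_hasCompactSupport (μ := volume) hpc
      simp only [one_mul]; exact this)
    (by simpa using h.continuous.integrable_of_hasCompactSupport hc)
    (by fun_prop) (fun x _ => h.differentiable (by norm_num) x)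
  simpa [pd] using this

theorem int_by_parts {n : ℕ} {φ X : (𝔼 n) → ℝ} (h : ContDiff ℝ 1 φ)
    (hX : ContDiff ℝ 1 X)
    (hc : HasCompactSupport φ) (j : Fin n) : ∫ x, φ x * pd X j x = - ∫ x, X x * pd φ j x := by
  have h0 := int_pd_zero (h.mul hX) hc.mul_right j
  have hpc : HasCompactSupport (pd φ j) := hc.fderiv_apply (𝕜 := ℝ) _
  have : ∀ x, pd (fun x => φ x * X x) j x = φ x * pd X j x + X x * pd φ j x := by
    intro x
    rw [pd_mul (h.differentiable (by norm_num) x) (hX.differentiable (by norm_num) x)]; ring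
  simp only [this] at h0
  rw [integral_add] at h0
  · linarith
  · exact (h.continuous.mul (pd_continuous hX j)).integrable_of_hasCompactSupport hc.mul_right
  · exact (hX.continuous.mul (pd_continuous h j)).integrable_of_hasCompactSupport hpc.mul_left

theorem div_ball_flux {n : ℕ} (hn : 1 ≤ n) (X : Fin n → (𝔼 n) → ℝ)
    (hX : ∀ j, ContDiff ℝ 1 (X j)) {r : ℝ} (hr : 0 < r) :
    r ^ (n - 1) * ∫ ω, ∑ j, X j (r • ω.1) * ω.1 j
      ∂((volume : Measure (𝔼 n)).toSphere) =
    ∫ x in Metric.ball 0 r, ∑ j, pd (X j) j x := by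
  set φ : ℝ → (𝔼 n) → ℝ :=
    fun k x => Real.smoothTransition (k * (r ^ 2 - ‖x‖ ^ 2)) with hφ
  have hns : ContDiff ℝ 1 (fun x : (𝔼 n) => ‖x‖ ^ 2) := contDiff_norm_sq ℝ
  have hφc : ∀ k, ContDiff ℝ 1 (φ k) := fun k =>
    Real.smoothTransition.contDiff.comp (contDiff_const.mul (contDiff_const.sub hns))
  have hφ0 : ∀ k, 0 ≤ k → ∀ x, r ≤ ‖x‖ → φ k x = 0 := by
    intro k hk x hx
    apply Real.smoothTransition.zero_of_nonpos
    apply mul_nonpos_of_nonneg_of_nonpos hk; nlinarith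
  have hφs : ∀ k, 0 ≤ k → HasCompactSupport (φ k) := by
    intro k hk
    apply HasCompactSupport.intro (isCompact_closedBall (0 : (𝔼 n)) r)
    intro x hx
    apply hφ0 k hk
    simp at hx; exact hx.le
  have hφd : ∀ k j x, pd (φ k) j x
      = - (2 * k * x j * deriv Real.smoothTransition (k * (r ^ 2 - ‖x‖ ^ 2))) := by
    intro k j x
    have h1 : HasDerivAt (fun t => Real.smoothTransition (k * (r ^ 2 - t)))
        (deriv Real.smoothTransition (k * (r ^ 2 - ‖x‖ ^ 2)) * (k * (-1))) (‖x‖ ^ 2) := by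
      have := ((hasDerivAt_id (‖x‖ ^ 2)).const_sub (r ^ 2)).const_mul k
      exact (st_hasDeriv (k * (r ^ 2 - ‖x‖ ^ 2))).comp (‖x‖ ^ 2) this
    rw [pd_comp (φ := fun x => ‖x‖ ^ 2) h1 (hns.differentiable (by norm_num) x) j,
      norm_sq_hasFDeriv]
    ring
  have hXc := fun j => (hX j).continuous
  set F : ℝ → ℝ := fun s => ∫ ω, ∑ j, X j (s • ω.1) * ω.1 j
      ∂((volume : Measure (𝔼 n)).toSphere) with hF
  have hFc : Continuous F := by
    have hc : Continuous (Function.uncurry fun (s : ℝ)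
        (ω : Metric.sphere (0 : (𝔼 n)) 1) =>
        ∑ j, X j (s • ω.1) * ω.1 j) := by
      simp only [Function.uncurry_def]; fun_prop
    have := continuous_parametric_integral_of_continuous (s := Set.univ)
      (μ := (volume : Measure (𝔼 n)).toSphere) hc isCompact_univ
    simpa using this
  have lim1 := peak_limit (fun s => s ^ (n - 1) * F s) (by fun_prop) hr
  have lim2 : Tendsto (fun k : ℝ => ∫ x, φ k x * ∑ j, pd (X j) j x) atTop
      (𝓝 (∫ x in Metric.ball 0 r, ∑ j, pd (X j) j x)) := by
    have hpc := fun j => pd_continuous (hX j) j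
    rw [← integral_indicator measurableSet_ball]
    apply tendsto_integral_filter_of_dominated_convergence
      (Set.indicator (Metric.closedBall 0 r) (fun x => ‖∑ j, pd (X j) j x‖))
    · refine Eventually.of_forall fun k => ?_
      apply Continuous.aestronglyMeasurable
      exact (hφc k).continuous.mul (by fun_prop)
    · filter_upwards [eventually_ge_atTop 0] with k hk
      refine Eventually.of_forall fun x => ?_
      by_cases hx : x ∈ Metric.closedBall 0 r
      · rw [Set.indicator_of_mem hx, norm_mul]
        apply mul_le_of_le_one_left (norm_nonneg _)
        rw [Real.norm_of_nonneg (Real.smoothTransition.nonneg _)]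
        exact Real.smoothTransition.le_one _
      · rw [hφ0 k hk]; simp [Set.indicator_of_notMem hx]
        simp at hx; exact hx.le
    · rw [integrable_indicator_iff measurableSet_closedBall]
      exact (Continuous.continuousOn (by fun_prop)).integrableOn_compact (isCompact_closedBall _ _)
    · refine Eventually.of_forall fun x => ?_
      by_cases hx : x ∈ Metric.ball 0 r
      · rw [Set.indicator_of_mem hx]
        have : ∀ᶠ k : ℝ in atTop, 1 ≤ k * (r ^ 2 - ‖x‖ ^ 2) := by
          apply (tendsto_id.atTop_mul_const _).eventually_ge_atTop 1
          simp at hx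
          nlinarith [norm_nonneg x]
        apply tendsto_const_nhds.congr'
        filter_upwards [this] with k hk
        simp only [hφ]
        rw [Real.smoothTransition.one_of_one_le hk, one_mul]
      · rw [Set.indicator_of_notMem hx]
        apply tendsto_const_nhds.congr'
        filter_upwards [eventually_ge_atTop 0] with k hk
        rw [hφ0 k hk]; simp
        simpa using hx
  refine tendsto_nhds_unique (lim1.congr' ?_) lim2
  filter_upwards [eventually_ge_atTop 0] with k hk
  have hpc := fun j => pd_continuous (hX j) j
  have hpp := fun j => pd_continuous (hφc k) j
  have e1 : ∫ x, φ k x * ∑ j, pd (X j) j x = ∫ x, ∑ j, -(X j x * pd (φ k) j x) := by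
    simp only [Finset.mul_sum]
    rw [integral_finsetSum, integral_finsetSum]
    · refine Finset.sum_congr rfl fun j _ => ?_
      rw [int_by_parts (hφc k) (hX j) (hφs k hk), integral_neg]
    · intro j _
      exact ((hXc j).mul (hpp j)).neg.integrable_of_hasCompactSupport
        (((hφs k hk).fderiv_apply (𝕜 := ℝ) _).mul_left.neg)
    · intro j _
      exact ((hφc k).continuous.mul (hpc j)).integrable_of_hasCompactSupport
        (hφs k hk).mul_right
  rw [e1, polar_integral hn]
  · refine setIntegral_congr_fun measurableSet_Ioi fun s hs => ?_
    have hs' : 0 < s := hs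
    simp only [hφd, hF]
    rw [mul_left_comm]
    congr 1
    rw [← integral_const_mul]
    congr 1; ext ω
    have : ‖s • ω.1‖ = s := by
      rw [norm_smul, Real.norm_of_nonneg hs'.le]; simp
    rw [this, Finset.mul_sum]
    refine Finset.sum_congr rfl fun j _ => ?_
    simp; ring
  · apply integrable_finsetSum
    intro j _
    exact ((hXc j).mul (hpp j)).neg.integrable_of_hasCompactSupport
        (((hφs k hk).fderiv_apply (𝕜 := ℝ) _).mul_left.neg)

open scoped Pointwise in
theorem toSphere_rot {n : ℕ} (L : (𝔼 n) ≃ₗᵢ[ℝ] (𝔼 n)) :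
    (((volume : Measure (𝔼 n)).toSphere.map Subtype.val).map L) =
    ((volume : Measure (𝔼 n)).toSphere.map Subtype.val) := by
  have hLm : Measurable L := L.continuous.measurable
  ext A hA
  rw [Measure.map_apply hLm hA, Measure.map_apply measurable_subtype_coe hA,
    Measure.map_apply measurable_subtype_coe (hLm hA), Measure.toSphere_apply' _
      (measurable_subtype_coe hA), Measure.toSphere_apply' _ (measurable_subtype_coe (hLm hA))]
  congr 1
  symm
  rw [← (L.measurePreserving).measure_preimage_equiv (f := L.toMeasurableEquiv)]
  congr 1
  ext x
  simp only [Set.mem_smul, Set.mem_image, Set.mem_preimage, LinearIsometryEquiv.coe_toMeasurableEquiv]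
  constructor
  · rintro ⟨t, ht, y, ⟨z, hz, rfl⟩, h⟩
    refine ⟨t, ht, L.symm z.1, ⟨⟨L.symm z.1, by simp⟩, by simpa using hz, rfl⟩, ?_⟩
    apply L.injective; simp [h]
  · rintro ⟨t, ht, y, ⟨z, hz, rfl⟩, rfl⟩
    refine ⟨t, ht, L z.1, ⟨⟨L z.1, by simp⟩, hz, rfl⟩, by simp⟩

theorem haus_rot {n : ℕ} (d : ℝ)
    (L : (𝔼 n) ≃ₗᵢ[ℝ] (𝔼 n)) :
    ((μH[d].restrict (Metric.sphere (0 : (𝔼 n)) 1)).map L) =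
    (μH[d].restrict (Metric.sphere (0 : (𝔼 n)) 1)) := by
  have h := (L.toIsometryEquiv.measurePreserving_hausdorffMeasure d).restrict_preimage
    (s := Metric.sphere (0 : (𝔼 n)) 1) Metric.isClosed_sphere.measurableSet
  have e : (L.toIsometryEquiv ⁻¹' Metric.sphere (0 : (𝔼 n)) 1)
      = Metric.sphere (0 : (𝔼 n)) 1 := by ext; simp
  rw [e] at h
  exact h.map_eq

open scoped Pointwise in
theorem haus_scale {n : ℕ} (hn : 1 ≤ n) {r : ℝ} (hr : 0 < r) (h : (𝔼 n) → ℝ) :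
    ∫ x in Metric.sphere (0 : (𝔼 n)) r, h x ∂μH[(n:ℝ) - 1] =
    r ^ (n - 1) * ∫ x in Metric.sphere (0 : (𝔼 n)) 1, h (r • x)
      ∂μH[(n:ℝ) - 1] := by
  have hn' : (0:ℝ) ≤ (n:ℝ) - 1 := by
    have : (1:ℝ) ≤ n := by exact_mod_cast hn
    linarith
  have hem : MeasurableEmbedding (fun x : (𝔼 n) => r • x) :=
    (Homeomorph.smulOfNeZero r hr.ne').measurableEmbedding
  have key : μH[(n:ℝ) - 1].restrict (Metric.sphere (0 : (𝔼 n)) r)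
      = ENNReal.ofReal (r ^ (n - 1)) • ((μH[(n:ℝ) - 1].restrict
        (Metric.sphere (0 : (𝔼 n)) 1)).map (fun x => r • x)) := by
    ext A hA
    rw [Measure.restrict_apply hA, Measure.smul_apply, Measure.map_apply hem.measurable hA,
      Measure.restrict_apply (hem.measurable hA)]
    have : A ∩ Metric.sphere (0 : (𝔼 n)) r
        = r • ((fun x => r • x) ⁻¹' A ∩ Metric.sphere 0 1) := by
      ext x
      simp only [Set.mem_inter_iff, Set.mem_smul_set, Set.mem_preimage, mem_sphere_zero_iff_norm]
      constructor
      · rintro ⟨h1, h2⟩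
        have e : r • r⁻¹ • x = x := by rw [smul_smul, mul_inv_cancel₀ hr.ne', one_smul]
        refine ⟨r⁻¹ • x, ⟨by rwa [e], ?_⟩, e⟩
        rw [norm_smul, h2, Real.norm_of_nonneg (by positivity), inv_mul_cancel₀ hr.ne']
      · rintro ⟨y, ⟨h1, h2⟩, rfl⟩
        refine ⟨h1, ?_⟩
        rw [norm_smul, h2, Real.norm_of_nonneg hr.le, mul_one]
    rw [this, Measure.hausdorffMeasure_smul₀ hn' hr.ne']
    rw [ENNReal.smul_def, smul_eq_mul, smul_eq_mul]
    congr 1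
    rw [ENNReal.ofReal, ENNReal.coe_inj]
    ext
    rw [Real.coe_toNNReal _ (by positivity)]
    simp only [NNReal.coe_rpow, coe_nnnorm, Real.norm_of_nonneg hr.le]
    rw [← Real.rpow_natCast, Nat.cast_sub hn]; simp
  rw [key, integral_smul_measure, hem.integral_map, ENNReal.toReal_ofReal (by positivity),
    smul_eq_mul]

theorem haus_flux {n : ℕ} (hn : 1 ≤ n) : ∃ κ : ℝ, 0 ≤ κ ∧
    ∀ X : Fin n → (𝔼 n) → ℝ, (∀ j, ContDiff ℝ 1 (X j)) → ∀ r : ℝ, 0 < r →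
    (1 / sphereVol n) * ∫ x in Metric.sphere (0 : (𝔼 n)) r,
      ∑ j, X j x * (x j / r) ∂μH[(n:ℝ) - 1] = κ * ∫ x in Metric.ball 0 r, ∑ j, pd (X j) j x := by
  by_cases hV : sphereVol n = 0
  · exact ⟨0, le_rfl, fun X hX r hr => by simp [hV]⟩
  set σ := μH[(n:ℝ) - 1].restrict (Metric.sphere (0 : (𝔼 n)) 1) with hσ
  set τ := ((volume : Measure (𝔼 n)).toSphere.map Subtype.val) with hτ
  have : Nonempty (Fin n) := ⟨⟨0, hn⟩⟩
  have : Nontrivial (𝔼 n) := inferInstance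
  have hσf : IsFiniteMeasure σ := by
    constructor
    rw [hσ, Measure.restrict_apply_univ]
    unfold sphereVol at hV
    exact lt_top_iff_ne_top.2 fun h => hV (by simp [h])
  have hτf : IsFiniteMeasure τ := by rw [hτ]; infer_instance
  have hV' : (σ Set.univ).toReal = sphereVol n := by
    rw [hσ, Measure.restrict_apply_univ]; rfl
  have hT : (τ Set.univ).toReal ≠ 0 := by
    rw [hτ, Measure.map_apply measurable_subtype_coe MeasurableSet.univ]
    rw [ne_eq, ENNReal.toReal_eq_zero_iff, not_or]
    exact ⟨by
      rw [Set.preimage_univ, Measure.measure_univ_eq_zero]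
      exact Measure.toSphere_ne_zero (volume : Measure (𝔼 n)), measure_ne_top _ _⟩
  have hp := rotinv_unique σ τ (fun L => haus_rot _ L) (fun L => toSphere_rot L)
    (by
      have := ae_restrict_mem (μ := μH[(n:ℝ) - 1])
        (s := Metric.sphere (0 : (𝔼 n)) 1) Metric.isClosed_sphere.measurableSet
      filter_upwards [this] with x hx; simpa using hx)
    (by
      rw [hτ, (MeasurableEmbedding.subtype_coe Metric.isClosed_sphere.measurableSet).ae_map_iff]
      exact Eventually.of_forall fun x => by simp)
  refine ⟨1 / (τ Set.univ).toReal, by positivity, fun X hX r hr => ?_⟩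
  have hi : ∀ g : (𝔼 n) → ℝ,
      (τ Set.univ).toReal * ∫ x, g x ∂σ = sphereVol n * ∫ x, g x ∂τ := by
    intro g
    have := congrArg (fun μ : Measure (𝔼 n) => ∫ x, g x ∂μ) hp
    simp only [integral_smul_measure, smul_eq_mul] at this
    rw [hV'] at this; exact this
  rw [haus_scale hn hr, ← div_ball_flux hn X hX hr]
  have h2 := hi (fun x => ∑ j, X j (r • x) * ((r • x) j / r))
  rw [hτ, (MeasurableEmbedding.subtype_coe Metric.isClosed_sphere.measurableSet).integral_map,
    ← hτ] at h2
  have e : ∀ (x : (𝔼 n)) j, (r • x) j / r = x j := by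
    intro x j; simp; field_simp
  simp only [e] at h2 ⊢
  field_simp
  linear_combination h2

theorem haus_bound {n : ℕ} (hn : 1 ≤ n) {r ε : ℝ} (hr : 0 < r) (hε : 0 ≤ ε)
    (h : (𝔼 n) → ℝ) (hb : ∀ x, ‖x‖ = r → |h x| ≤ ε) :
    |(1 / sphereVol n) * ∫ x in Metric.sphere (0 : (𝔼 n)) r, h x
      ∂μH[(n:ℝ) - 1]| ≤ r ^ (n - 1) * ε := by
  by_cases hV : sphereVol n = 0
  · simp [hV]; positivity
  have hV0 : 0 < sphereVol n := lt_of_le_of_ne ENNReal.toReal_nonneg (Ne.symm hV)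
  rw [haus_scale hn hr]
  have hf : μH[(n:ℝ) - 1] (Metric.sphere (0 : (𝔼 n)) 1) < ⊤ := by
    unfold sphereVol at hV
    exact lt_top_iff_ne_top.2 fun h => hV (by simp [h])
  have := norm_setIntegral_le_of_norm_le_const (μ := μH[(n:ℝ) - 1]) (C := ε)
    (f := fun x => h (r • x)) hf (fun x hx => hb _ (by
      simp at hx; rw [norm_smul, hx, Real.norm_of_nonneg hr.le, mul_one]))
  have hv : Measure.real μH[(n:ℝ) - 1] (Metric.sphere (0 : (𝔼 n)) 1)
    = sphereVol n := rfl
  rw [hv, Real.norm_eq_abs] at this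
  rw [abs_mul, abs_mul, abs_of_pos (by positivity : 0 < 1 / sphereVol n),
    abs_of_pos (by positivity : 0 < r ^ (n - 1))]
  calc _ ≤ 1 / sphereVol n * (r ^ (n - 1) * (ε * sphereVol n)) := by gcongr
    _ = _ := by field_simp

/-- Partial derivative of a vector valued function. -/
def vd {n : ℕ} {G : Type*} [NormedAddCommGroup G] [NormedSpace ℝ G]
    (φ : (𝔼 n) → G) (i : Fin n) (x : (𝔼 n)) : G :=
  fderiv ℝ φ x (EuclideanSpace.single i 1)

section vdlemmas
variable {n : ℕ} {G H K : Type*} [NormedAddCommGroup G] [NormedSpace ℝ G]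
  [NormedAddCommGroup H] [NormedSpace ℝ H] [NormedAddCommGroup K] [NormedSpace ℝ K]

theorem pd_eq_vd (φ : (𝔼 n) → ℝ) : pd φ = vd φ := rfl

theorem vd_contDiff {φ : (𝔼 n) → G} {k : ℕ} (h : ContDiff ℝ (k + 1 : ℕ) φ)
    (i : Fin n) : ContDiff ℝ k (vd φ i) := by
  unfold vd
  have : ContDiff ℝ k (fderiv ℝ φ) := h.fderiv_right (by norm_cast)
  exact this.clm_apply contDiff_const

theorem vd_continuous {φ : (𝔼 n) → G} (h : ContDiff ℝ 1 φ)
    (i : Fin n) : Continuous (vd φ i) := by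
  unfold vd
  exact (h.continuous_fderiv (by norm_num)).clm_apply continuous_const

theorem vd_add {a b : (𝔼 n) → G} {x : (𝔼 n)}
    (ha : DifferentiableAt ℝ a x) (hb : DifferentiableAt ℝ b x) (j : Fin n) :
    vd (fun x => a x + b x) j x = vd a j x + vd b j x := by
  unfold vd; rw [fderiv_fun_add ha hb]; rfl

theorem vd_sub {a b : (𝔼 n) → G} {x : (𝔼 n)}
    (ha : DifferentiableAt ℝ a x) (hb : DifferentiableAt ℝ b x) (j : Fin n) :
    vd (fun x => a x - b x) j x = vd a j x - vd b j x := by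
  unfold vd; rw [fderiv_fun_sub ha hb]; rfl

theorem vd_sum {ι : Type*} {s : Finset ι} {a : ι → (𝔼 n) → G}
    {x : (𝔼 n)}
    (ha : ∀ i ∈ s, DifferentiableAt ℝ (a i) x) (j : Fin n) :
    vd (fun x => ∑ i ∈ s, a i x) j x = ∑ i ∈ s, vd (a i) j x := by
  unfold vd; rw [fderiv_fun_sum ha]; simp

theorem vd_const (a : G) (x : (𝔼 n)) (j : Fin n) :
    vd (fun _ => a) j x = 0 := by
  unfold vd; simp

theorem vd_smul {a : (𝔼 n) → ℝ} {b : (𝔼 n) → G}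
    {x : (𝔼 n)}
    (ha : DifferentiableAt ℝ a x) (hb : DifferentiableAt ℝ b x) (j : Fin n) :
    vd (fun x => a x • b x) j x = a x • vd b j x + vd a j x • b x := by
  unfold vd; rw [fderiv_fun_smul ha hb]; simp

theorem vd_clm {a : (𝔼 n) → G →L[ℝ] H} {b : (𝔼 n) → G}
    {x : (𝔼 n)}
    (ha : DifferentiableAt ℝ a x) (hb : DifferentiableAt ℝ b x) (j : Fin n) :
    vd (fun x => a x (b x)) j x = a x (vd b j x) + vd a j x (b x) := by
  unfold vd; rw [fderiv_clm_apply ha hb]; simp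

theorem vd_mul {𝔸 : Type*} [NormedRing 𝔸] [NormedAlgebra ℝ 𝔸]
    {a b : (𝔼 n) → 𝔸} {x : (𝔼 n)}
    (ha : DifferentiableAt ℝ a x) (hb : DifferentiableAt ℝ b x) (j : Fin n) :
    vd (fun x => a x * b x) j x = a x * vd b j x + vd a j x * b x := by
  unfold vd; rw [fderiv_fun_mul' ha hb]; simp

theorem vd_inner {F : Type*} [NormedAddCommGroup F] [InnerProductSpace ℝ F]
    {a b : (𝔼 n) → F} {x : (𝔼 n)}
    (ha : DifferentiableAt ℝ a x) (hb : DifferentiableAt ℝ b x) (j : Fin n) :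
    vd (fun x => inner ℝ (a x) (b x)) j x = inner ℝ (a x) (vd b j x) + inner ℝ (vd a j x) (b x) := by
  unfold vd; rw [fderiv_inner_apply ℝ ha hb]

theorem vd_symm {φ : (𝔼 n) → G} (h : ContDiff ℝ 2 φ)
    (i j : Fin n) (x : (𝔼 n)) : vd (vd φ i) j x = vd (vd φ j) i x := by
  have hs := (h.contDiffAt (x := x)).isSymmSndFDerivAt (by simp)
  have hd : DifferentiableAt ℝ (fderiv ℝ φ) x :=
    (h.fderiv_right (m := 1) (by norm_num)).differentiable (by norm_num) x
  have e : ∀ i j, vd (vd φ i) j x =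
      fderiv ℝ (fderiv ℝ φ) x (EuclideanSpace.single j 1) (EuclideanSpace.single i 1) := by
    intro i j
    unfold vd
    rw [fderiv_clm_apply hd (by fun_prop)]; simp
  rw [e, e, hs.eq]
end vdlemmas

/-- Abstract Dirac structure on ℝ^n. -/
structure DS (n : ℕ) (F : Type*) [NormedAddCommGroup F] [InnerProductSpace ℝ F] where
  c : Fin n → (𝔼 n) → F →L[ℝ] F
  Om : Fin n → (𝔼 n) → F →L[ℝ] F
  w : (𝔼 n) → ℝ
  S : (𝔼 n) → ℝ
  hc : ∀ i, ContDiff ℝ 1 (c i)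
  hOm : ∀ i, ContDiff ℝ 1 (Om i)
  hw : ContDiff ℝ 1 w
  c_skew : ∀ i x u v, inner ℝ (c i x u) v = - inner ℝ u (c i x v)
  Om_skew : ∀ i x u v, inner ℝ (Om i x u) v = - inner ℝ u (Om i x v)
  divc : ∀ x, ∑ i, (vd w i x • c i x + w x • (vd (c i) i x + Om i x * c i x - c i x * Om i x)) = 0
  divs : ∀ x j, ∑ i, (vd w i x • (c i x * c j x - c j x * c i x)
    + w x • (vd (fun y => c i y * c j y - c j y * c i y) i x
      + Om i x * (c i x * c j x - c j x * c i x) - (c i x * c j x - c j x * c i x) * Om i x)) = 0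
  curv : ∀ x, ∑ i, ∑ j, (c i x * c j x - c j x * c i x) * (vd (Om j) i x + Om i x * Om j x)
    = (S x / 2) • 1

namespace DS
variable {n : ℕ} {F : Type*} [NormedAddCommGroup F] [InnerProductSpace ℝ F] (d : DS n F)

/-- Commutator. -/
def sg (i j : Fin n) (x : (𝔼 n)) : F →L[ℝ] F :=
  d.c i x * d.c j x - d.c j x * d.c i x

/-- Covariant derivative. -/
def nab (i : Fin n) (ψ : (𝔼 n) → F) (x : (𝔼 n)) : F :=
  vd ψ i x + d.Om i x (ψ x)

/-- Dirac operator. -/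
def D (ψ : (𝔼 n) → F) (x : (𝔼 n)) : F :=
  ∑ i, d.c i x (d.nab i ψ x)

/-- The Witten current. -/
def W (ψ : (𝔼 n) → F) (i : Fin n) (x : (𝔼 n)) : ℝ :=
  d.w x * inner ℝ (ψ x) (∑ j, d.sg i j x (d.nab j ψ x)) / 2

/-- The quadratic form of the metric. -/
def Q (x : (𝔼 n)) (v : Fin n → F) : ℝ :=
  - ∑ i, ∑ j, inner ℝ (v i) ((d.c i x * d.c j x + d.c j x * d.c i x) (v j)) / 2

theorem hsg (i j : Fin n) : ContDiff ℝ 1 (d.sg i j) := by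
  unfold sg
  exact ((d.hc i).clm_comp (d.hc j)).sub ((d.hc j).clm_comp (d.hc i))

theorem hnab (i : Fin n) {ψ : (𝔼 n) → F} (h : ContDiff ℝ 2 ψ) :
    ContDiff ℝ 1 (d.nab i ψ) := by
  have h1 : ContDiff ℝ 1 ψ := h.of_le (by norm_num)
  exact (vd_contDiff (k := 1) h i).add ((d.hOm i).clm_apply h1)

theorem hW (i : Fin n) {ψ : (𝔼 n) → F} (h : ContDiff ℝ 2 ψ) :
    ContDiff ℝ 1 (d.W ψ i) := by
  have h1 : ContDiff ℝ 1 ψ := h.of_le (by norm_num)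
  exact (d.hw.mul (h1.inner ℝ (ContDiff.sum fun j _ => (d.hsg i j).clm_apply
    (d.hnab j h)))).div_const 2

theorem sum_sg (x : (𝔼 n)) (v : Fin n → F) :
    ∑ i, ∑ j, inner ℝ (v i) (d.sg i j x (v j)) =
      2 * (d.Q x v - ‖∑ i, d.c i x (v i)‖ ^ 2) := by
  have e : ‖∑ i, d.c i x (v i)‖ ^ 2 = - ∑ i, ∑ j, inner ℝ (v i) ((d.c i x * d.c j x) (v j)) := by
    rw [← real_inner_self_eq_norm_sq, sum_inner, ← Finset.sum_neg_distrib]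
    refine Finset.sum_congr rfl fun i _ => ?_
    rw [inner_sum, ← Finset.sum_neg_distrib]
    refine Finset.sum_congr rfl fun j _ => ?_
    rw [d.c_skew]; rfl
  rw [e]
  unfold Q sg
  rw [sub_neg_eq_add, ← Finset.sum_neg_distrib, ← Finset.sum_add_distrib, Finset.mul_sum]
  refine Finset.sum_congr rfl fun i _ => ?_
  rw [← Finset.sum_neg_distrib, ← Finset.sum_add_distrib, Finset.mul_sum]
  refine Finset.sum_congr rfl fun j _ => ?_
  simp only [_root_.sub_apply, _root_.add_apply, inner_sub_right,
    inner_add_right]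
  ring

theorem div_W {ψ : (𝔼 n) → F} (h : ContDiff ℝ 2 ψ)
    (x : (𝔼 n)) :
    ∑ i, pd (d.W ψ i) i x = d.w x * (d.Q x (fun i => d.nab i ψ x) - ‖d.D ψ x‖ ^ 2
      + d.S x / 4 * ‖ψ x‖ ^ 2) := by
  have h1 : ContDiff ℝ 1 ψ := h.of_le (by norm_num)
  have dψ := h1.differentiable (by norm_num) x
  have dw := d.hw.differentiable (by norm_num) x
  have dsg := fun i j => (d.hsg i j).differentiable (by norm_num) x
  have dnab := fun j => (d.hnab j h).differentiable (by norm_num) x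
  have dOm := fun j => (d.hOm j).differentiable (by norm_num) x
  have dvd := fun j => (vd_contDiff (k := 1) h j).differentiable (by norm_num) x
  have dsum : ∀ i, DifferentiableAt ℝ (fun y => ∑ j, d.sg i j y (d.nab j ψ y)) x := by
    intro i
    exact DifferentiableAt.fun_sum fun j _ => (dsg i j).clm_apply (dnab j)
  have e1 : ∀ i, pd (d.W ψ i) i x = (∑ j,
      (d.w x * inner ℝ (d.nab i ψ x) (d.sg i j x (d.nab j ψ x))
      + inner ℝ (ψ x) ((vd d.w i x • d.sg i j x + d.w x • (vd (d.sg i j) i x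
        + d.Om i x * d.sg i j x - d.sg i j x * d.Om i x)) (d.nab j ψ x))
      + d.w x * inner ℝ (ψ x) (d.sg i j x ((vd (d.Om j) i x + d.Om i x * d.Om j x) (ψ x)))
      + d.w x * inner ℝ (ψ x) (d.sg i j x (d.Om i x (vd ψ j x) + d.Om j x (vd ψ i x)
          + vd (vd ψ j) i x)))) / 2 := by
    intro i
    have e0 : pd (fun x => d.w x * inner ℝ (ψ x) (∑ j, d.sg i j x (d.nab j ψ x)) / 2) i x
      = pd (fun x => d.w x * inner ℝ (ψ x) (∑ j, d.sg i j x (d.nab j ψ x))) i x / 2 := by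
      unfold pd
      simp only [div_eq_mul_inv]
      rw [fderiv_mul_const (dw.fun_mul (dψ.inner ℝ (dsum i)))]
      simp [mul_comm]
    refine e0.trans ?_
    congr 1
    rw [pd_mul dw (dψ.inner ℝ (dsum i)), pd_eq_vd, vd_inner dψ (dsum i),
      vd_sum fun j _ => (dsg i j).clm_apply (dnab j)]
    simp only [inner_sum, Finset.mul_sum, ← Finset.sum_add_distrib]
    refine Finset.sum_congr rfl fun j _ => ?_
    rw [vd_clm (dsg i j) (dnab j)]
    have e2 : vd (d.nab j ψ) i x = vd (vd ψ j) i x + (d.Om j x (vd ψ i x)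
        + vd (d.Om j) i x (ψ x)) := by
      rw [← vd_clm (dOm j) dψ, ← vd_add (dvd j) ((dOm j).clm_apply dψ)]; rfl
    have e3 : ∀ u, inner ℝ (d.Om i x (ψ x)) u = - inner ℝ (ψ x) (d.Om i x u) :=
      fun u => d.Om_skew i x _ u
    rw [e2]
    have hmul : ∀ (A B : F →L[ℝ] F) (u : F), (A * B) u = A (B u) := fun _ _ _ => rfl
    simp only [nab, map_add, inner_add_right, inner_add_left, inner_sub_right,
      _root_.add_apply, _root_.sub_apply, _root_.smul_apply,
      inner_smul_right, e3, hmul, pd_eq_vd]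
    ring
  have hsym : ∑ i, ∑ j, d.w x * inner ℝ (ψ x) (d.sg i j x (d.Om i x (vd ψ j x)
      + d.Om j x (vd ψ i x) + vd (vd ψ j) i x)) = 0 := by
    set T := ∑ i, ∑ j, d.w x * inner ℝ (ψ x) (d.sg i j x (d.Om i x (vd ψ j x)
      + d.Om j x (vd ψ i x) + vd (vd ψ j) i x)) with hT
    have : T = - T := by
      conv_lhs => rw [hT, Finset.sum_comm]
      rw [hT, ← Finset.sum_neg_distrib]
      refine Finset.sum_congr rfl fun i _ => ?_
      rw [← Finset.sum_neg_distrib]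
      refine Finset.sum_congr rfl fun j _ => ?_
      have : d.sg j i x = - d.sg i j x := by unfold sg; abel
      rw [this, vd_symm h i j, add_comm (d.Om j x _)]
      simp [inner_add_right, inner_neg_right]; ring
    linarith
  have hdiv : ∑ i, ∑ j, inner ℝ (ψ x) ((vd d.w i x • d.sg i j x + d.w x • (vd (d.sg i j) i x
        + d.Om i x * d.sg i j x - d.sg i j x * d.Om i x)) (d.nab j ψ x)) = (0:ℝ) := by
    rw [Finset.sum_comm]
    refine Finset.sum_eq_zero fun j _ => ?_
    rw [← inner_sum, ← _root_.sum_apply]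
    have := d.divs x j
    unfold sg
    rw [this]; simp
  have hcurv : ∑ i, ∑ j, d.w x * inner ℝ (ψ x) (d.sg i j x ((vd (d.Om j) i x
      + d.Om i x * d.Om j x) (ψ x))) = d.w x * (d.S x / 2 * ‖ψ x‖ ^ 2) := by
    simp only [← Finset.mul_sum, ← inner_sum]
    congr 1
    have := congrArg (fun T : F →L[ℝ] F => inner ℝ (ψ x) (T (ψ x))) (d.curv x)
    simp only [_root_.sum_apply, _root_.smul_apply, inner_smul_right,
      one_apply_eq_self, real_inner_self_eq_norm_sq] at this
    rw [← this]; rfl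
  have hsq := d.sum_sg x (fun i => d.nab i ψ x)
  simp only [e1, ← Finset.sum_div, Finset.sum_add_distrib]
  rw [hsym, hdiv, hcurv]
  simp only [← Finset.mul_sum]
  rw [hsq]
  unfold D
  ring
end DS

section moll
open scoped ENNReal
variable {n : ℕ} {F : Type*} [NormedAddCommGroup F] 

theorem trans_cont {ζ : (𝔼 n) → F} (hζ : MemLp ζ 2) {ε : ℝ} (hε : 0 < ε) :
    ∃ δ > 0, ∀ t : (𝔼 n), ‖t‖ ≤ δ →
      eLpNorm (fun y => ζ (y - t) - ζ y) 2 ≤ ENNReal.ofReal ε := by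
  have : Fact ((1:ℝ≥0∞) ≤ 2) := ⟨by norm_num⟩
  have : Fact ((2:ℝ≥0∞) ≠ ∞) := ⟨by norm_num⟩
  have hc : Continuous fun t : (𝔼 n) => (DomAddAct.mk t) +ᵥ (hζ.toLp ζ) :=
    (continuous_id.vadd continuous_const).comp (DomAddAct.continuous_mk)
  have h0 := Metric.continuous_iff.1 hc 0 ε hε
  obtain ⟨δ, hδ, h⟩ := h0
  refine ⟨δ / 2, by positivity, fun t ht => ?_⟩
  have h1 := h (-t) (by simp; linarith)
  rw [DomAddAct.mk_vadd_toLp, DomAddAct.mk_vadd_toLp, dist_eq_norm, ← MemLp.toLp_sub,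
    Lp.norm_toLp] at h1
  have h2 : eLpNorm (fun y => ζ (y - t) - ζ y) 2 ≠ ⊤ := by
    have := ((hζ.comp_measurePreserving (measurePreserving_sub_right volume t)).sub hζ).eLpNorm_ne_top
    simpa [Pi.sub_def] using this
  rw [ENNReal.le_ofReal_iff_toReal_le h2 hε.le]
  refine le_of_eq_of_le ?_ h1.le
  congr 2
  ext y
  simp [vadd_eq_add, sub_eq_neg_add]

theorem prob_sq {α : Type*} [MeasurableSpace α] (μ : Measure α) [IsProbabilityMeasure μ]
    {h : α → ℝ≥0∞} (hm : AEMeasurable h μ) : (∫⁻ t, h t ∂μ) ^ 2 ≤ ∫⁻ t, h t ^ 2 ∂μ := by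
  have := ENNReal.lintegral_mul_le_Lp_mul_Lq μ Real.HolderConjugate.two_two hm
    (g := fun _ => 1) aemeasurable_const
  simp only [Pi.mul_apply, mul_one, ENNReal.one_rpow, lintegral_const, measure_univ] at this
  calc _ ≤ ((∫⁻ t, h t ^ (2:ℝ) ∂μ) ^ (1 / (2:ℝ))) ^ 2 := by gcongr
    _ = _ := by
      rw [← ENNReal.rpow_natCast, ← ENNReal.rpow_mul]
      simp

theorem eLpNorm_two_sq {α : Type*} [MeasurableSpace α] (μ : Measure α) {G : Type*} [ENorm G]
    (f : α → G) : eLpNorm f 2 μ ^ 2 = ∫⁻ x, ‖f x‖ₑ ^ 2 ∂μ := by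
  rw [eLpNorm_eq_lintegral_rpow_enorm_toReal (by norm_num) (by norm_num), ← ENNReal.rpow_natCast,
    ← ENNReal.rpow_mul]
  simp

theorem moll_core (μ : Measure (𝔼 n)) [IsProbabilityMeasure μ]
    {h : (𝔼 n) → (𝔼 n) → ℝ≥0∞}
    (hm : Measurable (Function.uncurry h)) (K : ℝ≥0∞)
    (hK : ∀ᵐ t ∂μ, eLpNorm (fun y => h y t) 2 volume ≤ K) :
    eLpNorm (fun y => ∫⁻ t, h y t ∂μ) 2 volume ≤ K := by
  have : (eLpNorm (fun y => ∫⁻ t, h y t ∂μ) 2 volume) ^ 2 ≤ K ^ 2 := by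
    rw [eLpNorm_two_sq]
    simp only [enorm_eq_self]
    calc _ ≤ ∫⁻ y, ∫⁻ t, h y t ^ 2 ∂μ := by
          gcongr with y
          exact prob_sq μ (hm.of_uncurry_left.aemeasurable)
      _ = ∫⁻ t, (∫⁻ y, h y t ^ 2) ∂μ := lintegral_lintegral_swap (hm.pow_const 2).aemeasurable
      _ ≤ ∫⁻ t, K ^ 2 ∂μ := by
          apply lintegral_mono_ae
          filter_upwards [hK] with t ht
          have := eLpNorm_two_sq volume (fun y => h y t)
          simp only [enorm_eq_self] at this
          rw [← this]; gcongr
      _ = _ := by simp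
  exact (ENNReal.pow_le_pow_left_iff (by norm_num)).1 this

theorem meas_diff {ζ : (𝔼 n) → F} (hζ : StronglyMeasurable ζ) :
    Measurable (Function.uncurry fun y t : (𝔼 n) => ‖ζ (y - t) - ζ y‖ₑ) := by
  have h1 : StronglyMeasurable fun z : (𝔼 n) × (𝔼 n) =>
      ζ (z.1 - z.2) - ζ z.1 :=
      (hζ.comp_measurable (measurable_fst.sub measurable_snd)).sub (hζ.comp_measurable measurable_fst)
  exact h1.enorm

theorem meas_shift {ζ : (𝔼 n) → F} (hζ : StronglyMeasurable ζ) :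
    Measurable (Function.uncurry fun y t : (𝔼 n) => ‖ζ (y - t)‖ₑ) := by
  have h1 : StronglyMeasurable fun z : (𝔼 n) × (𝔼 n) =>
      ζ (z.1 - z.2) :=
      (hζ.comp_measurable (measurable_fst.sub measurable_snd))
  exact h1.enorm

theorem moll_gen (μ : Measure (𝔼 n)) [IsProbabilityMeasure μ]
    {h : (𝔼 n) → (𝔼 n) → ℝ≥0∞}
    (hm : Measurable (Function.uncurry h)) {C K : ℝ≥0∞}
    (hK : ∀ᵐ t ∂μ, eLpNorm (fun y => h y t) 2 volume ≤ K)
    {G : (𝔼 n) → F}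
    (hG : ∀ y, ‖G y‖ₑ ≤ C * ∫⁻ t, h y t ∂μ) :
    eLpNorm G 2 volume ≤ C * K := by
  have h0 := moll_core μ hm K hK
  rw [← ENNReal.pow_le_pow_left_iff (n := 2) (by norm_num)] at h0 ⊢
  rw [eLpNorm_two_sq] at h0 ⊢
  simp only [enorm_eq_self] at h0
  calc ∫⁻ y, ‖G y‖ₑ ^ 2 ≤ ∫⁻ y, C ^ 2 * (∫⁻ t, h y t ∂μ) ^ 2 := by
        refine lintegral_mono fun y => ?_
        rw [← mul_pow]
        gcongr
        exact hG y
    _ = C ^ 2 * ∫⁻ y, (∫⁻ t, h y t ∂μ) ^ 2 := by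
        rw [lintegral_const_mul]
        exact (Measurable.lintegral_prod_right hm).pow_const 2
    _ ≤ _ := by rw [mul_pow]; gcongr

end moll

section fried
open scoped ENNReal Convolution
variable {n : ℕ}

theorem int_vd_zero {G : Type*} [NormedAddCommGroup G] [NormedSpace ℝ G]
    {φ : (𝔼 n) → G} (h : ContDiff ℝ 1 φ)
    (hc : HasCompactSupport φ) (j : Fin n) : ∫ x, vd φ j x = 0 := by
  have hpc : HasCompactSupport (vd φ j) := hc.fderiv_apply (𝕜 := ℝ) _
  have := integral_smul_fderiv_eq_neg_fderiv_smul_of_integrable (μ := volume) (f := fun _ => (1:ℝ))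
    (g := φ) (v := EuclideanSpace.single j 1) (𝕜 := ℝ) (by simp) (by
      have := (vd_continuous h j).integrable_of_hasCompactSupport (μ := volume) hpc
      simp only [one_smul]; exact this)
    (by simpa using h.continuous.integrable_of_hasCompactSupport hc)
    (by fun_prop) (fun x _ => h.differentiable (by norm_num) x)
  simpa [vd] using this

theorem moll_exists (n : ℕ) : ∃ P : ℝ, 0 ≤ P ∧ ∀ δ : ℝ, 0 < δ → 
    ∃ ρ : (𝔼 n) → ℝ, ContDiff ℝ 2 ρ ∧ HasCompactSupport ρ ∧
    (∀ x, δ < ‖x‖ → ρ x = 0) ∧ (∀ i x, δ < ‖x‖ → pd ρ i x = 0) ∧ ∫ x, ρ x = 1 ∧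
    (∀ x, |ρ x| ≤ P / δ ^ n) ∧ (∀ i x, |pd ρ i x| ≤ P / δ ^ n / δ) := by
  let β : ContDiffBump (0 : (𝔼 n)) := ⟨1 / 2, 1, by norm_num, by norm_num⟩
  set η := β.normed volume with hη
  have hη2 : ContDiff ℝ 2 η := β.contDiff_normed
  have hηc : HasCompactSupport η := β.hasCompactSupport_normed
  obtain ⟨P0, hP0⟩ := hη2.continuous.bounded_above_of_compact_support hηc
  have hηd : ∀ i, ∃ P, ∀ x, ‖pd η i x‖ ≤ P := fun i =>
    (pd_continuous (hη2.of_le (by norm_num)) i).bounded_above_of_compact_support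
      (hηc.fderiv_apply (𝕜 := ℝ) _)
  choose P1 hP1 using hηd
  have hP00 : 0 ≤ P0 := (norm_nonneg _).trans (hP0 0)
  have hP10 : ∀ i, 0 ≤ P1 i := fun i => (norm_nonneg _).trans (hP1 i 0)
  refine ⟨P0 + ∑ i, P1 i, add_nonneg hP00 (Finset.sum_nonneg fun i _ => hP10 i), fun δ hδ => ?_⟩
  have hz : ∀ x, 1 ≤ ‖x‖ → η x = 0 := by
    intro x hx
    by_contra h
    have : x ∈ Function.support η := h
    rw [hη, β.support_normed_eq] at this
    simp at this
    have e : β.rOut = 1 := rfl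
    linarith
  set ρ : (𝔼 n) → ℝ := fun x => (δ ^ n)⁻¹ * η (δ⁻¹ • x) with hρ
  have hz1 : ∀ x, δ < ‖x‖ → ρ x = 0 := by
    intro x hx
    simp only [hρ]
    rw [hz]; · simp
    rw [norm_smul, norm_inv, Real.norm_of_nonneg hδ.le, inv_mul_eq_div, one_le_div hδ]
    exact hx.le
  have hd : ContDiff ℝ 2 ρ := contDiff_const.mul (hη2.comp (contDiff_const_smul _))
  have hpd : ∀ i x, pd ρ i x = (δ ^ n)⁻¹ * (δ⁻¹ * pd η i (δ⁻¹ • x)) := by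
    intro i x
    have h1 : HasFDerivAt η (fderiv ℝ η (δ⁻¹ • x)) (δ⁻¹ • x) :=
      (hη2.differentiable (by norm_num) _).hasFDerivAt
    have h2 : HasFDerivAt (fun x : (𝔼 n) => δ⁻¹ • x)
        (δ⁻¹ • ContinuousLinearMap.id ℝ _) x := (hasFDerivAt_id x).fun_const_smul _
    have h3 := (h1.comp x h2).const_mul (δ ^ n)⁻¹
    unfold pd
    have h4 : fderiv ℝ ρ x = _ := h3.fderiv
    rw [h4]
    simp
  refine ⟨ρ, hd, ?_, hz1, ?_, ?_, ?_, ?_⟩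
  · refine HasCompactSupport.intro (isCompact_closedBall 0 δ) fun x hx => hz1 x ?_
    simpa using hx
  · intro i x hx
    unfold pd
    have : ρ =ᶠ[𝓝 x] fun _ => 0 := by
      filter_upwards [(isOpen_lt continuous_const continuous_norm).mem_nhds hx] with y hy
      exact hz1 y hy
    rw [this.fderiv_eq]; simp
  · simp only [hρ]
    rw [integral_const_mul, Measure.integral_comp_smul]
    rw [β.integral_normed]
    simp
    rw [abs_of_pos hδ]
    field_simp
  · intro x
    simp only [hρ]
    rw [abs_mul, abs_of_pos (by positivity), inv_mul_eq_div]
    gcongr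
    exact (hP0 _).trans (by simp; exact Finset.sum_nonneg fun i _ => hP10 i)
  · intro i x
    rw [hpd, abs_mul, abs_mul, abs_of_pos (by positivity), abs_of_pos (by positivity)]
    have := (hP1 i (δ⁻¹ • x)).trans (Finset.single_le_sum (fun i _ => hP10 i) (Finset.mem_univ i))
    rw [div_div, inv_mul_eq_div, inv_mul_eq_div, div_div, mul_comm δ]
    gcongr
    exact this.trans (by linarith)

/-- Uniform probability on a ball. -/
def bp (n : ℕ) (δ : ℝ) : Measure (𝔼 n) :=
  (volume (Metric.closedBall (0 : (𝔼 n)) δ))⁻¹ •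
    volume.restrict (Metric.closedBall 0 δ)

theorem bp_prob {δ : ℝ} (hδ : 0 < δ) : IsProbabilityMeasure (bp n δ) := by
  constructor
  simp only [bp, Measure.smul_apply, Measure.restrict_apply MeasurableSet.univ, Set.univ_inter,
    smul_eq_mul]
  exact ENNReal.inv_mul_cancel (Metric.measure_closedBall_pos _ _ hδ).ne' measure_closedBall_lt_top.ne

theorem bp_ae (δ : ℝ) : ∀ᵐ t ∂(bp n δ), ‖t‖ ≤ δ := by
  refine Measure.ae_smul_measure ?_ _
  filter_upwards [ae_restrict_mem Metric.isClosed_closedBall.measurableSet] with t ht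
  simpa using ht

/-- Volume of the unit ball. -/
def vB (n : ℕ) : ℝ := (volume (Metric.closedBall (0 : (𝔼 n)) 1)).toReal

theorem kern_bound {F G : Type*} [NormedAddCommGroup F] [NormedSpace ℝ F] [NormedAddCommGroup G]
    {δ C : ℝ} (hδ : 0 < δ) (hC : 0 ≤ C) {k : (𝔼 n) → F}
    {h : (𝔼 n) → G}
    (hz : ∀ t, δ < ‖t‖ → k t = 0) (hk : ∀ t, ‖t‖ ≤ δ → ‖k t‖ ≤ C / δ ^ n * ‖h t‖) :
    ‖∫ t, k t‖ₑ ≤ ENNReal.ofReal (C * vB n) * ∫⁻ t, ‖h t‖ₑ ∂(bp n δ) := by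
  refine (enorm_integral_le_lintegral_enorm _).trans ?_
  have hv : volume (Metric.closedBall (0 : (𝔼 n)) δ) =
      ENNReal.ofReal (δ ^ n) * ENNReal.ofReal (vB n) := by
    rw [vB, ENNReal.ofReal_toReal measure_closedBall_lt_top.ne]
    have := Measure.addHaar_closedBall_mul volume (0 : (𝔼 n)) hδ.le (s := 1)
      zero_le_one
    simpa using this
  have hvp : 0 < vB n := ENNReal.toReal_pos (Metric.measure_closedBall_pos _ _ one_pos).ne'
    measure_closedBall_lt_top.ne
  rw [bp, lintegral_smul_measure, smul_eq_mul, ← mul_assoc, hv, ← ENNReal.ofReal_mul (by positivity),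
    ← ENNReal.ofReal_inv_of_pos (by positivity), ← ENNReal.ofReal_mul (by positivity)]
  have e : C * vB n * (δ ^ n * vB n)⁻¹ = C / δ ^ n := by field_simp
  rw [e, ← lintegral_const_mul' _ _ ENNReal.ofReal_ne_top]
  rw [← lintegral_indicator Metric.isClosed_closedBall.measurableSet]
  refine lintegral_mono fun t => ?_
  by_cases ht : ‖t‖ ≤ δ
  · rw [Set.indicator_of_mem (by simpa using ht)]
    rw [← ofReal_norm, ← ofReal_norm, ← ENNReal.ofReal_mul (by positivity)]
    exact ENNReal.ofReal_le_ofReal (hk t ht)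
  · rw [hz t (not_le.1 ht)]; simp
end fried

section fried2
open scoped ENNReal Convolution
variable {n : ℕ} {F : Type*} [NormedAddCommGroup F] [InnerProductSpace ℝ F] [FiniteDimensional ℝ F]

/-- First order operator. -/
def MM (a : Fin n → (𝔼 n) → F →L[ℝ] F) (b : (𝔼 n) → F →L[ℝ] F)
    (φ : (𝔼 n) → F) (x : (𝔼 n)) : F :=
  ∑ i, a i x (vd φ i x) + b x (φ x)

theorem conv_int {ζ : (𝔼 n) → F} (hζ : LocallyIntegrable ζ)
    {k : (𝔼 n) → F →L[ℝ] F} (hk : Continuous k) (hc : HasCompactSupport k)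
    (y : (𝔼 n)) : Integrable fun t => k t (ζ (y - t)) :=
  hc.convolutionExists_left (ContinuousLinearMap.id ℝ (F →L[ℝ] F)) hk hζ y

theorem conv_vd {ζ : (𝔼 n) → F} (hζ : LocallyIntegrable ζ)
    {ρ : (𝔼 n) → ℝ} (hρ : ContDiff ℝ 2 ρ) (hc : HasCompactSupport ρ) :
    ContDiff ℝ 2 (fun y => ∫ t, ρ t • ζ (y - t)) ∧
    ∀ i y, vd (fun y => ∫ t, ρ t • ζ (y - t)) i y = ∫ t, pd ρ i t • ζ (y - t) := by
  have e : (fun y => ∫ t, ρ t • ζ (y - t)) = (ρ ⋆[ContinuousLinearMap.lsmul ℝ ℝ, volume] ζ) := by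
    ext y; rfl
  rw [e]
  have hρ1 : ContDiff ℝ 1 ρ := hρ.of_le (by norm_num)
  refine ⟨hc.contDiff_convolution_left _ (n := 2) (by exact_mod_cast hρ) hζ, fun i y => ?_⟩
  have h1 := hc.hasFDerivAt_convolution_left (ContinuousLinearMap.lsmul ℝ ℝ (E := F)) hρ1 hζ y
  unfold vd
  rw [h1.fderiv]
  have h2 := (hc.fderiv ℝ).convolutionExists_left
    ((ContinuousLinearMap.lsmul ℝ ℝ (E := F)).precompL (𝔼 n))
    (hρ1.continuous_fderiv (by norm_num)) hζ y
  rw [convolution_def, ContinuousLinearMap.integral_apply h2]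
  rfl

theorem weak_conv {a : Fin n → (𝔼 n) → F →L[ℝ] F}
    {b : (𝔼 n) → F →L[ℝ] F} (ha : ∀ i, ContDiff ℝ 1 (a i)) (hb : Continuous b)
    (hsk : ∀ i x u v, inner ℝ (a i x u) v = - inner ℝ u (a i x v))
    (hbs : ∀ x u v, inner ℝ (b x u) v = inner ℝ u ((b x - ∑ i, vd (a i) i x) v))
    {ζ : (𝔼 n) → F} (hζ : LocallyIntegrable ζ)
    (ho : ∀ φ : (𝔼 n) → F, ContDiff ℝ 2 φ → HasCompactSupport φ →
      ∫ x, inner ℝ (MM a b φ x) (ζ x) = 0)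
    {ρ : (𝔼 n) → ℝ} (hρ : ContDiff ℝ 2 ρ) (hc : HasCompactSupport ρ)
    (y : (𝔼 n)) :
    ∫ t, (∑ i, pd ρ i t • a i (y - t) + ρ t • (b (y - t) - ∑ i, vd (a i) i (y - t)))
      (ζ (y - t)) = 0 := by
  have hρ1 : ContDiff ℝ 1 ρ := hρ.of_le (by norm_num)
  set k : (𝔼 n) → F →L[ℝ] F := fun t =>
    (∑ i, pd ρ i t • a i (y - t) + ρ t • (b (y - t) - ∑ i, vd (a i) i (y - t))) with hk
  have hcp : ∀ i, HasCompactSupport (pd ρ i) := fun i => hc.fderiv_apply (𝕜 := ℝ) _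
  have hkc : Continuous k := by
    have h1 : ∀ i, Continuous (vd (a i) i) := fun i => vd_continuous (ha i) i
    have h2 : ∀ i, Continuous (pd ρ i) := fun i => pd_continuous hρ1 i
    have h3 : ∀ i, Continuous (a i) := fun i => (ha i).continuous
    have h4 := hρ.continuous
    fun_prop
  have hks : HasCompactSupport k := by
    refine HasCompactSupport.intro hc fun x hx => ?_
    have e1 : ρ x = 0 := image_eq_zero_of_notMem_tsupport hx
    have e2 : ∀ i, pd ρ i x = 0 := fun i => by
      have : x ∉ tsupport (fderiv ℝ ρ) := fun h => hx (tsupport_fderiv_subset ℝ h)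
      unfold pd
      rw [image_eq_zero_of_notMem_tsupport this]; rfl
    simp [hk, e1, e2]
  have hI := conv_int hζ hkc hks y
  refine ext_inner_left ℝ fun v => ?_
  rw [← integral_inner hI, inner_zero_right]
  have h := ho (fun z => ρ (y - z) • v)
    ((hρ.comp (contDiff_const.sub contDiff_id)).smul contDiff_const) (by
      have : HasCompactSupport (fun z => ρ (y - z)) := by
        have := hc.comp_homeomorph (Homeomorph.subLeft y)
        exact this
      exact this.smul_right)
  rw [← integral_sub_left_eq_self _ volume y] at h
  rw [← h]
  congr 1
  ext t
  have hvd : ∀ i, vd (fun z => ρ (y - z) • v) i (y - t) = - (pd ρ i t • v) := by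
    intro i
    have h1 : HasFDerivAt ρ (fderiv ℝ ρ t) (y - (y - t)) := by
      rw [sub_sub_cancel]; exact (hρ.differentiable (by norm_num) _).hasFDerivAt
    have h2 : HasFDerivAt (fun z : (𝔼 n) => y - z)
        (-ContinuousLinearMap.id ℝ _) (y - t) := (hasFDerivAt_id _).const_sub y
    have h3 := (h1.comp (y - t) h2).smul_const v
    unfold vd pd
    have h4 : fderiv ℝ (fun z => ρ (y - z) • v) (y - t) = _ := h3.fderiv
    rw [h4]
    simp
  simp only [MM, hvd, sub_sub_cancel]
  rw [inner_add_left, map_smul, inner_smul_left, hbs, sum_inner]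
  simp only [hk, map_neg, map_smul, inner_neg_left, inner_smul_left, hsk, _root_.add_apply,
    _root_.sum_apply, _root_.smul_apply, inner_add_right, inner_sum, inner_smul_right]
  simp
end fried2

section fried3
open scoped ENNReal Convolution
variable {n : ℕ} {F : Type*} [NormedAddCommGroup F] [InnerProductSpace ℝ F] [FiniteDimensional ℝ F]

theorem MM_conv {a : Fin n → (𝔼 n) → F →L[ℝ] F}
    {b : (𝔼 n) → F →L[ℝ] F} (ha : ∀ i, ContDiff ℝ 1 (a i)) (hb : Continuous b)
    (hsk : ∀ i x u v, inner ℝ (a i x u) v = - inner ℝ u (a i x v))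
    (hbs : ∀ x u v, inner ℝ (b x u) v = inner ℝ u ((b x - ∑ i, vd (a i) i x) v))
    {ζ : (𝔼 n) → F} (hζ : LocallyIntegrable ζ)
    (ho : ∀ φ : (𝔼 n) → F, ContDiff ℝ 2 φ → HasCompactSupport φ →
      ∫ x, inner ℝ (MM a b φ x) (ζ x) = 0)
    {ρ : (𝔼 n) → ℝ} (hρ : ContDiff ℝ 2 ρ) (hc : HasCompactSupport ρ)
    (y : (𝔼 n)) :
    MM a b (fun y => ∫ t, ρ t • ζ (y - t)) y =
      (∫ t, (∑ i, pd ρ i t • (a i y - a i (y - t)) + ρ t • ∑ i, vd (a i) i (y - t))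
        (ζ (y - t) - ζ y)) + ∫ t, (ρ t • (b y - b (y - t))) (ζ (y - t)) := by
  have hw := weak_conv ha hb hsk hbs hζ ho hρ hc y
  have hρ1 : ContDiff ℝ 1 ρ := hρ.of_le (by norm_num)
  have hcp : ∀ i, HasCompactSupport (pd ρ i) := fun i => hc.fderiv_apply (𝕜 := ℝ) _
  have h1 : ∀ i, Continuous (vd (a i) i) := fun i => vd_continuous (ha i) i
  have h2 : ∀ i, Continuous (pd ρ i) := fun i => pd_continuous hρ1 i
  have h3 : ∀ i, Continuous (a i) := fun i => (ha i).continuous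
  have h4 := hρ.continuous
  have e1 : ∀ x, x ∉ tsupport ρ → ρ x = 0 := fun x hx => image_eq_zero_of_notMem_tsupport hx
  have e2 : ∀ x, x ∉ tsupport ρ → ∀ i, pd ρ i x = 0 := fun x hx i => by
    have : x ∉ tsupport (fderiv ℝ ρ) := fun h => hx (tsupport_fderiv_subset ℝ h)
    unfold pd
    rw [image_eq_zero_of_notMem_tsupport this]; rfl
  have hIw := conv_int hζ (k := fun t => (∑ i, pd ρ i t • a i (y - t)
      + ρ t • (b (y - t) - ∑ i, vd (a i) i (y - t)))) (by fun_prop)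
    (HasCompactSupport.intro hc fun x hx => by simp [e1 x hx, e2 x hx]) y
  have hIk := conv_int hζ (k := fun t => (∑ i, pd ρ i t • (a i y - a i (y - t))
      + ρ t • ∑ i, vd (a i) i (y - t))) (by fun_prop)
    (HasCompactSupport.intro hc fun x hx => by simp [e1 x hx, e2 x hx]) y
  have hI2 := conv_int hζ (k := fun t => (ρ t • (b y - b (y - t)))) (by fun_prop)
    (HasCompactSupport.intro hc fun x hx => by simp [e1 x hx]) y
  have hIa : ∀ i, Integrable fun t => pd ρ i t • ζ (y - t) := fun i =>
    (hcp i).convolutionExists_left (ContinuousLinearMap.lsmul ℝ ℝ) (h2 i) hζ y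
  have hIb : Integrable fun t => ρ t • ζ (y - t) :=
    hc.convolutionExists_left (ContinuousLinearMap.lsmul ℝ ℝ) h4 hζ y
  have hk0 : ∫ t, (∑ i, pd ρ i t • (a i y - a i (y - t)) + ρ t • ∑ i, vd (a i) i (y - t)) = 0 := by
    have hh : ∀ i, ContDiff ℝ 1 fun t => a i y - a i (y - t) := fun i =>
      contDiff_const.sub ((ha i).comp (contDiff_const.sub contDiff_id))
    have hq : ∀ i, ContDiff ℝ 1 fun t => ρ t • (a i y - a i (y - t)) := fun i => hρ1.smul (hh i)
    have hqc : ∀ i, HasCompactSupport fun t => ρ t • (a i y - a i (y - t)) := fun i => hc.smul_right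
    have h0 := fun i => int_vd_zero (hq i) (hqc i) i
    have hv : ∀ i t, vd (fun t => ρ t • (a i y - a i (y - t))) i t =
        pd ρ i t • (a i y - a i (y - t)) + ρ t • vd (a i) i (y - t) := by
      intro i t
      rw [vd_smul (hρ1.differentiable (by norm_num) t) ((hh i).differentiable (by norm_num) t),
        add_comm]
      congr 2
      have g1 : HasFDerivAt (a i) (fderiv ℝ (a i) (y - t)) (y - t) :=
        ((ha i).differentiable (by norm_num) _).hasFDerivAt
      have g2 : HasFDerivAt (fun z : (𝔼 n) => y - z)
        (-ContinuousLinearMap.id ℝ _) t := (hasFDerivAt_id _).const_sub y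
      have g3 := (g1.comp t g2).const_sub (a i y)
      unfold vd
      have g4 : fderiv ℝ (fun t => a i y - a i (y - t)) t = _ := g3.fderiv
      rw [g4]
      simp
    have hi : ∀ i, Integrable fun t => vd (fun t => ρ t • (a i y - a i (y - t))) i t := fun i =>
      (vd_continuous (hq i) i).integrable_of_hasCompactSupport ((hqc i).fderiv_apply (𝕜 := ℝ) _)
    have : ∑ i, ∫ t, vd (fun t => ρ t • (a i y - a i (y - t))) i t = 0 :=
      Finset.sum_eq_zero fun i _ => h0 i
    rw [← integral_finsetSum _ (fun i _ => hi i)] at this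
    rw [← this]
    congr 1; ext1 t
    simp only [hv, Finset.sum_add_distrib, Finset.smul_sum]
  have hkI : Integrable fun t => (∑ i, pd ρ i t • (a i y - a i (y - t))
      + ρ t • ∑ i, vd (a i) i (y - t)) :=
    Continuous.integrable_of_hasCompactSupport (by fun_prop)
      (HasCompactSupport.intro hc fun x hx => by simp [e1 x hx, e2 x hx])
  have hk1 : ∫ t, (∑ i, pd ρ i t • (a i y - a i (y - t)) + ρ t • ∑ i, vd (a i) i (y - t)) (ζ y)
      = 0 := by
    rw [← ContinuousLinearMap.integral_apply hkI, hk0]; rfl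
  have hIk1 : Integrable fun t => (∑ i, pd ρ i t • (a i y - a i (y - t))
      + ρ t • ∑ i, vd (a i) i (y - t)) (ζ y) := hkI.apply_continuousLinearMap _
  have hL : MM a b (fun y => ∫ t, ρ t • ζ (y - t)) y =
      ∫ t, (∑ i, a i y (pd ρ i t • ζ (y - t)) + b y (ρ t • ζ (y - t))) := by
    have hIa' := fun i => (a i y).integrable_comp (hIa i)
    have hIb' := (b y).integrable_comp hIb
    rw [integral_add (integrable_finsetSum _ fun i _ => hIa' i) hIb',
      integral_finsetSum _ fun i _ => hIa' i]
    unfold MM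
    congr 1
    · refine Finset.sum_congr rfl fun i _ => ?_
      rw [(conv_vd hζ hρ hc).2, ContinuousLinearMap.integral_comp_comm _ (hIa i)]
    · rw [ContinuousLinearMap.integral_comp_comm _ hIb]
  simp only [map_sub]
  rw [integral_sub hIk hIk1, hk1, sub_zero, hL, ← integral_add hIk hI2]
  rw [← sub_zero (∫ t, _), ← hw]
  rw [← integral_sub (by
    refine Integrable.add (integrable_finsetSum _ fun i _ => (a i y).integrable_comp (hIa i)) ?_
    exact (b y).integrable_comp hIb) hIw]
  congr 1; ext1 t
  simp only [map_smul, _root_.add_apply, _root_.sum_apply, _root_.smul_apply, _root_.sub_apply,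
    smul_sub, Finset.sum_sub_distrib]
  abel

theorem friedrichs {a : Fin n → (𝔼 n) → F →L[ℝ] F}
    {b : (𝔼 n) → F →L[ℝ] F} (ha : ∀ i, ContDiff ℝ 1 (a i))
    (hb : UniformContinuous b)
    (hsk : ∀ i x u v, inner ℝ (a i x u) v = - inner ℝ u (a i x v))
    (hbs : ∀ x u v, inner ℝ (b x u) v = inner ℝ u ((b x - ∑ i, vd (a i) i x) v))
    {Λ : ℝ} (hΛ : ∀ i x y, ‖a i x - a i y‖ ≤ Λ * ‖x - y‖) (hΛ' : ∀ i x, ‖vd (a i) i x‖ ≤ Λ)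
    (hΛ0 : 0 ≤ Λ)
    {ζ : (𝔼 n) → F} (hζ : MemLp ζ 2) (hζm : StronglyMeasurable ζ)
    (ho : ∀ φ : (𝔼 n) → F, ContDiff ℝ 2 φ → HasCompactSupport φ →
      ∫ x, inner ℝ (MM a b φ x) (ζ x) = 0) {ε : ℝ} (hε : 0 < ε) :
    ∃ u : (𝔼 n) → F, ContDiff ℝ 2 u ∧
      eLpNorm (fun x => u x - ζ x) 2 ≤ ENNReal.ofReal ε ∧
      eLpNorm (MM a b u) 2 ≤ ENNReal.ofReal ε := by
  obtain ⟨P, hP, hmoll⟩ := moll_exists n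
  have hV : 0 ≤ vB n := ENNReal.toReal_nonneg
  set K := (eLpNorm ζ 2).toReal with hK
  have hK0 : 0 ≤ K := ENNReal.toReal_nonneg
  have hKe : eLpNorm ζ 2 = ENNReal.ofReal K := (ENNReal.ofReal_toReal hζ.eLpNorm_ne_top).symm
  set C1 := 2 * n * Λ * P with hC1
  have hC10 : 0 ≤ C1 := by positivity
  set ε1 := ε / (2 * (C1 * vB n + P * vB n + 1)) with hε1
  have hε10 : 0 < ε1 := by positivity
  set ω := ε / (2 * (P * vB n * K + 1)) with hω
  have hω0 : 0 < ω := by positivity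
  obtain ⟨δ1, hδ1, htr⟩ := trans_cont hζ hε10
  obtain ⟨δ2, hδ2, huc⟩ := Metric.uniformContinuous_iff.1 hb ω hω0
  set δ := min δ1 (δ2 / 2) with hδ
  have hδ0 : 0 < δ := lt_min hδ1 (by positivity)
  obtain ⟨ρ, hρ, hρc, hρz, hρz', hρi, hρb, hρb'⟩ := hmoll δ hδ0
  have := bp_prob (n := n) hδ0
  have hloc : LocallyIntegrable ζ := hζ.locallyIntegrable (by norm_num)
  have hdiff : ∀ᵐ t ∂(bp n δ), eLpNorm (fun y => ‖ζ (y - t) - ζ y‖ₑ) 2 volume ≤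
      ENNReal.ofReal ε1 := by
    filter_upwards [bp_ae δ] with t ht
    have := htr t (ht.trans (min_le_left _ _))
    rwa [eLpNorm_enorm]
  have hsh : ∀ᵐ t ∂(bp n δ), eLpNorm (fun y => ‖ζ (y - t)‖ₑ) 2 volume ≤ ENNReal.ofReal K := by
    refine ae_of_all _ fun t => ?_
    rw [eLpNorm_enorm, ← hKe]
    exact (eLpNorm_comp_measurePreserving hζ.1 (measurePreserving_sub_right volume t)).le
  have hIb : ∀ y, Integrable fun t => ρ t • ζ (y - t) := fun y =>
    hρc.convolutionExists_left (ContinuousLinearMap.lsmul ℝ ℝ) hρ.continuous hloc y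
  refine ⟨fun y => ∫ t, ρ t • ζ (y - t), (conv_vd hloc hρ hρc).1, ?_, ?_⟩
  · have : eLpNorm (fun y => (∫ t, ρ t • ζ (y - t)) - ζ y) 2 ≤
        ENNReal.ofReal (P * vB n) * ENNReal.ofReal ε1 := by
      refine moll_gen (bp n δ) (meas_diff hζm) hdiff fun y => ?_
      have e : (∫ t, ρ t • ζ (y - t)) - ζ y = ∫ t, ρ t • (ζ (y - t) - ζ y) := by
        simp only [smul_sub]
        rw [integral_sub (hIb y) ((hρ.continuous.integrable_of_hasCompactSupport hρc).smul_const _),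
          integral_smul_const, hρi, one_smul]
      rw [e]
      refine kern_bound hδ0 hP (fun t ht => by simp [hρz t ht]) fun t ht => ?_
      rw [norm_smul]
      gcongr
      exact hρb t
    refine this.trans ?_
    rw [← ENNReal.ofReal_mul (by positivity)]
    apply ENNReal.ofReal_le_ofReal
    rw [hε1, mul_div_assoc', div_le_iff₀ (by positivity)]
    nlinarith [mul_nonneg hP hV, mul_nonneg hC10 hV]
  · set G1 : (𝔼 n) → F := fun y =>
      (∫ t, (∑ i, pd ρ i t • (a i y - a i (y - t)) + ρ t • ∑ i, vd (a i) i (y - t))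
        (ζ (y - t) - ζ y)) with hG1
    set G2 : (𝔼 n) → F := fun y =>
      ∫ t, (ρ t • (b y - b (y - t))) (ζ (y - t)) with hG2
    have e : MM a b (fun y => ∫ t, ρ t • ζ (y - t)) = G1 + G2 := by
      ext1 y
      exact MM_conv ha hb.continuous hsk hbs hloc ho hρ hρc y
    have b1 : eLpNorm G1 2 ≤ ENNReal.ofReal (C1 * vB n) * ENNReal.ofReal ε1 := by
      refine moll_gen (bp n δ) (meas_diff hζm) hdiff fun y => ?_
      refine kern_bound hδ0 hC10 (fun t ht => by simp [hρz t ht, hρz' _ t ht]) fun t ht => ?_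
      refine (ContinuousLinearMap.le_opNorm _ _).trans ?_
      gcongr
      have s1 : ∀ i, ‖pd ρ i t • (a i y - a i (y - t))‖ ≤ Λ * (P / δ ^ n) := by
        intro i
        rw [norm_smul]
        have h1 := hΛ i y (y - t)
        rw [sub_sub_cancel] at h1
        calc ‖pd ρ i t‖ * ‖a i y - a i (y - t)‖ ≤ (P / δ ^ n / δ) * (Λ * δ) := by
              gcongr
              · exact hρb' i t
              · exact h1.trans (by gcongr)
          _ = _ := by field_simp
      have s2 : ‖ρ t • ∑ i, vd (a i) i (y - t)‖ ≤ n * (Λ * (P / δ ^ n)) := by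
        rw [norm_smul]
        calc ‖ρ t‖ * ‖∑ i, vd (a i) i (y - t)‖ ≤ (P / δ ^ n) * (n * Λ) := by
              gcongr
              · exact hρb t
              · refine (norm_sum_le _ _).trans ?_
                refine (Finset.sum_le_sum fun i _ => hΛ' i (y - t)).trans ?_
                simp
          _ = _ := by ring
      calc _ ≤ ∑ i : Fin n, Λ * (P / δ ^ n) + n * (Λ * (P / δ ^ n)) :=
            (norm_add_le _ _).trans (add_le_add ((norm_sum_le _ _).trans
              (Finset.sum_le_sum fun i _ => s1 i)) s2)
        _ = C1 / δ ^ n := by simp [hC1]; ring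
    have b2 : eLpNorm G2 2 ≤ ENNReal.ofReal (P * ω * vB n) * ENNReal.ofReal K := by
      refine moll_gen (bp n δ) (meas_shift hζm) hsh fun y => ?_
      refine kern_bound hδ0 (by positivity) (fun t ht => by simp [hρz t ht]) fun t ht => ?_
      refine (ContinuousLinearMap.le_opNorm _ _).trans ?_
      gcongr
      rw [norm_smul]
      have h2 : ‖b y - b (y - t)‖ ≤ ω := by
        rw [← dist_eq_norm]
        refine (huc ?_).le
        rw [dist_eq_norm, sub_sub_cancel]
        have := min_le_right δ1 (δ2 / 2)
        linarith
      calc _ ≤ (P / δ ^ n) * ω := by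
            gcongr
            exact hρb t
        _ = _ := by ring
    have hmu : Continuous (MM a b (fun y => ∫ t, ρ t • ζ (y - t))) := by
      have hu := (conv_vd hloc hρ hρc).1
      have h1 : ∀ i, Continuous (vd (fun y => ∫ t, ρ t • ζ (y - t)) i) := fun i =>
        vd_continuous (hu.of_le (by norm_num)) i
      have h2 := hu.continuous
      have h3 := hb.continuous
      have h4 : ∀ i, Continuous (a i) := fun i => (ha i).continuous
      unfold MM
      fun_prop
    have hG2m : StronglyMeasurable G2 := by
      refine StronglyMeasurable.integral_prod_right' (f := fun z : (𝔼 n) ×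
        (𝔼 n) => (ρ z.2 • (b z.1 - b (z.1 - z.2))) (ζ (z.1 - z.2))) ?_
      have h1 : Continuous fun z : (𝔼 n) ×
        (𝔼 n) => (ρ z.2 • (b z.1 - b (z.1 - z.2))) := by
        have h2 := hρ.continuous
        have h3 := hb.continuous
        fun_prop
      exact isBoundedBilinearMap_apply.continuous.comp_stronglyMeasurable
        (h1.stronglyMeasurable.prodMk (hζm.comp_measurable (measurable_fst.sub measurable_snd)))
    have hG1m : StronglyMeasurable G1 := by
      have : G1 = fun y => MM a b (fun y => ∫ t, ρ t • ζ (y - t)) y - G2 y := by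
        rw [e]; ext y; simp
      rw [this]; exact hmu.stronglyMeasurable.sub hG2m
    rw [e]
    refine (eLpNorm_add_le hG1m.aestronglyMeasurable hG2m.aestronglyMeasurable (by norm_num)).trans ?_
    refine (add_le_add b1 b2).trans ?_
    rw [← ENNReal.ofReal_mul (by positivity), ← ENNReal.ofReal_mul (by positivity),
      ← ENNReal.ofReal_add (by positivity) (by positivity)]
    apply ENNReal.ofReal_le_ofReal
    have i1 : C1 * vB n * ε1 ≤ ε / 2 := by
      rw [hε1, mul_div_assoc', div_le_iff₀ (by positivity)]
      nlinarith [mul_nonneg hP hV, mul_nonneg hC10 hV]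
    have i2 : P * ω * vB n * K ≤ ε / 2 := by
      have : P * ω * vB n * K = (P * vB n * K) * ω := by ring
      rw [this, hω, mul_div_assoc', div_le_iff₀ (by positivity)]
      nlinarith [mul_nonneg (mul_nonneg hP hV) hK0]
    linarith
end fried3

section dense
set_option linter.unusedSectionVars false
open scoped ENNReal
variable {n : ℕ} {F : Type*} [NormedAddCommGroup F] [InnerProductSpace ℝ F] [FiniteDimensional ℝ F]

theorem cut_exists (n : ℕ) : ∃ P : ℝ, 0 ≤ P ∧ ∀ R : ℝ, 0 < R → 
    ∃ χ : (𝔼 n) → ℝ, ContDiff ℝ 2 χ ∧ HasCompactSupport χ ∧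
    (∀ x, ‖x‖ ≤ R → χ x = 1) ∧ (∀ x, |χ x| ≤ 1) ∧ (∀ i x, |pd χ i x| ≤ P / R) := by
  let β : ContDiffBump (0 : (𝔼 n)) := ⟨1, 2, by norm_num, by norm_num⟩
  have hη2 : ContDiff ℝ 2 β := β.contDiff
  have hηc : HasCompactSupport β := β.hasCompactSupport
  have hηd : ∀ i, ∃ P, ∀ x, ‖pd β i x‖ ≤ P := fun i =>
    (pd_continuous (hη2.of_le (by norm_num)) i).bounded_above_of_compact_support
      (hηc.fderiv_apply (𝕜 := ℝ) _)
  choose P1 hP1 using hηd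
  have hP10 : ∀ i, 0 ≤ P1 i := fun i => (norm_nonneg _).trans (hP1 i 0)
  refine ⟨∑ i, P1 i, (Finset.sum_nonneg fun i _ => hP10 i), fun δ hδ => ?_⟩
  refine ⟨fun x => β (δ⁻¹ • x), hη2.comp (contDiff_const_smul _), ?_, ?_, ?_, ?_⟩
  · exact hηc.comp_homeomorph (Homeomorph.smulOfNeZero δ⁻¹ (by positivity))
  · intro x hx
    apply β.one_of_mem_closedBall
    simp only [Metric.mem_closedBall, dist_zero_right]
    rw [norm_smul, norm_inv, Real.norm_of_nonneg hδ.le, inv_mul_eq_div]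
    exact (div_le_one hδ).2 hx
  · intro x
    rw [abs_of_nonneg (β.nonneg' _)]; exact β.le_one
  · intro i x
    have h1 : HasFDerivAt β (fderiv ℝ β (δ⁻¹ • x)) (δ⁻¹ • x) :=
      (hη2.differentiable (by norm_num) _).hasFDerivAt
    have h2 : HasFDerivAt (fun x : (𝔼 n) => δ⁻¹ • x)
        (δ⁻¹ • ContinuousLinearMap.id ℝ _) x := (hasFDerivAt_id x).fun_const_smul _
    have h3 := (h1.comp x h2)
    have hpd : pd (fun x => β (δ⁻¹ • x)) i x = δ⁻¹ * pd β i (δ⁻¹ • x) := by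
      unfold pd
      have h4 : fderiv ℝ (fun x => β (δ⁻¹ • x)) x = _ := h3.fderiv
      rw [h4]
      simp
    rw [hpd, abs_mul, abs_of_pos (by positivity), inv_mul_eq_div]
    gcongr
    exact (hP1 i (δ⁻¹ • x)).trans (Finset.single_le_sum (fun i _ => hP10 i) (Finset.mem_univ i))

theorem MM_cont {a : Fin n → (𝔼 n) → F →L[ℝ] F}
    {b : (𝔼 n) → F →L[ℝ] F} (ha : ∀ i, Continuous (a i))
    (hb : Continuous b) {u : (𝔼 n) → F} (hu : ContDiff ℝ 2 u) :
    Continuous (MM a b u) := by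
  have h1 : ∀ i, Continuous (vd u i) := fun i => vd_continuous (hu.of_le (by norm_num)) i
  have h2 := hu.continuous
  unfold MM
  fun_prop

theorem MM_supp {a : Fin n → (𝔼 n) → F →L[ℝ] F}
    {b : (𝔼 n) → F →L[ℝ] F} {u : (𝔼 n) → F}
    (hu : HasCompactSupport u) : HasCompactSupport (MM a b u) := by
  refine HasCompactSupport.intro hu fun x hx => ?_
  have e1 : u x = 0 := image_eq_zero_of_notMem_tsupport hx
  have e2 : ∀ i, vd u i x = 0 := fun i => by
    have : x ∉ tsupport (fderiv ℝ u) := fun h => hx (tsupport_fderiv_subset ℝ h)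
    unfold vd
    rw [image_eq_zero_of_notMem_tsupport this]; rfl
  simp [MM, e1, e2]

theorem MM_cut {a : Fin n → (𝔼 n) → F →L[ℝ] F}
    {b : (𝔼 n) → F →L[ℝ] F} {u : (𝔼 n) → F}
    (hu : ContDiff ℝ 2 u) {χ : (𝔼 n) → ℝ} (hχ : ContDiff ℝ 2 χ)
    {Λ q : ℝ} (hΛ0 : 0 ≤ Λ) (hq : 0 ≤ q) (hA : ∀ i x, ‖a i x‖ ≤ Λ)
    (hχb : ∀ x, |χ x| ≤ 1) (hχd : ∀ i x, |pd χ i x| ≤ q) (x : (𝔼 n)) :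
    ‖MM a b (fun x => χ x • u x) x‖ ≤ ‖MM a b u x‖ + (n * (q * Λ)) * ‖u x‖ := by
  have e : MM a b (fun x => χ x • u x) x = χ x • MM a b u x +
      ∑ i, pd χ i x • a i x (u x) := by
    unfold MM
    rw [smul_add, Finset.smul_sum, add_right_comm, ← Finset.sum_add_distrib]
    congr 1
    · refine Finset.sum_congr rfl fun i _ => ?_
      rw [vd_smul (hχ.differentiable (by norm_num) x) (hu.differentiable (by norm_num) x)]
      simp [pd_eq_vd]
    · simp
  rw [e]
  refine (norm_add_le _ _).trans (add_le_add ?_ ?_)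
  · rw [norm_smul]
    exact mul_le_of_le_one_left (norm_nonneg _) (hχb x)
  · refine (norm_sum_le _ _).trans ?_
    refine (Finset.sum_le_sum (g := fun _ => q * Λ * ‖u x‖) fun i _ => ?_).trans ?_
    · rw [norm_smul, mul_assoc]
      gcongr
      · exact hχd i x
      · exact (ContinuousLinearMap.le_opNorm _ _).trans (by gcongr; exact hA i x)
    · simp [mul_assoc]

theorem lin_bound {g h u : (𝔼 n) → F} (hh : Continuous h) (hu : Continuous u)
    {q : ℝ} (hq : 0 ≤ q) (hb : ∀ x, ‖g x‖ ≤ ‖h x‖ + q * ‖u x‖) :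
    eLpNorm g 2 ≤ eLpNorm h 2 + ENNReal.ofReal q * eLpNorm u 2 := by
  set h' : (𝔼 n) → ℝ := fun x => ‖h x‖ with hh'
  set u' : (𝔼 n) → ℝ := fun x => ‖u x‖ with hu'
  have m1 : AEStronglyMeasurable h' volume := hh.norm.aestronglyMeasurable
  have m2 : AEStronglyMeasurable (q • u') volume :=
    (continuous_const.smul hu.norm).aestronglyMeasurable
  have e1 : eLpNorm g 2 ≤ eLpNorm (h' + q • u') 2 := by
    refine eLpNorm_mono fun x => (hb x).trans (le_abs_self _)
  refine e1.trans ((eLpNorm_add_le m1 m2 (by norm_num)).trans (le_of_eq ?_))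
  rw [eLpNorm_const_smul, hh', hu', eLpNorm_norm, eLpNorm_norm, Real.enorm_of_nonneg hq]

set_option maxHeartbeats 400000 in
theorem weak_zero {a : Fin n → (𝔼 n) → F →L[ℝ] F}
    {b : (𝔼 n) → F →L[ℝ] F} (ha : ∀ i, ContDiff ℝ 1 (a i))
    (hb : UniformContinuous b)
    (hsk : ∀ i x u v, inner ℝ (a i x u) v = - inner ℝ u (a i x v))
    (hbs : ∀ x u v, inner ℝ (b x u) v = inner ℝ u ((b x - ∑ i, vd (a i) i x) v))
    {Λ : ℝ} (hΛ : ∀ i x y, ‖a i x - a i y‖ ≤ Λ * ‖x - y‖) (hΛ' : ∀ i x, ‖vd (a i) i x‖ ≤ Λ)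
    (hΛ0 : 0 ≤ Λ) (hA : ∀ i x, ‖a i x‖ ≤ Λ)
    (hLH : ∀ R : ℝ, 0 < R → ∃ C : ℝ, 0 ≤ C ∧ ∀ u : (𝔼 n) → F,
      ContDiff ℝ 2 u → HasCompactSupport u →
      eLpNorm u 2 (volume.restrict (Metric.ball 0 R)) ≤ ENNReal.ofReal C * eLpNorm (MM a b u) 2)
    {ζ : (𝔼 n) → F} (hζ : MemLp ζ 2) (hζm : StronglyMeasurable ζ)
    (ho : ∀ φ : (𝔼 n) → F, ContDiff ℝ 2 φ → HasCompactSupport φ →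
      ∫ x, inner ℝ (MM a b φ x) (ζ x) = 0) : ζ =ᵐ[volume] 0 := by
  obtain ⟨P, hP, hcut⟩ := cut_exists n
  set K := (eLpNorm ζ 2).toReal with hK
  have hK0 : 0 ≤ K := ENNReal.toReal_nonneg
  have hKe : eLpNorm ζ 2 = ENNReal.ofReal K := (ENNReal.ofReal_toReal hζ.eLpNorm_ne_top).symm
  have key : ∀ R : ℝ, 0 < R → eLpNorm ζ 2 (volume.restrict (Metric.ball 0 R)) = 0 := by
    intro R hR
    obtain ⟨C, hC, hLHR⟩ := hLH R hR
    set κ := (eLpNorm ζ 2 (volume.restrict (Metric.ball 0 R))).toReal with hκ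
    have hκe : eLpNorm ζ 2 (volume.restrict (Metric.ball 0 R)) = ENNReal.ofReal κ :=
      (ENNReal.ofReal_toReal (hζ.restrict _).eLpNorm_ne_top).symm
    have step : ∀ ε : ℝ, 0 < ε → ∀ R' : ℝ, R ≤ R' →
        κ ≤ ε + C * (ε + n * (P / R' * Λ) * (K + ε)) := by
      intro ε hε R' hR'
      have hR'0 : 0 < R' := hR.trans_le hR'
      obtain ⟨u, hu, hu1, hu2⟩ := friedrichs ha hb hsk hbs hΛ hΛ' hΛ0 hζ hζm ho hε
      obtain ⟨χ, hχ, hχc, hχ1, hχb, hχd⟩ := hcut R' hR'0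
      have h1 := hLHR (fun x => χ x • u x) (hχ.smul hu) hχc.smul_right
      have h2 : eLpNorm (fun x => χ x • u x) 2 (volume.restrict (Metric.ball 0 R)) =
          eLpNorm u 2 (volume.restrict (Metric.ball 0 R)) := by
        apply eLpNorm_congr_ae
        filter_upwards [ae_restrict_mem Metric.isOpen_ball.measurableSet] with x hx
        rw [hχ1 x, one_smul]
        have : ‖x‖ < R := by simpa using hx
        linarith
      rw [h2] at h1
      have huK : eLpNorm u 2 ≤ ENNReal.ofReal (K + ε) := by
        have := eLpNorm_add_le (μ := volume) (p := 2) (f := fun x => u x - ζ x) (g := ζ)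
          (hu.continuous.aestronglyMeasurable.sub hζ.1) hζ.1 (by norm_num)
        have e : (fun x => u x - ζ x) + ζ = u := by ext x; simp
        rw [e] at this
        refine this.trans ?_
        rw [add_comm K, ENNReal.ofReal_add hε.le hK0, hKe]
        gcongr
      have h3 : eLpNorm (MM a b fun x => χ x • u x) 2 ≤
          ENNReal.ofReal ε + ENNReal.ofReal (n * (P / R' * Λ)) * ENNReal.ofReal (K + ε) := by
        refine (lin_bound (MM_cont (fun i => (ha i).continuous) hb.continuous hu) hu.continuous
          (by positivity) (MM_cut hu hχ hΛ0 (by positivity) hA hχb hχd)).trans ?_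
        gcongr
      have h4 : ENNReal.ofReal κ ≤ ENNReal.ofReal (ε + C * (ε + n * (P / R' * Λ) * (K + ε))) := by
        rw [← hκe]
        calc eLpNorm ζ 2 (volume.restrict (Metric.ball 0 R)) ≤
              eLpNorm (fun x => u x - ζ x) 2 (volume.restrict (Metric.ball 0 R)) +
              eLpNorm u 2 (volume.restrict (Metric.ball 0 R)) := by
              have := eLpNorm_sub_le (μ := volume.restrict (Metric.ball 0 R)) (p := 2)
                (g := fun x => u x - ζ x) (f := u)
                hu.continuous.aestronglyMeasurable
                (hu.continuous.aestronglyMeasurable.sub hζ.1.restrict) (by norm_num)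
              have e : u - (fun x => u x - ζ x) = ζ := by ext x; simp
              rw [e, add_comm] at this
              exact this
          _ ≤ ENNReal.ofReal ε + ENNReal.ofReal C * (ENNReal.ofReal ε +
              ENNReal.ofReal (n * (P / R' * Λ)) * ENNReal.ofReal (K + ε)) := by
              refine add_le_add ((eLpNorm_mono_measure _ Measure.restrict_le_self).trans hu1) ?_
              exact h1.trans (by gcongr)
          _ = _ := by
              rw [← ENNReal.ofReal_mul (by positivity), ← ENNReal.ofReal_add (by positivity)
                (by positivity), ← ENNReal.ofReal_mul (by positivity), ← ENNReal.ofReal_add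
                (by positivity) (by positivity)]
      exact (ENNReal.ofReal_le_ofReal_iff (by positivity)).1 h4
    have lim1 : ∀ R' : ℝ, R ≤ R' → κ ≤ C * (n * (P / R' * Λ) * K) := by
      intro R' hR'
      have ht : Tendsto (fun ε : ℝ => ε + C * (ε + n * (P / R' * Λ) * (K + ε))) (𝓝[>] 0)
          (𝓝 (0 + C * (0 + n * (P / R' * Λ) * (K + 0)))) := by
        apply Tendsto.mono_left _ nhdsWithin_le_nhds
        exact Continuous.tendsto (by fun_prop) 0
      have := ge_of_tendsto ht (eventually_nhdsWithin_of_forall fun ε hε => step ε hε R' hR')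
      simpa using this
    have lim2 : κ ≤ 0 := by
      have ht : Tendsto (fun R' : ℝ => C * (n * (P / R' * Λ) * K)) atTop
          (𝓝 (C * (n * (0 * Λ) * K))) := by
        have := tendsto_const_nhds (x := P) (f := atTop (α := ℝ)) |>.div_atTop tendsto_id
        exact ((((this.mul_const Λ).const_mul (n : ℝ)).mul_const K).const_mul C)
      have := ge_of_tendsto ht ((eventually_ge_atTop R).mono fun R' h => lim1 R' h)
      simpa using this
    rw [hκe, ENNReal.ofReal_eq_zero]; exact lim2
  have h0 : ∀ k : ℕ, ∀ᵐ x ∂(volume.restrict (Metric.ball (0 : (𝔼 n)) (k + 1))),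
      ζ x = 0 := by
    intro k
    have := (eLpNorm_eq_zero_iff hζ.1.restrict (by norm_num)).1 (key (k + 1) (by positivity))
    exact this
  have h1 : ∀ᵐ x : (𝔼 n), ∀ k : ℕ, x ∈ Metric.ball 0 ((k : ℝ) + 1) → ζ x = 0 := by
    rw [ae_all_iff]
    intro k
    exact (ae_restrict_iff' Metric.isOpen_ball.measurableSet).1 (h0 k)
  filter_upwards [h1] with x hx
  obtain ⟨k, hk⟩ := exists_nat_gt ‖x‖
  exact hx k (by simp; linarith)
end dense

section dense2
open scoped ENNReal
variable {n : ℕ} {F : Type*} [NormedAddCommGroup F] [InnerProductSpace ℝ F] [FiniteDimensional ℝ F]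

theorem MM_memLp {a : Fin n → (𝔼 n) → F →L[ℝ] F}
    {b : (𝔼 n) → F →L[ℝ] F} (ha : ∀ i, Continuous (a i))
    (hb : Continuous b) {u : (𝔼 n) → F} (hu : ContDiff ℝ 2 u)
    (huc : HasCompactSupport u) : MemLp (MM a b u) 2 :=
  (MM_cont ha hb hu).memLp_of_hasCompactSupport (MM_supp huc)

theorem dense_MM {a : Fin n → (𝔼 n) → F →L[ℝ] F}
    {b : (𝔼 n) → F →L[ℝ] F} (ha : ∀ i, Continuous (a i))
    (hb : Continuous b)
    (hz : ∀ ζ : (𝔼 n) → F, MemLp ζ 2 → StronglyMeasurable ζ →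
      (∀ φ : (𝔼 n) → F, ContDiff ℝ 2 φ → HasCompactSupport φ →
      ∫ x, inner ℝ (MM a b φ x) (ζ x) = 0) → ζ =ᵐ[volume] 0)
    {h : (𝔼 n) → F} (hh : MemLp h 2) {ε : ℝ} (hε : 0 < ε) :
    ∃ φ : (𝔼 n) → F, ContDiff ℝ 2 φ ∧ HasCompactSupport φ ∧
      eLpNorm (fun x => h x + MM a b φ x) 2 ≤ ENNReal.ofReal ε := by
  have : Fact ((1:ℝ≥0∞) ≤ 2) := ⟨by norm_num⟩
  let V : Submodule ℝ (Lp F 2 (volume : Measure (𝔼 n))) :=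
    { carrier := {g | ∃ φ : (𝔼 n) → F, ContDiff ℝ 2 φ ∧ HasCompactSupport φ ∧
        g =ᵐ[volume] MM a b φ}
      zero_mem' := ⟨fun _ => 0, contDiff_const, HasCompactSupport.zero, by
        filter_upwards [Lp.coeFn_zero F 2 (volume : Measure (𝔼 n))] with x hx
        rw [hx]; simp [MM, vd_const]⟩
      add_mem' := by
        rintro g g' ⟨φ, h1, h2, h3⟩ ⟨φ', h1', h2', h3'⟩
        refine ⟨fun x => φ x + φ' x, h1.add h1', h2.add h2', ?_⟩
        filter_upwards [Lp.coeFn_add g g', h3, h3'] with x e1 e2 e3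
        rw [e1, Pi.add_apply, e2, e3]
        simp only [MM]
        simp only [vd_add (h1.differentiable (by norm_num) x) (h1'.differentiable (by norm_num) x),
          map_add, Finset.sum_add_distrib]
        abel
      smul_mem' := by
        rintro c g ⟨φ, h1, h2, h3⟩
        refine ⟨fun x => c • φ x, contDiff_const.smul h1, h2.smul_left, ?_⟩
        filter_upwards [Lp.coeFn_smul c g, h3] with x e1 e2
        rw [e1, Pi.smul_apply, e2]
        have : ∀ i, vd (fun x => c • φ x) i x = c • vd φ i x := fun i => by
          rw [vd_smul (by fun_prop) (h1.differentiable (by norm_num) x), vd_const]; simp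
        simp only [MM, this, map_smul, smul_add, Finset.smul_sum] }
  have hV : Vᗮ = ⊥ := by
    rw [Submodule.eq_bot_iff]
    intro ζ hζ
    rw [Submodule.mem_orthogonal] at hζ
    have h0 := hz ζ (Lp.memLp ζ) (Lp.stronglyMeasurable ζ) (fun φ h1 h2 => by
      have hm := MM_memLp ha hb h1 h2
      have := hζ (hm.toLp _) ⟨φ, h1, h2, hm.coeFn_toLp⟩
      rw [L2.inner_def] at this
      rw [← this]
      refine integral_congr_ae ?_
      filter_upwards [hm.coeFn_toLp] with x hx
      rw [hx])
    exact (Lp.eq_zero_iff_ae_eq_zero).2 h0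
  have hd := Submodule.topologicalClosure_eq_top_iff.2 hV
  have hmem : - hh.toLp h ∈ V.topologicalClosure := by rw [hd]; trivial
  have hmem2 : - hh.toLp h ∈ closure (V : Set (Lp F 2 (volume : Measure (𝔼 n)))) :=
    hmem
  obtain ⟨g, ⟨φ, h1, h2, h3⟩, hg⟩ := Metric.mem_closure_iff.1 hmem2 ε hε
  refine ⟨φ, h1, h2, ?_⟩
  rw [dist_comm, dist_eq_norm, sub_neg_eq_add, Lp.norm_def] at hg
  have e : eLpNorm (fun x => h x + MM a b φ x) 2 volume = eLpNorm (g + hh.toLp h : Lp F 2 volume) 2 volume := by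
    apply eLpNorm_congr_ae
    filter_upwards [Lp.coeFn_add g (hh.toLp h), h3, hh.coeFn_toLp] with x e1 e2 e3
    rw [e1, Pi.add_apply, e2, e3, add_comm]
  rw [e]
  exact (ENNReal.le_ofReal_iff_toReal_le (Lp.eLpNorm_ne_top _) hε.le).2 hg.le
end dense2

section hardy
variable {n : ℕ} {F : Type*} [NormedAddCommGroup F] [InnerProductSpace ℝ F]

theorem sum_sq_eq (x : (𝔼 n)) : ∑ i, x i ^ 2 = ‖x‖ ^ 2 := by
  rw [EuclideanSpace.norm_sq_eq]; simp

theorem pd_coord (i : Fin n) (x : (𝔼 n)) :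
    pd (fun y : (𝔼 n) => y i) i x = 1 := by
  unfold pd
  have : HasFDerivAt (fun y : (𝔼 n) => y i)
    (EuclideanSpace.proj (𝕜 := ℝ) i) x := (EuclideanSpace.proj (𝕜 := ℝ) i).hasFDerivAt
  rw [this.fderiv]; simp

/-- The Hardy vector field. -/
def YY (i : Fin n) (x : (𝔼 n)) : ℝ := x i * (1 + ‖x‖ ^ 2)⁻¹

theorem inv_cd : ContDiff ℝ 2 (fun x : (𝔼 n) => (1 + ‖x‖ ^ 2)⁻¹) := by
  refine ContDiff.inv (contDiff_const.add (contDiff_norm_sq ℝ)) fun x => by positivity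

theorem coord_cd (i : Fin n) : ContDiff ℝ 2 (fun x : (𝔼 n) => x i) :=
  (EuclideanSpace.proj (𝕜 := ℝ) i).contDiff

theorem YY_cd (i : Fin n) : ContDiff ℝ 2 (YY i) := (coord_cd i).mul inv_cd

theorem pd_YY (i : Fin n) (x : (𝔼 n)) :
    pd (YY i) i x = (1 + ‖x‖ ^ 2)⁻¹ - 2 * x i ^ 2 * ((1 + ‖x‖ ^ 2)⁻¹) ^ 2 := by
  have h1 : pd (fun x : (𝔼 n) => (1 + ‖x‖ ^ 2)⁻¹) i x =
      - (2 * x i) * ((1 + ‖x‖ ^ 2)⁻¹) ^ 2 := by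
    have := norm_sq_hasFDeriv x i
    unfold pd at this ⊢
    have hd : DifferentiableAt ℝ (fun x : (𝔼 n) => ‖x‖ ^ 2) x :=
      (contDiff_norm_sq ℝ (n := 1)).differentiable (by norm_num) x
    have h2 := (hasDerivAt_inv (by positivity : (1 + ‖x‖ ^ 2) ≠ 0)).comp_hasFDerivAt x
      (hd.hasFDerivAt.const_add 1)
    have h3 : fderiv ℝ (fun x : (𝔼 n) => (1 + ‖x‖ ^ 2)⁻¹) x = _ := h2.fderiv
    rw [h3]
    simp only [_root_.smul_apply, this]
    simp; ring
  unfold YY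
  rw [pd_mul ((coord_cd i).differentiable (by norm_num) x) (inv_cd.differentiable (by norm_num) x),
    h1, pd_coord]
  ring

theorem hardy_pt (hn : 3 ≤ n) {u : (𝔼 n) → F} {x : (𝔼 n)}
    (hu : DifferentiableAt ℝ u x) (v : Fin n → F)
    (hv : ∀ i, inner ℝ (u x) (vd u i x) = inner ℝ (u x) (v i)) :
    (1 / 2) * ((1 + ‖x‖ ^ 2)⁻¹ * ‖u x‖ ^ 2) - 2 * ∑ i, ‖v i‖ ^ 2 ≤
      ∑ i, pd (fun x => inner ℝ (u x) (u x) * YY i x) i x := by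
  set T := (1 + ‖x‖ ^ 2)⁻¹ with hT
  have hT0 : 0 < T := by positivity
  have hTr : T * ‖x‖ ^ 2 ≤ 1 := by
    rw [hT, inv_mul_le_iff₀ (by positivity)]; linarith
  have e : ∀ i, pd (fun x => inner ℝ (u x) (u x) * YY i x) i x =
      ‖u x‖ ^ 2 * (T - 2 * x i ^ 2 * T ^ 2) + 2 * inner ℝ (u x) (v i) * (x i * T) := by
    intro i
    rw [pd_mul (hu.inner ℝ hu) ((YY_cd i).differentiable (by norm_num) x), pd_YY, pd_eq_vd,
      vd_inner hu hu, real_inner_comm (u x) (vd u i x), hv, real_inner_self_eq_norm_sq]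
    simp only [YY, ← hT]
    ring
  have b1 : ∀ i, - (1 / 2 * (‖u x‖ ^ 2 * T ^ 2) * x i ^ 2 + 2 * ‖v i‖ ^ 2) ≤
      2 * inner ℝ (u x) (v i) * (x i * T) := by
    intro i
    have h1 := abs_real_inner_le_norm (u x) (v i)
    have h2 : |2 * inner ℝ (u x) (v i) * (x i * T)| ≤ 2 * (‖u x‖ * ‖v i‖) * (|x i| * T) := by
      rw [abs_mul, abs_mul, abs_mul, abs_of_pos hT0]
      gcongr; norm_num
    have h3 := neg_abs_le (2 * inner ℝ (u x) (v i) * (x i * T))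
    have h4 := sq_nonneg (‖u x‖ * |x i| * T - 2 * ‖v i‖)
    rw [← sq_abs (x i)]
    nlinarith
  have b2 : ∑ i, (‖u x‖ ^ 2 * (T - 2 * x i ^ 2 * T ^ 2) -
      (1 / 2 * (‖u x‖ ^ 2 * T ^ 2) * x i ^ 2 + 2 * ‖v i‖ ^ 2)) ≤
      ∑ i, pd (fun x => inner ℝ (u x) (u x) * YY i x) i x := by
    refine Finset.sum_le_sum fun i _ => ?_
    rw [e]; linarith [b1 i]
  refine le_trans ?_ b2
  have e2 : ∑ i, (‖u x‖ ^ 2 * (T - 2 * x i ^ 2 * T ^ 2) -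
      (1 / 2 * (‖u x‖ ^ 2 * T ^ 2) * x i ^ 2 + 2 * ‖v i‖ ^ 2)) =
      ‖u x‖ ^ 2 * (n * T - 2 * ‖x‖ ^ 2 * T ^ 2) -
      (1 / 2 * (‖u x‖ ^ 2 * T ^ 2) * ‖x‖ ^ 2 + 2 * ∑ i, ‖v i‖ ^ 2) := by
    rw [← sum_sq_eq, Finset.sum_sub_distrib, Finset.sum_add_distrib, ← Finset.mul_sum,
      ← Finset.mul_sum, ← Finset.mul_sum, Finset.sum_sub_distrib, ← Finset.sum_mul,
      ← Finset.mul_sum]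
    simp
  rw [e2]
  have hn' : (3 : ℝ) ≤ n := by exact_mod_cast hn
  have h5 : (5 / 2) * (T * ‖x‖ ^ 2) * T ≤ 5 / 2 * 1 * T := by gcongr
  have h6 : (1 / 2) * T ≤ n * T - 2 * ‖x‖ ^ 2 * T ^ 2 - 1 / 2 * T ^ 2 * ‖x‖ ^ 2 := by nlinarith
  have := mul_le_mul_of_nonneg_left h6 (sq_nonneg ‖u x‖)
  nlinarith
end hardy

namespace DS
open scoped ENNReal
variable {n : ℕ} {F : Type*} [NormedAddCommGroup F] [InnerProductSpace ℝ F] (d : DS n F)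

/-- Weighted symbols. -/
def aa (i : Fin n) (x : (𝔼 n)) : F →L[ℝ] F := d.w x • d.c i x

/-- Weighted zeroth order term. -/
def bb (x : (𝔼 n)) : F →L[ℝ] F := ∑ i, d.w x • (d.c i x * d.Om i x)

theorem MM_eq (u : (𝔼 n) → F) (x : (𝔼 n)) :
    MM d.aa d.bb u x = d.w x • d.D u x := by
  have hmul : ∀ (A B : F →L[ℝ] F) (u : F), (A * B) u = A (B u) := fun _ _ _ => rfl
  simp only [MM, aa, bb, D, nab, _root_.smul_apply, _root_.sum_apply, map_add, Finset.smul_sum,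
    smul_add, Finset.sum_add_distrib, hmul]

theorem haa (i : Fin n) : ContDiff ℝ 1 (d.aa i) := d.hw.smul (d.hc i)

theorem hbb : ContDiff ℝ 1 d.bb :=
  ContDiff.sum fun i _ => d.hw.smul ((d.hc i).clm_comp (d.hOm i))

theorem LH [FiniteDimensional ℝ F] (hn : 3 ≤ n) {lam : ℝ} (hlam : 0 < lam) (hw : ∀ x, lam ≤ d.w x)
    (hQ : ∀ x v, lam * ∑ i, ‖v i‖ ^ 2 ≤ d.Q x v) (hS : ∀ x, 0 ≤ d.S x)
    {u : (𝔼 n) → F} (hu : ContDiff ℝ 2 u) (huc : HasCompactSupport u) :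
    ∫ x, (1 + ‖x‖ ^ 2)⁻¹ * ‖u x‖ ^ 2 ≤ (4 / lam ^ 3) * ∫ x, ‖MM d.aa d.bb u x‖ ^ 2 := by
  have hu1 : ContDiff ℝ 1 u := hu.of_le (by norm_num)
  have hI1 : Integrable fun x => (1 + ‖x‖ ^ 2)⁻¹ * ‖u x‖ ^ 2 := by
    refine Continuous.integrable_of_hasCompactSupport (inv_cd.continuous.mul
      (hu.continuous.norm.pow 2)) (HasCompactSupport.intro huc fun x hx => ?_)
    rw [image_eq_zero_of_notMem_tsupport hx]; simp
  have hI2 : Integrable fun x => ‖MM d.aa d.bb u x‖ ^ 2 := by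
    refine Continuous.integrable_of_hasCompactSupport ((MM_cont (fun i => (d.haa i).continuous)
      d.hbb.continuous hu).norm.pow 2) (HasCompactSupport.intro (MM_supp (a := d.aa) (b := d.bb) huc)
        fun x hx => ?_)
    rw [image_eq_zero_of_notMem_tsupport hx]; simp
  have hX1 : ∀ i, ContDiff ℝ 1 (fun x => inner ℝ (u x) (u x) * YY i x) := fun i =>
    (hu1.inner ℝ hu1).mul ((YY_cd i).of_le (by norm_num))
  have hX1c : ∀ i, HasCompactSupport (fun x => inner ℝ (u x) (u x) * YY i x) := fun i => by
    refine HasCompactSupport.intro huc fun x hx => ?_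
    rw [image_eq_zero_of_notMem_tsupport hx]; simp
  have hX2 : ∀ i, ContDiff ℝ 1 (d.W u i) := fun i => d.hW i hu
  have hX2c : ∀ i, HasCompactSupport (d.W u i) := fun i => by
    refine HasCompactSupport.intro huc fun x hx => ?_
    unfold W
    rw [image_eq_zero_of_notMem_tsupport hx]; simp
  have z1 : ∫ x, ∑ i, pd (fun x => inner ℝ (u x) (u x) * YY i x) i x = 0 := by
    rw [integral_finsetSum _ fun i _ => ((pd_continuous (hX1 i) i).integrable_of_hasCompactSupport
      ((hX1c i).fderiv_apply (𝕜 := ℝ) _))]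
    exact Finset.sum_eq_zero fun i _ => int_pd_zero (hX1 i) (hX1c i) i
  have z2 : ∫ x, ∑ i, pd (d.W u i) i x = 0 := by
    rw [integral_finsetSum _ fun i _ => ((pd_continuous (hX2 i) i).integrable_of_hasCompactSupport
      ((hX2c i).fderiv_apply (𝕜 := ℝ) _))]
    exact Finset.sum_eq_zero fun i _ => int_pd_zero (hX2 i) (hX2c i) i
  have hJ1 : Integrable fun x => ∑ i, pd (fun x => inner ℝ (u x) (u x) * YY i x) i x :=
    integrable_finsetSum _ fun i _ => ((pd_continuous (hX1 i) i).integrable_of_hasCompactSupport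
      ((hX1c i).fderiv_apply (𝕜 := ℝ) _))
  have hJ2 : Integrable fun x => ∑ i, pd (d.W u i) i x :=
    integrable_finsetSum _ fun i _ => ((pd_continuous (hX2 i) i).integrable_of_hasCompactSupport
      ((hX2c i).fderiv_apply (𝕜 := ℝ) _))
  have pt : ∀ x, (1 + ‖x‖ ^ 2)⁻¹ * ‖u x‖ ^ 2 - (4 / lam ^ 3) * ‖MM d.aa d.bb u x‖ ^ 2 ≤
      2 * (∑ i, pd (fun x => inner ℝ (u x) (u x) * YY i x) i x)
        + (4 / lam ^ 2) * ∑ i, pd (d.W u i) i x := by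
    intro x
    have h1 := hardy_pt hn (hu.differentiable (by norm_num) x) (fun i => d.nab i u x) (fun i => by
      have : inner ℝ (u x) (d.Om i x (u x)) = (0:ℝ) := by
        have := d.Om_skew i x (u x) (u x)
        rw [real_inner_comm] at this
        linarith
      simp only [nab, inner_add_right, this, add_zero])
    have h2 := d.div_W hu x
    have h3 := hQ x (fun i => d.nab i u x)
    have h4 : 0 ≤ d.S x / 4 * ‖u x‖ ^ 2 := by have := hS x; positivity
    have hwx := hw x
    have hw0 : 0 < d.w x := hlam.trans_le hwx
    rw [MM_eq, norm_smul, Real.norm_of_nonneg hw0.le]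
    set N := ∑ i, ‖d.nab i u x‖ ^ 2 with hN
    have hN0 : 0 ≤ N := Finset.sum_nonneg fun i _ => sq_nonneg _
    have h5 : lam ^ 2 * N - (d.w x * ‖d.D u x‖) ^ 2 / lam ≤ ∑ i, pd (d.W u i) i x := by
      rw [h2]
      have h6 : lam * (lam * N) ≤ d.w x * d.Q x (fun i => d.nab i u x) := by
        gcongr
      have h7 : d.w x * ‖d.D u x‖ ^ 2 ≤ (d.w x * ‖d.D u x‖) ^ 2 / lam := by
        rw [le_div_iff₀ hlam]
        nlinarith [mul_le_mul_of_nonneg_left hwx (by positivity : 0 ≤ d.w x * ‖d.D u x‖ ^ 2)]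
      have h8 : 0 ≤ d.w x * (d.S x / 4 * ‖u x‖ ^ 2) := by positivity
      nlinarith
    have h9 := mul_le_mul_of_nonneg_left h5 (by positivity : 0 ≤ 4 / lam ^ 2)
    have e9 : 4 / lam ^ 2 * (lam ^ 2 * N - (d.w x * ‖d.D u x‖) ^ 2 / lam) =
      4 * N - 4 / lam ^ 3 * (d.w x * ‖d.D u x‖) ^ 2 := by field_simp
    rw [e9] at h9
    linarith
  have := integral_mono (hI1.sub (hI2.const_mul _)) ((hJ1.const_mul 2).add (hJ2.const_mul _)) pt
  simp only [Pi.sub_apply, Pi.add_apply] at this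
  rw [integral_add (hJ1.const_mul 2) (hJ2.const_mul _)] at this
  rw [integral_sub hI1 (hI2.const_mul _), integral_const_mul, integral_const_mul,
    integral_const_mul, z1, z2] at this
  linarith
end DS

namespace DS
open scoped ENNReal
variable {n : ℕ} {F : Type*} [NormedAddCommGroup F] [InnerProductSpace ℝ F] [FiniteDimensional ℝ F]
  (d : DS n F)

theorem aa_skew (i x u v) : inner ℝ (d.aa i x u) v = - inner ℝ u (d.aa i x v) := by
  simp only [aa, _root_.smul_apply, inner_smul_left, inner_smul_right, d.c_skew]
  simp

theorem vd_aa (i j x) : vd (d.aa i) j x = d.w x • vd (d.c i) j x + vd d.w j x • d.c i x :=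
  vd_smul (d.hw.differentiable (by norm_num) x) ((d.hc i).differentiable (by norm_num) x) j

theorem bb_adj (x u v) :
    inner ℝ (d.bb x u) v = inner ℝ u ((d.bb x - ∑ i, vd (d.aa i) i x) v) := by
  have e : d.bb x - ∑ i, vd (d.aa i) i x = ∑ i, d.w x • (d.Om i x * d.c i x) := by
    rw [← add_zero (d.bb x - _), ← d.divc x, bb, ← Finset.sum_sub_distrib, ← Finset.sum_add_distrib]
    refine Finset.sum_congr rfl fun i _ => ?_
    rw [vd_aa]
    simp only [smul_add, smul_sub]
    abel
  rw [e]
  have hmul : ∀ (A B : F →L[ℝ] F) (u : F), (A * B) u = A (B u) := fun _ _ _ => rfl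
  simp only [bb, _root_.smul_apply, _root_.sum_apply, inner_smul_left, inner_smul_right, hmul,
    sum_inner, inner_sum, d.c_skew, d.Om_skew]
  simp

theorem bb_le {A : ℝ} (hA : 0 ≤ A) (hw0 : ∀ x, 0 ≤ d.w x) (hwA : ∀ x, d.w x ≤ A)
    (hc : ∀ i x, ‖d.c i x‖ ≤ A) (x : (𝔼 n)) :
    ‖d.bb x‖ ≤ A * A * ∑ i, ‖d.Om i x‖ := by
  rw [bb, Finset.mul_sum]
  refine (norm_sum_le _ _).trans (Finset.sum_le_sum fun i _ => ?_)
  rw [norm_smul, Real.norm_of_nonneg (hw0 x), mul_assoc]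
  refine mul_le_mul (hwA x) ?_ (norm_nonneg _) hA
  exact (norm_mul_le _ _).trans (by gcongr; exact hc i x)

theorem lip_of_vd {G : Type*} [NormedAddCommGroup G] [NormedSpace ℝ G]
    {h : (𝔼 n) → G} (hd : ContDiff ℝ 1 h) {A : ℝ}
    (hA : ∀ i x, ‖vd h i x‖ ≤ A) (hA0 : 0 ≤ A) (x y : (𝔼 n)) :
    ‖h x - h y‖ ≤ n * A * ‖x - y‖ := by
  refine Convex.norm_image_sub_le_of_norm_fderiv_le (𝕜 := ℝ) (s := Set.univ)
    (fun z _ => hd.differentiable (by norm_num) z) (fun z _ => ?_) convex_univ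
    (Set.mem_univ y) (Set.mem_univ x)
  refine ContinuousLinearMap.opNorm_le_bound _ (by positivity) fun v => ?_
  have e : v = ∑ i, v i • EuclideanSpace.single i (1:ℝ) := by
    ext j; simp [Finset.sum_apply, Pi.single_apply]
  conv_lhs => rw [e, map_sum]
  refine (norm_sum_le _ _).trans ?_
  have : ∀ i ∈ Finset.univ, ‖fderiv ℝ h z (v i • EuclideanSpace.single i (1:ℝ))‖ ≤ A * ‖v‖ := by
    intro i _
    rw [map_smul, norm_smul, mul_comm]
    exact mul_le_mul (hA i z) (PiLp.norm_apply_le v i) (norm_nonneg _) hA0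
  refine (Finset.sum_le_sum this).trans ?_
  simp [mul_assoc]

theorem pos_mass (hn : 3 ≤ n) {lam A : ℝ} (hlam : 0 < lam) (hw : ∀ x, lam ≤ d.w x)
    (hQ : ∀ x v, lam * ∑ i, ‖v i‖ ^ 2 ≤ d.Q x v) (hS : ∀ x, 0 ≤ d.S x)
    (hwA : ∀ x, d.w x ≤ A) (hwd : ∀ j x, ‖vd d.w j x‖ ≤ A)
    (hc : ∀ i x, ‖d.c i x‖ ≤ A) (hcd : ∀ i j x, ‖vd (d.c i) j x‖ ≤ A)
    (hOm0 : ∀ i, Tendsto (d.Om i) (cocompact _) (𝓝 0)) (hOm2 : ∀ i, MemLp (d.Om i) 2)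
    (ψ : F) (hint : Integrable fun x => ∑ i, pd (d.W (fun _ => ψ) i) i x) :
    0 ≤ ∫ x, ∑ i, pd (d.W (fun _ => ψ) i) i x := by
  have hA : 0 ≤ A := hlam.le.trans ((hw 0).trans (hwA 0))
  have hw0 : ∀ x, 0 < d.w x := fun x => hlam.trans_le (hw x)
  have hble := d.bb_le hA (fun x => (hw0 x).le) hwA hc
  have hbu : UniformContinuous d.bb := by
    refine d.hbb.continuous.uniformContinuous_of_tendsto_cocompact (x := 0) ?_
    refine squeeze_zero_norm hble ?_
    have : Tendsto (fun x => A * A * ∑ i, ‖d.Om i x‖) (cocompact (𝔼 n))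
        (𝓝 (A * A * ∑ i : Fin n, ‖(0 : F →L[ℝ] F)‖)) :=
      (tendsto_finsetSum _ fun i _ => (hOm0 i).norm).const_mul _
    simpa using this
  have hvda : ∀ i j x, ‖vd (d.aa i) j x‖ ≤ A * A + A * A := by
    intro i j x
    rw [vd_aa]
    refine (norm_add_le _ _).trans (add_le_add ?_ ?_)
    · rw [norm_smul, Real.norm_of_nonneg (hw0 x).le]
      exact mul_le_mul (hwA x) (hcd i j x) (norm_nonneg _) hA
    · rw [norm_smul]
      exact mul_le_mul (hwd j x) (hc i x) (norm_nonneg _) hA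
  set Λ := (n : ℝ) * (A * A + A * A) + (A * A + A * A) with hΛ
  have hn0 : (0:ℝ) ≤ n := Nat.cast_nonneg n
  have hAA : 0 ≤ A * A := mul_nonneg hA hA
  have hΛ0 : 0 ≤ Λ := by positivity
  have hzero := fun ζ hζ hζm ho => weak_zero (a := d.aa) (b := d.bb) (ζ := ζ) d.haa hbu d.aa_skew
    d.bb_adj (Λ := Λ) (fun i x y => (lip_of_vd (d.haa i) (hvda i) (by positivity) x y).trans (by
      gcongr; rw [hΛ]; linarith))
    (fun i x => (hvda i i x).trans (by rw [hΛ]; nlinarith))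
    hΛ0 (fun i x => by
      rw [aa, norm_smul, Real.norm_of_nonneg (hw0 x).le]
      refine (mul_le_mul (hwA x) (hc i x) (norm_nonneg _) hA).trans ?_
      rw [hΛ]; nlinarith)
    (fun R hR => by
      refine ⟨√((1 + R ^ 2) * (4 / lam ^ 3)), by positivity, fun u hu huc => ?_⟩
      rw [← ENNReal.pow_le_pow_left_iff (n := 2) (by norm_num), mul_pow, eLpNorm_two_sq,
        eLpNorm_two_sq, ← ENNReal.ofReal_pow (by positivity), Real.sq_sqrt (by positivity)]
      have hI2 : Integrable fun x => ‖MM d.aa d.bb u x‖ ^ 2 := by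
        refine Continuous.integrable_of_hasCompactSupport ((MM_cont (fun i => (d.haa i).continuous)
          d.hbb.continuous hu).norm.pow 2) (HasCompactSupport.intro (MM_supp (a := d.aa) (b := d.bb)
            huc) fun x hx => ?_)
        rw [image_eq_zero_of_notMem_tsupport hx]; simp
      have hI1 : Integrable fun x => (1 + ‖x‖ ^ 2)⁻¹ * ‖u x‖ ^ 2 := by
        refine Continuous.integrable_of_hasCompactSupport (inv_cd.continuous.mul
          (hu.continuous.norm.pow 2)) (HasCompactSupport.intro huc fun x hx => ?_)
        rw [image_eq_zero_of_notMem_tsupport hx]; simp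
      have hL := d.LH hn hlam hw hQ hS hu huc
      have e1 : ∀ v : F, ‖v‖ₑ ^ 2 = ENNReal.ofReal (‖v‖ ^ 2) := fun v => by
        rw [ENNReal.ofReal_pow (norm_nonneg _), ofReal_norm]
      simp only [e1]
      rw [← ofReal_integral_eq_lintegral_ofReal hI2 (ae_of_all _ fun x => by positivity),
        ← ENNReal.ofReal_mul (by positivity)]
      calc _ ≤ ∫⁻ x in Metric.ball 0 R, ENNReal.ofReal ((1 + R ^ 2) *
              ((1 + ‖x‖ ^ 2)⁻¹ * ‖u x‖ ^ 2)) := by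
            refine setLIntegral_mono_ae' Metric.isOpen_ball.measurableSet (ae_of_all _ fun x hx => ?_)
            apply ENNReal.ofReal_le_ofReal
            have hx' : ‖x‖ < R := by simpa using hx
            rw [← mul_assoc]
            refine le_mul_of_one_le_left (sq_nonneg _) ?_
            rw [← div_eq_mul_inv, one_le_div (by positivity)]
            gcongr
        _ ≤ ∫⁻ x, ENNReal.ofReal ((1 + R ^ 2) * ((1 + ‖x‖ ^ 2)⁻¹ * ‖u x‖ ^ 2)) :=
            setLIntegral_le_lintegral _ _
        _ = ENNReal.ofReal (∫ x, (1 + R ^ 2) * ((1 + ‖x‖ ^ 2)⁻¹ * ‖u x‖ ^ 2)) := by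
            rw [ofReal_integral_eq_lintegral_ofReal (hI1.const_mul _)
              (ae_of_all _ fun x => by positivity)]
        _ ≤ _ := by
            apply ENNReal.ofReal_le_ofReal
            rw [integral_const_mul, mul_assoc]
            gcongr) hζ hζm ho
  set h : (𝔼 n) → F := MM d.aa d.bb (fun _ => ψ) with hh
  have hhb : ∀ x, h x = d.bb x ψ := fun x => by simp [hh, MM, vd_const]
  have hhL : MemLp h 2 := by
    have h1 : MemLp (fun x => A * A * ∑ i, ‖d.Om i x‖ * ‖ψ‖) 2 := by
      refine MemLp.const_mul ?_ _
      exact memLp_finsetSum _ fun i _ => ((hOm2 i).norm.mul_const _)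
    refine h1.mono (MM_cont (fun i => (d.haa i).continuous) d.hbb.continuous
      contDiff_const).aestronglyMeasurable (ae_of_all _ fun x => ?_)
    rw [hhb, ← Finset.sum_mul, ← mul_assoc]
    refine ((d.bb x).le_opNorm ψ).trans ((mul_le_mul_of_nonneg_right (hble x)
      (norm_nonneg _)).trans (le_abs_self _))
  have key : ∀ ε : ℝ, 0 < ε → - (ε ^ 2 / lam) ≤ ∫ x, ∑ i, pd (d.W (fun _ => ψ) i) i x := by
    intro ε hε
    obtain ⟨φ, hφ, hφc, hφe⟩ := dense_MM (fun i => (d.haa i).continuous) d.hbb.continuous hzero hhL hε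
    set ψ' : (𝔼 n) → F := fun x => ψ + φ x with hψ'
    have hψ2 : ContDiff ℝ 2 ψ' := contDiff_const.add hφ
    have hψ0 : ContDiff ℝ 2 (fun _ : (𝔼 n) => ψ) := contDiff_const
    have hvd : ∀ i x, vd ψ' i x = vd φ i x := fun i x => by
      rw [hψ', vd_add (by fun_prop) (hφ.differentiable (by norm_num) x), vd_const, zero_add]
    have hMM : ∀ x, MM d.aa d.bb ψ' x = h x + MM d.aa d.bb φ x := by
      intro x
      rw [hhb]
      have e : ψ' x = ψ + φ x := rfl
      simp only [MM, hvd]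
      rw [e, map_add]; abel
    have hX : ∀ i, ContDiff ℝ 1 (fun x => d.W ψ' i x - d.W (fun _ => ψ) i x) := fun i =>
      (d.hW i hψ2).sub (d.hW i hψ0)
    have hXc : ∀ i, HasCompactSupport (fun x => d.W ψ' i x - d.W (fun _ => ψ) i x) := fun i => by
      refine HasCompactSupport.intro hφc fun x hx => ?_
      have e1 : φ x = 0 := image_eq_zero_of_notMem_tsupport hx
      have e2 : ∀ i, vd φ i x = 0 := fun i => by
        have : x ∉ tsupport (fderiv ℝ φ) := fun h => hx (tsupport_fderiv_subset ℝ h)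
        unfold vd
        rw [image_eq_zero_of_notMem_tsupport this]; rfl
      have e3 : ψ' x = ψ := by rw [hψ']; simp [e1]
      simp only [W, nab, hvd, vd_const, e2, e3]; simp
    have hXi := fun i => (pd_continuous (hX i) i).integrable_of_hasCompactSupport (μ := volume)
      ((hXc i).fderiv_apply (𝕜 := ℝ) _)
    have z : ∫ x, ∑ i, pd (fun x => d.W ψ' i x - d.W (fun _ => ψ) i x) i x = 0 := by
      rw [integral_finsetSum _ fun i _ => hXi i]
      exact Finset.sum_eq_zero fun i _ => int_pd_zero (hX i) (hXc i) i
    have e3 : ∀ x, ∑ i, pd (fun x => d.W ψ' i x - d.W (fun _ => ψ) i x) i x =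
        ∑ i, pd (d.W ψ' i) i x - ∑ i, pd (d.W (fun _ => ψ) i) i x := by
      intro x
      rw [← Finset.sum_sub_distrib]
      refine Finset.sum_congr rfl fun i _ => ?_
      rw [pd_eq_vd, pd_eq_vd, pd_eq_vd]
      exact vd_sub ((d.hW i hψ2).differentiable (by norm_num) x)
        ((d.hW i hψ0).differentiable (by norm_num) x) i
    have hI' : Integrable fun x => ∑ i, pd (d.W ψ' i) i x := by
      have := (integrable_finsetSum Finset.univ fun i _ => hXi i).add hint
      refine this.congr (ae_of_all _ fun x => ?_)
      simp only [Pi.add_apply]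
      rw [e3]; ring
    have e4 : ∫ x, ∑ i, pd (d.W (fun _ => ψ) i) i x = ∫ x, ∑ i, pd (d.W ψ' i) i x := by
      simp only [e3] at z
      rw [integral_sub hI' hint] at z
      linarith
    rw [e4]
    have hML : MemLp (MM d.aa d.bb ψ') 2 := by
      have := hhL.add (MM_memLp (fun i => (d.haa i).continuous) d.hbb.continuous hφ hφc)
      refine this.ae_eq (ae_of_all _ fun x => ?_)
      rw [hMM]; rfl
    have hMI : Integrable fun x => ‖MM d.aa d.bb ψ' x‖ ^ 2 := hML.integrable_norm_pow (by norm_num)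
    have hMe : ∫ x, ‖MM d.aa d.bb ψ' x‖ ^ 2 ≤ ε ^ 2 := by
      have e1 : ∀ v : F, ‖v‖ₑ ^ 2 = ENNReal.ofReal (‖v‖ ^ 2) := fun v => by
        rw [ENNReal.ofReal_pow (norm_nonneg _), ofReal_norm]
      have h1 := eLpNorm_two_sq volume (MM d.aa d.bb ψ')
      simp only [e1] at h1
      rw [← ofReal_integral_eq_lintegral_ofReal hMI (ae_of_all _ fun x => by positivity)] at h1
      have h2 : eLpNorm (MM d.aa d.bb ψ') 2 ≤ ENNReal.ofReal ε := by
        refine le_trans (le_of_eq ?_) hφe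
        congr 1; ext1 x; exact hMM x
      have h3 : ENNReal.ofReal (∫ x, ‖MM d.aa d.bb ψ' x‖ ^ 2) ≤ ENNReal.ofReal (ε ^ 2) := by
        rw [← h1, ENNReal.ofReal_pow hε.le]; gcongr
      exact (ENNReal.ofReal_le_ofReal_iff (by positivity)).1 h3
    have pt : ∀ x, - ((1 / lam) * ‖MM d.aa d.bb ψ' x‖ ^ 2) ≤ ∑ i, pd (d.W ψ' i) i x := by
      intro x
      rw [d.div_W hψ2, MM_eq, norm_smul, Real.norm_of_nonneg (hw0 x).le]
      have h1 := hQ x (fun i => d.nab i ψ' x)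
      have h2 : 0 ≤ lam * ∑ i, ‖d.nab i ψ' x‖ ^ 2 := by positivity
      have h3 : 0 ≤ d.S x / 4 * ‖ψ' x‖ ^ 2 := by have := hS x; positivity
      have h7 : d.w x * ‖d.D ψ' x‖ ^ 2 ≤ (1 / lam) * (d.w x * ‖d.D ψ' x‖) ^ 2 := by
        rw [one_div, inv_mul_eq_div, le_div_iff₀ hlam]
        nlinarith [mul_le_mul_of_nonneg_left (hw x)
          (by have := (hw0 x).le; positivity : 0 ≤ d.w x * ‖d.D ψ' x‖ ^ 2)]
      have h8 : 0 ≤ d.w x * (d.Q x (fun i => d.nab i ψ' x) + d.S x / 4 * ‖ψ' x‖ ^ 2) :=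
        mul_nonneg (hw0 x).le (by linarith)
      nlinarith
    have h9 := integral_mono (hMI.const_mul (1 / lam)).neg hI' pt
    refine le_trans ?_ h9
    simp only [Pi.neg_apply]
    rw [integral_neg, integral_const_mul, neg_le_neg_iff, one_div, inv_mul_eq_div]
    gcongr
  have ht : Tendsto (fun ε : ℝ => - (ε ^ 2 / lam)) (𝓝[>] 0) (𝓝 (- ((0:ℝ) ^ 2 / lam))) := by
    apply Tendsto.mono_left _ nhdsWithin_le_nhds
    exact Continuous.tendsto (by fun_prop) 0
  have := le_of_tendsto ht (eventually_nhdsWithin_of_forall fun ε hε => key ε hε)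
  simpa using this
end DS

/-- Decay of order a. -/
def OO {n : ℕ} (a : ℝ) (φ : (𝔼 n) → ℝ) : Prop :=
  ∃ C : ℝ, 0 ≤ C ∧ ∀ x, 1 ≤ ‖x‖ → |φ x| ≤ C * ‖x‖ ^ (-a)

/-- Decay of order a, with one derivative. -/
def O1 {n : ℕ} (a : ℝ) (φ : (𝔼 n) → ℝ) : Prop :=
  ContDiff ℝ 2 φ ∧ OO a φ ∧ ∀ i, OO (a + 1) (pd φ i)

section OOl
variable {n : ℕ} {a b : ℝ} {φ χ : (𝔼 n) → ℝ}

theorem OO.mono (h : OO a φ) (hb : b ≤ a) : OO b φ := by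
  obtain ⟨C, hC, h⟩ := h
  refine ⟨C, hC, fun x hx => (h x hx).trans ?_⟩
  gcongr

theorem OO.add (h : OO a φ) (k : OO a χ) : OO a (fun x => φ x + χ x) := by
  obtain ⟨C, hC, h⟩ := h
  obtain ⟨D, hD, k⟩ := k
  refine ⟨C + D, by positivity, fun x hx => (abs_add_le _ _).trans ?_⟩
  rw [add_mul]; exact add_le_add (h x hx) (k x hx)

theorem OO.neg (h : OO a φ) : OO a (fun x => - φ x) := by
  obtain ⟨C, hC, h⟩ := h
  exact ⟨C, hC, fun x hx => by rw [abs_neg]; exact h x hx⟩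

theorem OO.sub (h : OO a φ) (k : OO a χ) : OO a (fun x => φ x - χ x) := by
  simp only [sub_eq_add_neg]; exact h.add k.neg

theorem OO.mul (h : OO a φ) (k : OO b χ) : OO (a + b) (fun x => φ x * χ x) := by
  obtain ⟨C, hC, h⟩ := h
  obtain ⟨D, hD, k⟩ := k
  refine ⟨C * D, by positivity, fun x hx => ?_⟩
  rw [abs_mul, neg_add, Real.rpow_add (by linarith)]
  calc _ ≤ (C * ‖x‖ ^ (-a)) * (D * ‖x‖ ^ (-b)) := by
        gcongr
        · exact h x hx
        · exact k x hx
    _ = _ := by ring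

theorem OO.of_le (h : OO a φ) (hle : ∀ x, |χ x| ≤ |φ x|) : OO a χ := by
  obtain ⟨C, hC, h⟩ := h
  exact ⟨C, hC, fun x hx => (hle x).trans (h x hx)⟩

theorem OO.const (c : ℝ) : OO 0 (fun _ : (𝔼 n) => c) :=
  ⟨|c|, by positivity, fun x _ => by simp⟩

theorem OO.zero : OO a (fun _ : (𝔼 n) => (0 : ℝ)) :=
  ⟨0, le_rfl, fun x _ => by simp⟩

theorem OO.cmul (c : ℝ) (h : OO a φ) : OO a (fun x => c * φ x) := by
  have := (OO.const (n := n) c).mul h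
  rwa [zero_add] at this

theorem OO.sum {ι : Type*} {s : Finset ι} {φ : ι → (𝔼 n) → ℝ}
    (h : ∀ i, OO a (φ i)) : OO a (fun x => ∑ i ∈ s, φ i x) := by
  classical
  induction s using Finset.induction_on with
  | empty => simpa using OO.zero
  | insert i s hi ih => simp only [Finset.sum_insert hi]; exact (h i).add ih

theorem OO.congr (h : OO a φ) (e : ∀ x, χ x = φ x) : OO a χ := by
  have : χ = φ := funext e
  rwa [this]

theorem O1.diff (h : O1 a φ) (x : (𝔼 n)) : DifferentiableAt ℝ φ x :=
  h.1.differentiable (by norm_num) x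

theorem O1.congr (h : O1 a φ) (e : ∀ x, χ x = φ x) : O1 a χ := by
  have : χ = φ := funext e
  rwa [this]

theorem O1.mono (h : O1 a φ) (hb : b ≤ a) : O1 b φ :=
  ⟨h.1, h.2.1.mono hb, fun i => (h.2.2 i).mono (by linarith)⟩

theorem O1.add (h : O1 a φ) (k : O1 a χ) : O1 a (fun x => φ x + χ x) :=
  ⟨h.1.add k.1, h.2.1.add k.2.1, fun i => ((h.2.2 i).add (k.2.2 i)).congr fun x =>
    vd_add (h.diff x) (k.diff x) i⟩

theorem O1.sub (h : O1 a φ) (k : O1 a χ) : O1 a (fun x => φ x - χ x) :=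
  ⟨h.1.sub k.1, h.2.1.sub k.2.1, fun i => ((h.2.2 i).sub (k.2.2 i)).congr fun x =>
    vd_sub (h.diff x) (k.diff x) i⟩

theorem O1.mul (h : O1 a φ) (k : O1 b χ) : O1 (a + b) (fun x => φ x * χ x) := by
  refine ⟨h.1.mul k.1, h.2.1.mul k.2.1, fun i => ?_⟩
  have h1 := (h.2.1.mul (k.2.2 i)).mono (show a + b + 1 ≤ _ by linarith)
  have h2 := ((h.2.2 i).mul k.2.1).mono (show a + b + 1 ≤ _ by linarith)
  exact (h1.add h2).congr fun x => vd_mul (h.diff x) (k.diff x) i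

theorem O1.const (c : ℝ) : O1 0 (fun _ : (𝔼 n) => c) :=
  ⟨contDiff_const, OO.const c, fun i => OO.zero.congr fun x => vd_const c x i⟩

theorem O1.zero : O1 a (fun _ : (𝔼 n) => (0 : ℝ)) :=
  ⟨contDiff_const, OO.zero, fun i => OO.zero.congr fun x => vd_const _ x i⟩

theorem O1.sum {ι : Type*} {s : Finset ι} {φ : ι → (𝔼 n) → ℝ}
    (h : ∀ i, O1 a (φ i)) : O1 a (fun x => ∑ i ∈ s, φ i x) := by
  classical
  induction s using Finset.induction_on with
  | empty => simpa using O1.zero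
  | insert i s hi ih => simp only [Finset.sum_insert hi]; exact (h i).add ih

theorem O1.inv (h : O1 0 φ) (h1 : ∀ x, 1 ≤ φ x) : O1 0 (fun x => (φ x)⁻¹) := by
  have hne : ∀ x, φ x ≠ 0 := fun x => by linarith [h1 x]
  have hO : OO 0 (fun x => (φ x)⁻¹) := (OO.const 1).of_le fun x => by
    rw [abs_inv, abs_one]
    exact inv_le_one_of_one_le₀ ((h1 x).trans (le_abs_self _))
  refine ⟨h.1.inv hne, hO, fun i => ?_⟩
  have := ((hO.mul hO).mul (h.2.2 i)).neg.mono (show (0:ℝ) + 1 ≤ _ by linarith)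
  refine this.congr fun x => ?_
  unfold pd
  have e := (hasDerivAt_inv (hne x)).comp_hasFDerivAt x (h.diff x).hasFDerivAt
  rw [show (fun x => (φ x)⁻¹) = Inv.inv ∘ φ from rfl, e.fderiv]
  simp [sq, mul_comm]

theorem O1.sqrt (h : O1 a φ) (h0 : ∀ x, 0 ≤ φ x) :
    O1 a (fun x => Real.sqrt (1 + φ x) - 1) := by
  have hne : ∀ x, 1 + φ x ≠ 0 := fun x => by linarith [h0 x]
  have h1 : ∀ x, 1 ≤ Real.sqrt (1 + φ x) := fun x => by
    rw [Real.one_le_sqrt]; linarith [h0 x]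
  refine ⟨(ContDiff.sqrt (contDiff_const.add h.1) hne).sub contDiff_const, ?_, fun i => ?_⟩
  · refine h.2.1.of_le fun x => ?_
    rw [abs_of_nonneg (by linarith [h1 x]), abs_of_nonneg (h0 x)]
    nlinarith [Real.sq_sqrt (show 0 ≤ 1 + φ x by linarith [h0 x]), h1 x]
  · refine (h.2.2 i).of_le fun x => ?_
    unfold pd
    have e := ((h.diff x).hasFDerivAt.const_add 1).sqrt (hne x)
    rw [(e.sub_const 1).fderiv, _root_.smul_apply, smul_eq_mul, abs_mul]
    refine mul_le_of_le_one_left (abs_nonneg _) ?_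
    rw [one_div, abs_inv, abs_of_nonneg (by positivity)]
    apply inv_le_one_of_one_le₀
    linarith [h1 x]
end OOl

section frame
variable {n : ℕ}

/-- Algebraic step of the frame construction. -/
theorem frame_alg (E g : Matrix (Fin n) (Fin n) ℝ) (a : Fin n → ℝ) (h : E * g * Eᵀ = 1)
    (s t : ℝ) (hs : s ^ 2 = 1 + (E *ᵥ a) ⬝ᵥ (E *ᵥ a)) (ht : t * (s * (1 + s)) = 1) :
    (E - t • (vecMulVec (E *ᵥ a) (E *ᵥ a) * E)) * (g + vecMulVec a a) *
      (E - t • (vecMulVec (E *ᵥ a) (E *ᵥ a) * E))ᵀ = 1 ∧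
    s * (E - t • (vecMulVec (E *ᵥ a) (E *ᵥ a) * E)).det = E.det := by
  set b := E *ᵥ a with hb
  set B := vecMulVec b b with hB
  have hBB : B * B = (s ^ 2 - 1) • B := by
    rw [hB, vecMulVec_mul_vecMulVec, hs, add_sub_cancel_left, vecMulVec_smul]
  have hBt : Bᵀ = B := by rw [hB, transpose_vecMulVec]
  have hEa : E * vecMulVec a a * Eᵀ = B := by
    rw [mul_vecMulVec, vecMulVec_mul, vecMul_transpose]
  have hP : E - t • (B * E) = (1 - t • B) * E := by rw [sub_mul, one_mul, smul_mul_assoc]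
  have hs0 : s ≠ 0 := by rintro rfl; simp at ht
  rw [hP]
  constructor
  · rw [transpose_mul, transpose_sub, transpose_smul, hBt, transpose_one]
    have : (1 - t • B) * E * (g + vecMulVec a a) * (Eᵀ * (1 - t • B)) =
        (1 - t • B) * (E * g * Eᵀ + E * vecMulVec a a * Eᵀ) * (1 - t • B) := by
      noncomm_ring
    rw [this, h, hEa]
    have e : (1 - t • B) * (1 + B) * (1 - t • B) = 1 + (1 - 2 * t) • B
        + (t ^ 2 - 2 * t) • (B * B) + t ^ 2 • (B * B * B) := by
      simp only [sub_mul, mul_sub, add_mul, mul_add, one_mul, mul_one, Matrix.smul_mul, Matrix.mul_smul]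
      module
    rw [e, hBB, smul_mul_assoc, hBB, smul_smul, smul_smul, smul_smul, add_assoc, add_assoc,
      ← add_smul, ← add_smul]
    have ht' : t = (s * (1 + s))⁻¹ := eq_inv_of_mul_eq_one_left ht
    have h1 : 1 + s ≠ 0 := by rintro h; rw [h] at ht; simp at ht
    have : (1 - 2 * t + ((t ^ 2 - 2 * t) * (s ^ 2 - 1) + t ^ 2 * (s ^ 2 - 1) * (s ^ 2 - 1))) = 0 := by
      rw [ht']; field_simp; ring
    rw [this, zero_smul, add_zero]
  · rw [det_mul, ← mul_assoc]
    have : (1 - t • B).det = 1 - t * (s ^ 2 - 1) := by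
      have e1 : (1 - t • B) = 1 + replicateCol Unit ((-t) • b) * replicateRow Unit b := by
        rw [← vecMulVec_eq, smul_vecMulVec, neg_smul, sub_eq_add_neg]
      rw [e1, det_one_add_replicateCol_mul_replicateRow, hs, dotProduct_smul, smul_eq_mul]
      ring
    rw [this]
    have : s * (1 - t * (s ^ 2 - 1)) = 1 := by linear_combination (1 - s) * ht
    rw [this, one_mul]

theorem frame_exists {ι : Type*} {q : ℝ} (hq : 0 < q)
    (a : ι → Fin n → (𝔼 n) → ℝ)
    (ha : ∀ α i, O1 q (a α i)) (s : Finset ι) :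
    ∃ (E : (𝔼 n) → Matrix (Fin n) (Fin n) ℝ) (w : (𝔼 n) → ℝ),
      (∀ i j, O1 (2 * q) (fun x => E x i j - (1 : Matrix (Fin n) (Fin n) ℝ) i j)) ∧
      (∀ i j, O1 (4 * q) (fun x => E x i j - E x j i)) ∧
      (∀ x, E x * (1 + ∑ α ∈ s, vecMulVec (fun i => a α i x) (fun i => a α i x)) * (E x)ᵀ = 1) ∧
      O1 (2 * q) (fun x => w x - 1) ∧ (∀ x, 1 ≤ w x) ∧ (∀ x, w x * (E x).det = 1) := by
  classical
  induction s using Finset.induction_on with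
  | empty =>
    refine ⟨fun _ => 1, fun _ => 1, fun i j => O1.zero.congr fun x => sub_self _,
      fun i j => O1.zero.congr fun x => ?_, fun x => by simp, O1.zero.congr fun x => sub_self _,
      fun x => le_rfl, fun x => by simp⟩
    simp only [one_apply, eq_comm (a := j)]; simp
  | insert α s hα ih =>
    obtain ⟨E, w, h1, h2, h3, h4, h5, h6⟩ := ih
    have hE : ∀ i j, O1 0 (fun x => E x i j) := fun i j =>
      (((h1 i j).mono (by positivity)).add (O1.const ((1 : Matrix (Fin n) (Fin n) ℝ) i j))).congr
        fun x => by ring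
    have hb : ∀ i, O1 q (fun x => (E x *ᵥ (fun i => a α i x)) i) := fun i => by
      refine (O1.sum (s := Finset.univ) fun j => ((hE i j).mul (ha α j)).mono (b := q)
        (by linarith)).congr fun x => rfl
    set b : (𝔼 n) → Fin n → ℝ := fun x => E x *ᵥ (fun i => a α i x) with hbd
    have hβ : O1 (2 * q) (fun x => b x ⬝ᵥ b x) :=
      (O1.sum (s := Finset.univ) fun j => ((hb j).mul (hb j)).mono (b := 2 * q)
        (by linarith)).congr fun x => rfl
    have hβ0 : ∀ x, 0 ≤ b x ⬝ᵥ b x := fun x => Finset.sum_nonneg fun i _ => mul_self_nonneg _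
    set σ : (𝔼 n) → ℝ := fun x => Real.sqrt (1 + b x ⬝ᵥ b x) with hσd
    have hσ1 : ∀ x, 1 ≤ σ x := fun x => by rw [hσd, Real.one_le_sqrt]; linarith [hβ0 x]
    have hσ2 : ∀ x, σ x ^ 2 = 1 + b x ⬝ᵥ b x := fun x => Real.sq_sqrt (by linarith [hβ0 x])
    have hσm : O1 (2 * q) (fun x => σ x - 1) := hβ.sqrt hβ0
    have hσ : O1 0 σ := ((hσm.mono (by positivity)).add (O1.const 1)).congr fun x => by ring
    set t : (𝔼 n) → ℝ := fun x => (σ x * (1 + σ x))⁻¹ with htd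
    have ht : O1 0 t := by
      refine O1.inv ?_ fun x => by nlinarith [hσ1 x]
      have := hσ.mul ((O1.const 1).add hσ)
      rwa [zero_add] at this
    have ht1 : ∀ x, t x * (σ x * (1 + σ x)) = 1 := fun x =>
      inv_mul_cancel₀ (by nlinarith [hσ1 x])
    have hG : ∀ i j, O1 (2 * q) (fun x => t x * (b x i * b x j)) := fun i j =>
      (ht.mul ((hb i).mul (hb j))).mono (by linarith)
    have eE : ∀ x i j, (E x - t x • (vecMulVec (b x) (b x) * E x)) i j = E x i j -
        ∑ k, t x * (b x i * b x k) * E x k j := by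
      intro x i j
      simp only [Matrix.sub_apply, Matrix.smul_apply, mul_apply, vecMulVec_apply, smul_eq_mul, Finset.mul_sum]
      congr 1
      exact Finset.sum_congr rfl fun k _ => by ring
    refine ⟨fun x => E x - t x • (vecMulVec (b x) (b x) * E x), fun x => w x * σ x, fun i j => ?_,
      fun i j => ?_, fun x => ?_, ?_, fun x => ?_, fun x => ?_⟩
    · refine ((h1 i j).sub (O1.sum (s := Finset.univ) fun k => ((hG i k).mul (hE k j)).mono
        (b := 2 * q) (by linarith))).congr fun x => ?_
      beta_reduce; rw [eE]; ring
    · refine ((h2 i j).sub ((O1.sum (s := Finset.univ) fun k => ((hG i k).mul (h1 k j)).mono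
        (b := 4 * q) (by linarith)).sub (O1.sum (s := Finset.univ) fun k => ((hG j k).mul
          (h1 k i)).mono (b := 4 * q) (by linarith)))).congr fun x => ?_
      beta_reduce; rw [eE, eE]
      have : ∀ i j, ∑ k, t x * (b x i * b x k) * (E x k j - (1 : Matrix (Fin n) (Fin n) ℝ) k j)
          = ∑ k, t x * (b x i * b x k) * E x k j - t x * (b x i * b x j) := by
        intro i j
        simp only [mul_sub, Finset.sum_sub_distrib, one_apply]
        simp
      rw [this, this]; ring
    · rw [Finset.sum_insert hα, add_comm (vecMulVec _ _), ← add_assoc]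
      exact (frame_alg (E x) _ _ (h3 x) (σ x) (t x) (hσ2 x) (ht1 x)).1
    · refine (((h4.mul hσ).mono (b := 2 * q) (by linarith)).add hσm).congr fun x => by ring
    · nlinarith [h5 x, hσ1 x]
    · rw [mul_assoc, (frame_alg (E x) _ _ (h3 x) (σ x) (t x) (hσ2 x) (ht1 x)).2, h6]
end frame

theorem det_deriv_one {n : ℕ} {M : (𝔼 n) → Matrix (Fin n) (Fin n) ℝ}
    {x : (𝔼 n)} (hM : ∀ i j, DifferentiableAt ℝ (fun y => M y i j) x)
    (h1 : M x = 1) (i : Fin n) :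
    vd (fun y => (M y).det) i x = ∑ k, vd (fun y => M y k k) i x := by
  have hd : ∀ σ : Equiv.Perm (Fin n), HasFDerivAt (fun y => ∏ k, M y (σ k) k)
      (∑ k, (∏ j ∈ Finset.univ.erase k, M x (σ j) j) • fderiv ℝ (fun y => M y (σ k) k) x) x :=
    fun σ => HasFDerivAt.finsetProd fun k _ => (hM (σ k) k).hasFDerivAt
  have e : ∀ σ : Equiv.Perm (Fin n), vd (fun y => ∏ k, M y (σ k) k) i x =
      if σ = 1 then ∑ k, vd (fun y => M y k k) i x else 0 := by
    intro σ
    unfold vd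
    rw [(hd σ).fderiv, _root_.sum_apply]
    split_ifs with h
    · subst h
      simp [h1]
    · refine Finset.sum_eq_zero fun k _ => ?_
      obtain ⟨j, hj⟩ : ∃ j, σ j ≠ j := by
        by_contra! hc
        exact h (Equiv.ext hc)
      obtain ⟨l, hl, hlk⟩ : ∃ l, σ l ≠ l ∧ l ≠ k := by
        by_cases hjk : j = k
        · refine ⟨σ j, fun h => hj (σ.injective h), by rw [← hjk]; exact hj⟩
        · exact ⟨j, hj, hjk⟩
      rw [Finset.prod_eq_zero (Finset.mem_erase.2 ⟨hlk, Finset.mem_univ l⟩)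
        (by rw [h1, one_apply_ne hl])]
      simp
  have e2 : (fun y => (M y).det) = fun y => ∑ σ : Equiv.Perm (Fin n),
      ((Equiv.Perm.sign σ : ℤ) : ℝ) • ∏ k, M y (σ k) k := by
    ext y; rw [det_apply']; rfl
  rw [e2, vd_sum fun σ _ => (hd σ).differentiableAt.fun_const_smul _]
  have e3 : ∀ σ : Equiv.Perm (Fin n), vd (fun y => ((Equiv.Perm.sign σ : ℤ) : ℝ) •
      ∏ k, M y (σ k) k) i x = if σ = 1 then ∑ k, vd (fun y => M y k k) i x else 0 := by
    intro σ
    rw [vd_smul (by fun_prop) (hd σ).differentiableAt, vd_const, e σ]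
    split_ifs with h
    · subst h; simp
    · simp
  simp only [e3]; simp

theorem det_deriv {n : ℕ} {E : (𝔼 n) → Matrix (Fin n) (Fin n) ℝ}
    {x : (𝔼 n)} (hE : ∀ i j, DifferentiableAt ℝ (fun y => E y i j) x)
    {G : Matrix (Fin n) (Fin n) ℝ} (hG : E x * G = 1) (i : Fin n) :
    vd (fun y => (E y).det) i x =
      (E x).det * ((Matrix.of fun a j => vd (fun y => E y a j) i x) * G).trace := by
  have hdet : G.det * (E x).det = 1 := by
    have := congrArg Matrix.det hG
    rw [det_mul, det_one] at this; linarith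
  have e : (fun y => (E y).det) = fun y => (E x).det * (E y * G).det := by
    ext y; rw [det_mul]; linear_combination (-(E y).det) * hdet
  have hM : ∀ a b, DifferentiableAt ℝ (fun y => (E y * G) a b) x := fun a b => by
    simp only [mul_apply]
    exact DifferentiableAt.fun_sum fun k _ => (hE a k).mul_const _
  have hMd : DifferentiableAt ℝ (fun y => (E y * G).det) x := by
    simp only [det_apply]
    exact DifferentiableAt.fun_sum fun σ _ => DifferentiableAt.fun_const_smul
      (HasFDerivAt.finsetProd fun k _ => (hM (σ k) k).hasFDerivAt).differentiableAt _
  rw [e, vd_mul (by fun_prop) hMd, vd_const, zero_mul, add_zero, det_deriv_one hM hG]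
  congr 1
  refine Finset.sum_congr rfl fun k _ => ?_
  simp only [mul_apply, diag_apply, of_apply]
  rw [vd_sum fun j _ => (hE k j).mul_const _]
  refine Finset.sum_congr rfl fun j _ => ?_
  rw [vd_mul (hE k j) (by fun_prop), vd_const, mul_zero, zero_add]

theorem clifford_matrix (n : ℕ) : ∃ (ι : Type) (_ : Fintype ι) (_ : DecidableEq ι) (_ : Nonempty ι)
    (γ : Fin n → Matrix ι ι ℝ), (∀ a, (γ a)ᵀ = - γ a) ∧
      ∀ a b, γ a * γ b + γ b * γ a = (if a = b then (-2 : ℝ) else 0) • 1 := by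
  induction n with
  | zero => exact ⟨Unit, inferInstance, inferInstance, inferInstance, fun _ => 0,
      fun a => a.elim0, fun a => a.elim0⟩
  | succ n ih =>
    obtain ⟨ι, _, _, _, γ, h1, h2⟩ := ih
    refine ⟨ι ⊕ ι, inferInstance, inferInstance, inferInstance,
      Fin.cons (fromBlocks 0 (-1) 1 0) (fun a => fromBlocks (γ a) 0 0 (- γ a)), fun a => ?_,
      fun a b => ?_⟩
    · refine Fin.cases ?_ (fun a => ?_) a
      · simp [fromBlocks_transpose, fromBlocks_neg]
      · simp [fromBlocks_transpose, fromBlocks_neg, h1]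
    · refine Fin.cases ?_ (fun a => ?_) a <;> refine Fin.cases ?_ (fun b => ?_) b
      · simp only [Fin.cons_zero, fromBlocks_multiply, fromBlocks_add, if_true]
        rw [← fromBlocks_one, fromBlocks_smul]
        congr 1 <;> simp <;> module
      · simp only [Fin.cons_zero, Fin.cons_succ, fromBlocks_multiply, fromBlocks_add]
        rw [if_neg (Fin.succ_ne_zero b).symm, zero_smul, ← fromBlocks_zero]
        congr 1 <;> simp
      · simp only [Fin.cons_zero, Fin.cons_succ, fromBlocks_multiply, fromBlocks_add]
        rw [if_neg (Fin.succ_ne_zero a), zero_smul, ← fromBlocks_zero]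
        congr 1 <;> simp
      · simp only [Fin.cons_succ, fromBlocks_multiply, fromBlocks_add, Fin.succ_inj]
        rw [← fromBlocks_one, fromBlocks_smul, ← h2]
        congr 1 <;> simp

theorem clifford_exists (n : ℕ) : ∃ (ι : Type) (_ : Fintype ι) (ψ : EuclideanSpace ℝ ι)
    (γ : Fin n → EuclideanSpace ℝ ι →L[ℝ] EuclideanSpace ℝ ι), ‖ψ‖ = 1 ∧
      (∀ a u v, inner ℝ (γ a u) v = - inner ℝ u (γ a v)) ∧
      ∀ a b, γ a * γ b + γ b * γ a = (if a = b then (-2 : ℝ) else 0) • 1 := by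
  obtain ⟨ι, _, _, _, γ, h1, h2⟩ := clifford_matrix n
  refine ⟨ι, inferInstance, EuclideanSpace.single (Classical.arbitrary ι) 1,
    fun a => Matrix.toEuclideanCLM (𝕜 := ℝ) (γ a), by simp, fun a u v => ?_, fun a b => ?_⟩
  · rw [← ContinuousLinearMap.adjoint_inner_right, ← ContinuousLinearMap.star_eq_adjoint, ← map_star,
      star_eq_conjTranspose, conjTranspose_eq_transpose_of_trivial, h1, map_neg]
    simp
  · rw [← map_mul, ← map_mul, ← map_add, h2, map_smul, map_one]

section cliff
variable {n : ℕ} {R : Type*} [Ring R] [Algebra ℝ R]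

/-- Spin lift of a matrix. -/
def spin (γ : Fin n → R) (om : Matrix (Fin n) (Fin n) ℝ) : R :=
  ∑ a, ∑ b, (om a b / 4) • (γ a * γ b)

theorem spin_comm {γ : Fin n → R}
    (hγ : ∀ a b, γ a * γ b + γ b * γ a = (if a = b then (-2 : ℝ) else 0) • (1 : R))
    {om : Matrix (Fin n) (Fin n) ℝ} (hom : omᵀ = - om) (c : Fin n) :
    spin γ om * γ c - γ c * spin γ om = ∑ b, om c b • γ b := by
  have hsk : ∀ a b, om a b = - om b a := fun a b => by
    have := congrFun (congrFun hom b) a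
    simpa using this
  have e : ∀ a b, (γ a * γ b) * γ c - γ c * (γ a * γ b) =
      (if b = c then (-2 : ℝ) else 0) • γ a - (if a = c then (-2 : ℝ) else 0) • γ b := by
    intro a b
    have h1 := congrArg (fun t => γ a * t) (hγ b c)
    have h2 := congrArg (fun t => t * γ b) (hγ a c)
    simp only [mul_smul_comm, mul_one, smul_mul_assoc, one_mul] at h1 h2
    rw [← h1, ← h2]; noncomm_ring
  unfold spin
  simp only [Finset.sum_mul, Finset.mul_sum, ← Finset.sum_sub_distrib, smul_mul_assoc,
    mul_smul_comm, ← smul_sub, e]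
  simp only [smul_sub, Finset.sum_sub_distrib, smul_smul]
  simp only [mul_ite, mul_zero, ite_smul, zero_smul]
  rw [Finset.sum_comm (f := fun a b => if a = c then (om a b / 4 * -2) • γ b else 0)]
  simp only [Finset.sum_ite_eq', Finset.mem_univ, if_true]
  rw [← Finset.sum_sub_distrib]
  refine Finset.sum_congr rfl fun b _ => ?_
  rw [hsk b c, ← sub_smul]; congr 1; ring

theorem spin_spin {γ : Fin n → R}
    (hγ : ∀ a b, γ a * γ b + γ b * γ a = (if a = b then (-2 : ℝ) else 0) • (1 : R))
    {o1 o2 : Matrix (Fin n) (Fin n) ℝ} (h1 : o1ᵀ = - o1) :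
    spin γ o1 * spin γ o2 - spin γ o2 * spin γ o1 = spin γ (o2 * o1 - o1 * o2) := by
  have hsk : ∀ a b, o1 a b = - o1 b a := fun a b => by
    have := congrFun (congrFun h1 b) a
    simpa using this
  have e : ∀ a b, spin γ o1 * (γ a * γ b) - (γ a * γ b) * spin γ o1 =
      (∑ d, o1 a d • (γ d * γ b)) + ∑ d, o1 b d • (γ a * γ d) := by
    intro a b
    have h3 := congrArg (fun t => t * γ b) (spin_comm hγ h1 a)
    have h4 := congrArg (fun t => γ a * t) (spin_comm hγ h1 b)
    simp only [Finset.sum_mul, Finset.mul_sum, smul_mul_assoc, mul_smul_comm] at h3 h4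
    rw [← h3, ← h4]; noncomm_ring
  have e2 : spin γ o1 * spin γ o2 - spin γ o2 * spin γ o1 =
      ∑ a, ∑ b, (o2 a b / 4) • ((∑ d, o1 a d • (γ d * γ b)) + ∑ d, o1 b d • (γ a * γ d)) := by
    simp only [← e]
    conv_lhs => rw [show spin γ o2 = ∑ a, ∑ b, (o2 a b / 4) • (γ a * γ b) from rfl]
    simp only [Finset.sum_mul, Finset.mul_sum, smul_mul_assoc, mul_smul_comm, smul_sub,
      Finset.sum_sub_distrib]
  rw [e2]
  simp only [smul_add, Finset.sum_add_distrib, Finset.smul_sum, smul_smul]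
  have e3 : ∑ a, ∑ b, ∑ d, (o2 a b / 4 * o1 a d) • (γ d * γ b) =
      ∑ a, ∑ b, (- (o1 * o2) a b / 4) • (γ a * γ b) := by
    simp only [mul_apply, ← Finset.sum_neg_distrib, Finset.sum_div, Finset.sum_smul]
    calc _ = ∑ a, ∑ d, ∑ b, (o2 a b / 4 * o1 a d) • (γ d * γ b) :=
          Finset.sum_congr rfl fun a _ => Finset.sum_comm
      _ = ∑ d, ∑ a, ∑ b, (o2 a b / 4 * o1 a d) • (γ d * γ b) := Finset.sum_comm
      _ = _ := by
        refine Finset.sum_congr rfl fun d _ => ?_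
        rw [Finset.sum_comm]
        refine Finset.sum_congr rfl fun b _ => Finset.sum_congr rfl fun a _ => ?_
        rw [hsk d a]; congr 1; ring
  have e4 : ∑ a, ∑ b, ∑ d, (o2 a b / 4 * o1 b d) • (γ a * γ d) =
      ∑ a, ∑ b, ((o2 * o1) a b / 4) • (γ a * γ b) := by
    simp only [mul_apply, Finset.sum_div, Finset.sum_smul]
    refine Finset.sum_congr rfl fun a _ => ?_
    rw [Finset.sum_comm]
    refine Finset.sum_congr rfl fun b _ => Finset.sum_congr rfl fun d _ => ?_
    congr 1; ring
  rw [e3, e4]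
  unfold spin
  simp only [← Finset.sum_add_distrib, ← add_smul]
  refine Finset.sum_congr rfl fun a _ => Finset.sum_congr rfl fun b _ => ?_
  rw [Matrix.sub_apply]; congr 1; ring

theorem cliff_c {γ : Fin n → R}
    (hγ : ∀ a b, γ a * γ b + γ b * γ a = (if a = b then (-2 : ℝ) else 0) • (1 : R))
    (E : Matrix (Fin n) (Fin n) ℝ) (i j : Fin n) :
    (∑ a, E a i • γ a) * (∑ a, E a j • γ a) + (∑ a, E a j • γ a) * (∑ a, E a i • γ a) =
      (-2 * (Eᵀ * E) i j) • (1 : R) := by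
  have : (∑ a, E a j • γ a) * (∑ a, E a i • γ a) = ∑ a, ∑ b, (E a i * E b j) • (γ b * γ a) := by
    simp only [Finset.sum_mul, Finset.mul_sum, smul_mul_assoc, mul_smul_comm, smul_smul,
      Finset.smul_sum]
  rw [this]
  simp only [Finset.sum_mul, Finset.mul_sum, smul_mul_assoc, mul_smul_comm, smul_smul,
    Finset.smul_sum]
  rw [Finset.sum_comm]
  simp only [← Finset.sum_add_distrib]
  have : ∀ a b, (E b j * E a i) • (γ a * γ b) + (E a i * E b j) • (γ b * γ a) =
      (if a = b then -2 * (E a i * E b j) else 0) • (1 : R) := by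
    intro a b
    rw [mul_comm (E b j), ← smul_add, hγ, smul_smul]
    congr 1; split_ifs <;> ring
  simp only [this, ← Finset.sum_smul]
  congr 1
  simp [mul_apply, Finset.mul_sum]

theorem spin_conj (γ : Fin n → R) (E Y : Matrix (Fin n) (Fin n) ℝ) :
    spin γ (E * Y * Eᵀ) = ∑ k, ∑ l, (Y k l / 4) • ((∑ a, E a k • γ a) * (∑ b, E b l • γ b)) := by
  unfold spin
  simp only [Finset.sum_mul, Finset.mul_sum, smul_mul_assoc, mul_smul_comm, smul_smul,
    Finset.smul_sum, mul_apply, Finset.sum_div, Finset.sum_smul, transpose_apply]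
  calc _ = ∑ a, ∑ l, ∑ b, ∑ k, (E a k * Y k l * E b l / 4) • (γ a * γ b) :=
        Finset.sum_congr rfl fun a _ => Finset.sum_comm
    _ = ∑ l, ∑ a, ∑ b, ∑ k, (E a k * Y k l * E b l / 4) • (γ a * γ b) := Finset.sum_comm
    _ = ∑ l, ∑ k, ∑ a, ∑ b, (E a k * Y k l * E b l / 4) • (γ a * γ b) := by
        refine Finset.sum_congr rfl fun l _ => ?_
        calc _ = ∑ a, ∑ k, ∑ b, (E a k * Y k l * E b l / 4) • (γ a * γ b) :=
              Finset.sum_congr rfl fun a _ => Finset.sum_comm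
          _ = _ := Finset.sum_comm
    _ = ∑ k, ∑ l, ∑ a, ∑ b, (E a k * Y k l * E b l / 4) • (γ a * γ b) := Finset.sum_comm
    _ = _ := by
        refine Finset.sum_congr rfl fun k _ => Finset.sum_congr rfl fun l _ => ?_
        rw [Finset.sum_comm]
        refine Finset.sum_congr rfl fun a _ => Finset.sum_congr rfl fun b _ => ?_
        congr 1; ring
end cliff

section contract
variable {n m : ℕ} {R : Type*} [Ring R] [Algebra ℝ R] {c : Fin n → R}
  {gi : Matrix (Fin n) (Fin n) ℝ}

theorem sym_contract (hc : ∀ i j, c i * c j + c j * c i = (-2 * gi i j) • (1 : R))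
    {f : Fin n → Fin n → ℝ} (hf : ∀ i j, f i j = f j i) :
    ∑ i, ∑ j, f i j • (c i * c j) = - (∑ i, ∑ j, gi i j * f i j) • (1 : R) := by
  have h2 : (2 : ℝ) • ∑ i, ∑ j, f i j • (c i * c j) =
      (2 : ℝ) • - (∑ i, ∑ j, gi i j * f i j) • (1 : R) := by
    have e : ∑ i, ∑ j, f i j • (c i * c j) = ∑ i, ∑ j, f i j • (c j * c i) := by
      rw [Finset.sum_comm]
      exact Finset.sum_congr rfl fun i _ => Finset.sum_congr rfl fun j _ => by rw [hf]
    rw [two_smul]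
    nth_rewrite 2 [e]
    simp only [← Finset.sum_add_distrib, ← smul_add, hc, smul_smul, ← Finset.sum_smul,
      ← Finset.sum_neg_distrib, Finset.mul_sum]
    congr 1
    exact Finset.sum_congr rfl fun i _ => Finset.sum_congr rfl fun j _ => by ring
  exact smul_right_injective R (two_ne_zero (α := ℝ)) h2

theorem contract1 (hc : ∀ i j, c i * c j + c j * c i = (-2 * gi i j) • (1 : R))
    {f h : Fin n → Fin n → ℝ} (hf : ∀ i j, f i j = f j i) (hh : ∀ i j, h i j = h j i) :
    ∑ i, ∑ j, ∑ k, ∑ l, (f j k * h i l) • (c i * c j * (c k * c l)) =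
      ((∑ i, ∑ j, gi i j * f i j) * (∑ i, ∑ j, gi i j * h i j)) • (1 : R) := by
  have e : ∀ i, ∑ j, ∑ k, ∑ l, (f j k * h i l) • (c i * c j * (c k * c l)) =
      ∑ l, h i l • (c i * (∑ j, ∑ k, f j k • (c j * c k)) * c l) := by
    intro i
    simp only [Finset.mul_sum, Finset.sum_mul, mul_smul_comm, smul_mul_assoc, Finset.smul_sum,
      smul_smul]
    calc _ = ∑ j, ∑ l, ∑ k, (f j k * h i l) • (c i * c j * (c k * c l)) :=
          Finset.sum_congr rfl fun j _ => Finset.sum_comm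
      _ = ∑ l, ∑ j, ∑ k, (f j k * h i l) • (c i * c j * (c k * c l)) := Finset.sum_comm
      _ = _ := by
        refine Finset.sum_congr rfl fun l _ => Finset.sum_congr rfl fun j _ =>
          Finset.sum_congr rfl fun k _ => ?_
        rw [mul_comm]; simp only [mul_assoc]
  simp only [e, sym_contract hc hf, mul_smul_comm, mul_one, smul_mul_assoc]
  have : ∀ i l, h i l • -(∑ i, ∑ j, gi i j * f i j) • (c i * c l) =
      -(∑ i, ∑ j, gi i j * f i j) • (h i l • (c i * c l)) := fun i l => smul_comm _ _ _
  simp only [this, ← Finset.smul_sum]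
  rw [sym_contract hc hh, smul_smul]
  congr 1; ring

theorem contract2 (hc : ∀ i j, c i * c j + c j * c i = (-2 * gi i j) • (1 : R))
    {f h : Fin n → Fin n → ℝ} (hf : ∀ i j, f i j = f j i) (hh : ∀ i j, h i j = h j i) :
    ∑ i, ∑ j, ∑ k, ∑ l, (f i k * h j l) • (c i * c j * (c k * c l)) =
      - ((∑ i, ∑ j, gi i j * f i j) * (∑ i, ∑ j, gi i j * h i j)) • (1 : R)
      - (2 : ℝ) • ∑ i, ∑ l, (∑ j, ∑ k, f i k * gi j k * h j l) • (c i * c l) := by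
  have e : ∀ i j k l, (f i k * h j l) • (c i * c j * (c k * c l)) =
      - ((f i k • (c i * c k)) * (h j l • (c j * c l)))
      - (2 : ℝ) • ((f i k * gi j k * h j l) • (c i * c l)) := by
    intro i j k l
    have h1 : c j * c k = (-2 * gi j k) • (1 : R) - c k * c j := by rw [← hc]; abel
    have : c i * c j * (c k * c l) = c i * (c j * c k) * c l := by simp only [mul_assoc]
    rw [this, h1]
    simp only [mul_sub, sub_mul, smul_mul_assoc, mul_smul_comm, mul_one, mul_assoc]
    module
  simp only [e, Finset.sum_sub_distrib, Finset.sum_neg_distrib, ← Finset.smul_sum]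
  have e1 : ∑ i, ∑ j, ∑ k, ∑ l, (f i k • (c i * c k)) * (h j l • (c j * c l)) =
      (∑ i, ∑ k, f i k • (c i * c k)) * (∑ j, ∑ l, h j l • (c j * c l)) := by
    rw [Finset.sum_mul]
    refine Finset.sum_congr rfl fun i _ => ?_
    rw [Finset.sum_comm, Finset.sum_mul]
    refine Finset.sum_congr rfl fun k _ => ?_
    rw [Finset.mul_sum]
    exact Finset.sum_congr rfl fun j _ => by rw [Finset.mul_sum]
  rw [e1, sym_contract hc hf, sym_contract hc hh, smul_mul_smul_comm, mul_one, neg_mul_neg,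
    neg_smul]
  have e2 : ∑ i, ∑ j, ∑ k, ∑ l, (f i k * gi j k * h j l) • (c i * c l) =
      ∑ i, ∑ l, (∑ j, ∑ k, f i k * gi j k * h j l) • (c i * c l) := by
    refine Finset.sum_congr rfl fun i _ => ?_
    simp only [Finset.sum_smul]
    calc _ = ∑ j, ∑ l, ∑ k, (f i k * gi j k * h j l) • (c i * c l) :=
          Finset.sum_congr rfl fun j _ => Finset.sum_comm
      _ = _ := Finset.sum_comm
  rw [e2]

theorem curv_contract (hc : ∀ i j, c i * c j + c j * c i = (-2 * gi i j) • (1 : R))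
    (hgi : ∀ i j, gi i j = gi j i) {V : Matrix (Fin m) (Fin m) ℝ} (hV : ∀ α β, V α β = V β α)
    {f : Fin m → Fin n → Fin n → ℝ} (hf : ∀ α i j, f α i j = f α j i) :
    ∑ i, ∑ j, c i * c j * ∑ k, ∑ l,
      ((∑ α, ∑ β, V α β * (f α j k * f β i l - f α i k * f β j l)) / 4) • (c k * c l) =
    ((∑ i, ∑ j, ∑ k, ∑ l, ∑ α, ∑ β, gi i j * gi k l * V α β *
      (f β i j * f α k l - f β i k * f α j l)) / 2) • (1 : R) := by
  set τ : Fin m → ℝ := fun α => ∑ i, ∑ j, gi i j * f α i j with hτ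
  set P : Fin n → Fin n → ℝ := fun i l => ∑ α, ∑ β, V α β * ∑ j, ∑ k, f α i k * gi j k * f β j l
    with hP
  have hPs : ∀ i l, P i l = P l i := by
    intro i l
    simp only [hP]
    rw [Finset.sum_comm]
    refine Finset.sum_congr rfl fun α _ => Finset.sum_congr rfl fun β _ => ?_
    rw [hV]; congr 1
    rw [Finset.sum_comm]
    refine Finset.sum_congr rfl fun j _ => Finset.sum_congr rfl fun k _ => ?_
    rw [hgi k j, hf β i, hf α k l]; ring
  have e0 : ∀ i j k l, c i * c j * (((∑ α, ∑ β, V α β * (f α j k * f β i l - f α i k * f β j l)) / 4)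
      • (c k * c l)) = ∑ α, ∑ β, (V α β / 4) • ((f α j k * f β i l) • (c i * c j * (c k * c l))
        - (f α i k * f β j l) • (c i * c j * (c k * c l))) := by
    intro i j k l
    rw [mul_smul_comm, Finset.sum_div, Finset.sum_smul]
    refine Finset.sum_congr rfl fun α _ => ?_
    rw [Finset.sum_div, Finset.sum_smul]
    refine Finset.sum_congr rfl fun β _ => ?_
    module
  have e1 : ∑ i, ∑ j, c i * c j * ∑ k, ∑ l,
      ((∑ α, ∑ β, V α β * (f α j k * f β i l - f α i k * f β j l)) / 4) • (c k * c l) =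
      ∑ α, ∑ β, (V α β / 4) • ((2 * (τ α * τ β)) • (1 : R) + (2 : ℝ) • ∑ i, ∑ l,
        (∑ j, ∑ k, f α i k * gi j k * f β j l) • (c i * c l)) := by
    have : ∀ α β, (2 * (τ α * τ β)) • (1 : R) + (2 : ℝ) • ∑ i, ∑ l,
        (∑ j, ∑ k, f α i k * gi j k * f β j l) • (c i * c l) = ∑ i, ∑ j, ∑ k, ∑ l,
        ((f α j k * f β i l) • (c i * c j * (c k * c l))
        - (f α i k * f β j l) • (c i * c j * (c k * c l))) := by
      intro α β
      simp only [Finset.sum_sub_distrib, contract1 hc (hf α) (hf β), contract2 hc (hf α) (hf β), hτ]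
      module
    simp only [this]
    simp only [Finset.mul_sum, e0, Finset.smul_sum]
    have sw : ∀ G : Fin n → Fin m → Fin m → R, ∑ i, ∑ α, ∑ β, G i α β = ∑ α, ∑ β, ∑ i, G i α β := by
      intro G
      rw [Finset.sum_comm]
      exact Finset.sum_congr rfl fun α _ => Finset.sum_comm
    simp only [sw]
  have e2 : ∑ α, ∑ β, (V α β / 4) • ((2 : ℝ) • ∑ i, ∑ l,
        (∑ j, ∑ k, f α i k * gi j k * f β j l) • (c i * c l)) =
      (- (∑ i, ∑ j, gi i j * P i j) / 2) • (1 : R) := by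
    rw [neg_div, neg_smul, ← neg_smul]
    have := sym_contract hc hPs
    have h2 := congrArg (fun t => (1 / 2 : ℝ) • t) this
    simp only [smul_smul] at h2
    rw [show -((∑ i, ∑ j, gi i j * P i j) / 2) = 1 / 2 * -(∑ i, ∑ j, gi i j * P i j) by ring, ← h2]
    simp only [hP, Finset.smul_sum, smul_smul, Finset.sum_smul, Finset.mul_sum]
    have sw : ∀ G : Fin n → Fin m → Fin m → R, ∑ i, ∑ α, ∑ β, G i α β = ∑ α, ∑ β, ∑ i, G i α β := by
      intro G
      rw [Finset.sum_comm]
      exact Finset.sum_congr rfl fun α _ => Finset.sum_comm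
    simp only [sw]
    refine Finset.sum_congr rfl fun α _ => Finset.sum_congr rfl fun β _ =>
      Finset.sum_congr rfl fun i _ => Finset.sum_congr rfl fun j _ =>
      Finset.sum_congr rfl fun k _ => Finset.sum_congr rfl fun l _ => ?_
    congr 1; ring
  rw [e1]
  simp only [smul_add, Finset.sum_add_distrib]
  rw [e2]
  simp only [smul_smul, ← Finset.sum_smul, ← add_smul]
  congr 1
  have swr : ∀ G : Fin n → Fin m → Fin m → ℝ, ∑ i, ∑ α, ∑ β, G i α β = ∑ α, ∑ β, ∑ i, G i α β := by
    intro G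
    rw [Finset.sum_comm]
    exact Finset.sum_congr rfl fun α _ => Finset.sum_comm
  have f1 : ∑ i, ∑ j, ∑ k, ∑ l, ∑ α, ∑ β, gi i j * gi k l * V α β * (f β i j * f α k l) =
      ∑ α, ∑ β, V α β * (τ α * τ β) := by
    have ht : ∀ α β, V α β * (τ α * τ β) = ∑ i, ∑ j, ∑ k, ∑ l,
        gi i j * gi k l * V α β * (f β i j * f α k l) := by
      intro α β
      rw [mul_comm (τ α)]
      simp only [hτ]
      rw [Finset.sum_mul, Finset.mul_sum]
      refine Finset.sum_congr rfl fun i _ => ?_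
      rw [Finset.sum_mul, Finset.mul_sum]
      refine Finset.sum_congr rfl fun j _ => ?_
      rw [Finset.mul_sum, Finset.mul_sum]
      refine Finset.sum_congr rfl fun k _ => ?_
      rw [Finset.mul_sum, Finset.mul_sum]
      exact Finset.sum_congr rfl fun l _ => by ring
    simp only [ht, swr]
  have f2 : ∑ i, ∑ j, ∑ k, ∑ l, ∑ α, ∑ β, gi i j * gi k l * V α β * (f β i k * f α j l) =
      ∑ i, ∑ j, gi i j * P i j := by
    simp only [hP, Finset.mul_sum]
    refine Finset.sum_congr rfl fun i _ => Finset.sum_congr rfl fun j _ => ?_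
    simp only [swr]
    rw [Finset.sum_comm]
    refine Finset.sum_congr rfl fun α _ => Finset.sum_congr rfl fun β _ => ?_
    rw [Finset.sum_comm]
    refine Finset.sum_congr rfl fun k _ => Finset.sum_congr rfl fun l _ => ?_
    rw [hV, hf β j k, hgi k l]; ring
  simp only [mul_sub, Finset.sum_sub_distrib, f1, f2]
  rw [neg_div, ← sub_eq_add_neg, sub_div]
  congr 1
  rw [Finset.sum_div]
  refine Finset.sum_congr rfl fun α _ => ?_
  rw [Finset.sum_div]
  exact Finset.sum_congr rfl fun β _ => by ring
end contract

set_option linter.unusedSectionVars false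
set_option linter.unusedVariables false
section matd
variable {n : ℕ} {ι κ μ : Type*} [Fintype ι] [Fintype κ] [Fintype μ]

/-- Entrywise regularity of a matrix valued function. -/
def MC (k : ℕ) (M : (𝔼 n) → Matrix ι κ ℝ) : Prop :=
  ∀ a b, ContDiff ℝ k (fun y => M y a b)

/-- Entrywise partial derivative. -/
def md (M : (𝔼 n) → Matrix ι κ ℝ) (i : Fin n)
    (x : (𝔼 n)) : Matrix ι κ ℝ :=
  of fun a b => vd (fun y => M y a b) i x

variable {k : ℕ} {M N : (𝔼 n) → Matrix ι κ ℝ}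
  {P : (𝔼 n) → Matrix κ μ ℝ}

theorem MC.mono {l : ℕ} (h : MC k M) (hl : l ≤ k) : MC l M :=
  fun a b => (h a b).of_le (by exact_mod_cast hl)

theorem MC.diff (h : MC 1 M) (a : ι) (b : κ) (x : (𝔼 n)) :
    DifferentiableAt ℝ (fun y => M y a b) x :=
  (h a b).differentiable (by norm_num) x

theorem MC.add (h : MC k M) (h' : MC k N) : MC k (fun x => M x + N x) :=
  fun a b => (h a b).add (h' a b)

theorem MC.mul (h : MC k M) (h' : MC k P) : MC k (fun x => M x * P x) := fun a b => by
  simp only [mul_apply]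
  exact ContDiff.sum fun c _ => (h a c).mul (h' c b)

theorem MC.tr (h : MC k M) : MC k (fun x => (M x)ᵀ) := fun a b => h b a

theorem MC.md (h : MC (k + 1) M) (i : Fin n) : MC k (md M i) := fun a b => vd_contDiff (h a b) i

theorem md_add (h : MC 1 M) (h' : MC 1 N) (i : Fin n) (x : (𝔼 n)) :
    md (fun x => M x + N x) i x = md M i x + md N i x := by
  ext a b
  exact vd_add (h.diff a b x) (h'.diff a b x) i

theorem md_mul (h : MC 1 M) (h' : MC 1 P) (i : Fin n) (x : (𝔼 n)) :
    md (fun x => M x * P x) i x = md M i x * P x + M x * md P i x := by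
  ext a b
  simp only [md, of_apply, mul_apply, Matrix.add_apply]
  rw [vd_sum (a := fun c y => M y a c * P y c b) fun c _ => (h.diff a c x).fun_mul (h'.diff c b x), ← Finset.sum_add_distrib]
  refine Finset.sum_congr rfl fun c _ => ?_
  rw [vd_mul (h.diff a c x) (h'.diff c b x)]; ring

theorem md_symm (h : MC 2 M) (i j : Fin n) (x : (𝔼 n)) :
    md (md M i) j x = md (md M j) i x := by
  ext a b
  exact vd_symm (h a b) i j x

theorem md_tr (i : Fin n) (x : (𝔼 n)) :
    md (fun x => (M x)ᵀ) i x = (md M i x)ᵀ := rfl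
end matd

/-- Graph geometry: orthonormal frame `E` for the metric `1 + Aᵀ A`. -/
structure Geo (n m : ℕ) where
  A : (𝔼 n) → Matrix (Fin m) (Fin n) ℝ
  E : (𝔼 n) → Matrix (Fin n) (Fin n) ℝ
  w : (𝔼 n) → ℝ
  hA : MC 2 A
  hE : MC 2 E
  hw : ContDiff ℝ 2 w
  sym : ∀ i j x α, md A i x α j = md A j x α i
  hEg : ∀ x, E x * (1 + (A x)ᵀ * A x) * (E x)ᵀ = 1
  hdet : ∀ x, w x * (E x).det = 1

namespace Geo
variable {n m : ℕ} (d : Geo n m)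

/-- The metric. -/
def g (x : (𝔼 n)) : Matrix (Fin n) (Fin n) ℝ := 1 + (d.A x)ᵀ * d.A x

/-- The second derivatives. -/
def H (i : Fin n) (x : (𝔼 n)) : Matrix (Fin n) (Fin m) ℝ := (md d.A i x)ᵀ

/-- The connection matrix. -/
def om (i : Fin n) (x : (𝔼 n)) : Matrix (Fin n) (Fin n) ℝ :=
  md d.E i x * (d.g x * (d.E x)ᵀ) + d.E x * (d.H i x * d.A x) * (d.E x)ᵀ

theorem gT (x : (𝔼 n)) : (d.g x)ᵀ = d.g x := by
  simp [g, transpose_mul]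

theorem hg : MC 2 d.g :=
  MC.add (fun a b => contDiff_const) (d.hA.tr.mul d.hA)

theorem mdg (i : Fin n) (x : (𝔼 n)) :
    md d.g i x = d.H i x * d.A x + (d.H i x * d.A x)ᵀ := by
  have h1 := d.hA.mono (l := 1) (by norm_num)
  have : md d.g i x = md (fun x => (1 : Matrix (Fin n) (Fin n) ℝ)) i x +
      md (fun x => (d.A x)ᵀ * d.A x) i x :=
    md_add (M := fun _ => 1) (fun a b => contDiff_const) (h1.tr.mul h1) i x
  rw [this, md_mul h1.tr h1, md_tr]
  have h0 : md (fun x => (1 : Matrix (Fin n) (Fin n) ℝ)) i x = 0 := by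
    ext a b; exact vd_const _ x i
  rw [h0, zero_add, transpose_mul]; rfl

theorem EG (x : (𝔼 n)) : d.E x * (d.g x * (d.E x)ᵀ) = 1 := by
  rw [← Matrix.mul_assoc]; exact d.hEg x

theorem GE (x : (𝔼 n)) : d.g x * (d.E x)ᵀ * d.E x = 1 :=
  mul_eq_one_comm.mp (d.EG x)

theorem EEg (x : (𝔼 n)) : (d.E x)ᵀ * d.E x * d.g x = 1 := by
  have := congrArg transpose (d.GE x)
  simpa [transpose_mul, gT, Matrix.mul_assoc] using this

theorem om_skew (i : Fin n) (x : (𝔼 n)) : (d.om i x)ᵀ = - d.om i x := by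
  have hE := d.hE.mono (l := 1) (by norm_num)
  have hg := d.hg.mono (l := 1) (by norm_num)
  have h := md_mul (hE.mul hg) hE.tr i x
  rw [md_mul hE hg, md_tr, mdg] at h
  have h0 : md (fun x => d.E x * d.g x * (d.E x)ᵀ) i x = 0 := by
    ext a b
    have : (fun y => (d.E y * d.g y * (d.E y)ᵀ) a b) = fun _ => (1 : Matrix (Fin n) (Fin n) ℝ) a b := by
      funext y; rw [show d.E y * d.g y * (d.E y)ᵀ = 1 from d.hEg y]
    simp only [md, of_apply, this]; exact vd_const _ x i
  rw [h0] at h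
  rw [eq_neg_iff_add_eq_zero, h]
  simp only [om, transpose_add, transpose_mul, transpose_transpose, gT]
  noncomm_ring

theorem om_E (i : Fin n) (x : (𝔼 n)) :
    d.om i x * d.E x = md d.E i x + d.E x * (d.H i x * d.A x) * ((d.E x)ᵀ * d.E x) := by
  rw [om, Matrix.add_mul, Matrix.mul_assoc (md d.E i x), GE, Matrix.mul_one]
  noncomm_ring

theorem vdw (i : Fin n) (x : (𝔼 n)) :
    vd d.w i x = d.w x * (d.H i x * d.A x * ((d.E x)ᵀ * d.E x)).trace := by
  have hE := d.hE.mono (l := 1) (by norm_num)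
  have h1 := det_deriv (fun a b => hE.diff a b x) (d.EG x) i
  have hw : DifferentiableAt ℝ d.w x := d.hw.differentiable (by norm_num) x
  have hdd : DifferentiableAt ℝ (fun y => (d.E y).det) x := by
    simp only [det_apply]
    exact DifferentiableAt.fun_sum fun s _ => DifferentiableAt.fun_const_smul
      (HasFDerivAt.finsetProd fun a _ => (hE.diff (s a) a x).hasFDerivAt).differentiableAt _
  have h2 := vd_mul hw hdd i
  have h0 : vd (fun y => d.w y * (d.E y).det) i x = 0 := by
    simp only [d.hdet]; exact vd_const _ x i
  have ht : (d.om i x).trace = 0 := by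
    have := congrArg trace (d.om_skew i x)
    rw [trace_transpose, trace_neg] at this; linarith
  rw [om, trace_add, trace_mul_comm (d.E x * _),
    ← Matrix.mul_assoc (d.E x)ᵀ, trace_mul_comm _ (d.H i x * d.A x)] at ht
  rw [h0, h1] at h2
  have hd := d.hdet x
  change (md d.E i x * _).trace + _ = 0 at ht
  change 0 = d.w x * ((d.E x).det * (md d.E i x * _).trace) + _ at h2
  have hne : (d.E x).det ≠ 0 := fun h => by simp [h] at hd
  refine mul_right_cancel₀ hne ?_
  rw [mul_right_comm, hd]
  rw [← mul_assoc, hd] at h2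
  linarith

/-- The symmetric part of the derivative of the connection. -/
def Z (i j : Fin n) (x : (𝔼 n)) : Matrix (Fin n) (Fin n) ℝ :=
  md (md d.E j) i x * (d.g x * (d.E x)ᵀ) + d.E x * (md (d.H j) i x * d.A x) * (d.E x)ᵀ +
  md d.E j x * (d.H i x * d.A x) * (d.E x)ᵀ + md d.E i x * (d.H j x * d.A x) * (d.E x)ᵀ

theorem Z_symm (i j : Fin n) (x : (𝔼 n)) : d.Z i j x = d.Z j i x := by
  have : md (d.H j) i x = md (d.H i) j x := md_symm d.hA.tr j i x
  rw [Z, Z, this, md_symm d.hE]; abel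

/-- The normal projection. -/
def V (x : (𝔼 n)) : Matrix (Fin m) (Fin m) ℝ :=
  1 - d.A x * ((d.E x)ᵀ * d.E x) * (d.A x)ᵀ

theorem ring_id {R : Type*} [Ring R] {E F g Pj Qi Kj Li : R} (h1 : g * F * E = 1)
    (h2 : F * E * g = 1) : (Pj * (g * F) + E * Kj * F) * (E * g * Qi + E * Li * F) =
      Pj * g * Qi + Pj * Li * F + E * Kj * Qi + E * Kj * (F * E) * Li * F := by
  have e1 : ∀ u, g * (F * (E * u)) = u := fun u => by rw [← mul_assoc, ← mul_assoc, h1, one_mul]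
  have e2 : ∀ u, F * (E * (g * u)) = u := fun u => by rw [← mul_assoc, ← mul_assoc, h2, one_mul]
  simp only [mul_add, add_mul, mul_assoc, e1, e2]; abel

theorem curv (i j : Fin n) (x : (𝔼 n)) :
    md (d.om j) i x + d.om j x * d.om i x =
      d.Z i j x + d.E x * (d.H j x * d.V x * (d.H i x)ᵀ) * (d.E x)ᵀ := by
  have hE := d.hE.mono (l := 1) (by norm_num)
  have hg := d.hg.mono (l := 1) (by norm_num)
  have hA := d.hA.mono (l := 1) (by norm_num)
  have hH : MC 1 (d.H j) := (MC.md (k := 1) d.hA j).tr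
  have hdE : MC 1 (md d.E j) := MC.md (k := 1) d.hE j
  have e1 : md (d.om j) i x = md (md d.E j) i x * (d.g x * (d.E x)ᵀ) + md d.E j x *
      ((d.H i x * d.A x + (d.H i x * d.A x)ᵀ) * (d.E x)ᵀ + d.g x * (md d.E i x)ᵀ) +
      ((md d.E i x * (d.H j x * d.A x) +
        d.E x * (md (d.H j) i x * d.A x + d.H j x * (d.H i x)ᵀ)) * (d.E x)ᵀ
        + d.E x * (d.H j x * d.A x) * (md d.E i x)ᵀ) := by
    have := md_add (hdE.mul (hg.mul hE.tr)) ((hE.mul (hH.mul hA)).mul hE.tr) i x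
    rw [md_mul hdE (hg.mul hE.tr), md_mul hg hE.tr, md_mul (hE.mul (hH.mul hA)) hE.tr,
      md_mul hE (hH.mul hA), md_mul hH hA, mdg, md_tr] at this
    exact this
  have e2 : d.om j x * d.om i x = - (d.om j x * (d.om i x)ᵀ) := by rw [om_skew]; simp
  have e3 : (d.om i x)ᵀ = d.E x * d.g x * (md d.E i x)ᵀ +
      d.E x * (d.H i x * d.A x)ᵀ * (d.E x)ᵀ := by
    simp only [om, transpose_add, transpose_mul, transpose_transpose, gT, Matrix.mul_assoc]
  rw [e2, e3, e1, om, ring_id (d.GE x) (d.EEg x)]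
  have e4 : d.H j x * d.V x * (d.H i x)ᵀ = d.H j x * (d.H i x)ᵀ -
      (d.H j x * d.A x) * ((d.E x)ᵀ * d.E x) * (d.H i x * d.A x)ᵀ := by
    rw [V]
    simp only [Matrix.mul_sub, Matrix.sub_mul, Matrix.mul_one, transpose_mul, Matrix.mul_assoc]
  rw [e4, Z]
  generalize d.H j x * d.A x = Kj
  generalize (d.H i x * d.A x)ᵀ = Li
  noncomm_ring

theorem V_inv (x : (𝔼 n)) : (1 + d.A x * (d.A x)ᵀ)⁻¹ = d.V x := by
  refine inv_eq_right_inv ?_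
  have h := mul_eq_one_comm.mp (d.EEg x)
  rw [g, Matrix.add_mul, Matrix.one_mul] at h
  have h2 : d.A x * ((d.E x)ᵀ * d.E x) * (d.A x)ᵀ + d.A x * (d.A x)ᵀ *
      (d.A x * ((d.E x)ᵀ * d.E x) * (d.A x)ᵀ) = d.A x * (d.A x)ᵀ := by
    have := congrArg (fun t => d.A x * t * (d.A x)ᵀ) h
    simpa only [Matrix.mul_add, Matrix.add_mul, Matrix.mul_one, Matrix.mul_assoc] using this
  rw [V, Matrix.mul_sub, Matrix.mul_one, Matrix.add_mul, Matrix.one_mul, h2, add_sub_cancel_right]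

theorem g_inv (x : (𝔼 n)) : (d.g x)⁻¹ = (d.E x)ᵀ * d.E x :=
  inv_eq_left_inv (d.EEg x)

theorem V_symm (x : (𝔼 n)) : (d.V x)ᵀ = d.V x := by
  simp [V, transpose_mul, Matrix.mul_assoc]
end Geo

section divs
variable {n : ℕ} {R : Type*} [Ring R] [Algebra ℝ R]

theorem spin_sub (γ : Fin n → R) (M N : Matrix (Fin n) (Fin n) ℝ) :
    spin γ (M - N) = spin γ M - spin γ N := by
  simp only [spin, ← Finset.sum_sub_distrib, ← sub_smul, Matrix.sub_apply, ← sub_div]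

theorem spin_add (γ : Fin n → R) (M N : Matrix (Fin n) (Fin n) ℝ) :
    spin γ (M + N) = spin γ M + spin γ N := by
  simp only [spin, ← Finset.sum_add_distrib, ← add_smul, Matrix.add_apply, ← add_div]

theorem divc_alg {c : Fin n → R} {Γ : Fin n → Fin n → Fin n → ℝ} (hΓ : ∀ i k j, Γ i k j = Γ k i j)
    {N : Fin n → Fin n → R} (hN : ∀ i j, N i j = - ∑ k, Γ i k j • c k) (w : ℝ) :
    ∑ i, ((w * ∑ k, Γ i k k) • c i + w • N i i) = 0 := by
  simp only [hN, mul_smul, ← smul_add, ← Finset.smul_sum, Finset.sum_add_distrib,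
    Finset.sum_neg_distrib, Finset.sum_smul]
  rw [Finset.sum_comm (f := fun i k => Γ i k i • c k)]
  simp only [fun i k => hΓ k i k]
  rw [add_neg_cancel, smul_zero]

theorem divs_alg {c : Fin n → R} {Γ : Fin n → Fin n → Fin n → ℝ} (hΓ : ∀ i k j, Γ i k j = Γ k i j)
    {N : Fin n → Fin n → R} (hN : ∀ i j, N i j = - ∑ k, Γ i k j • c k) (w : ℝ) (j : Fin n) :
    ∑ i, ((w * ∑ k, Γ i k k) • (c i * c j - c j * c i) +
      w • (N i i * c j + c i * N i j - N i j * c i - c j * N i i)) = 0 := by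
  have h1 := divc_alg hΓ hN w
  have h2 : ∑ i, (c i * N i j - N i j * c i) = 0 := by
    simp only [hN, mul_neg, neg_mul, Finset.mul_sum, Finset.sum_mul, mul_smul_comm, smul_mul_assoc,
      Finset.sum_sub_distrib, Finset.sum_neg_distrib]
    rw [Finset.sum_comm (f := fun i k => Γ i k j • (c k * c i))]
    simp only [fun i k => hΓ k i j]
    abel
  have e : ∀ i, (w * ∑ k, Γ i k k) • (c i * c j - c j * c i) +
      w • (N i i * c j + c i * N i j - N i j * c i - c j * N i i) =
      ((w * ∑ k, Γ i k k) • c i + w • N i i) * c j - c j * ((w * ∑ k, Γ i k k) • c i + w • N i i)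
      + w • (c i * N i j - N i j * c i) := by
    intro i
    simp only [add_mul, mul_add, smul_mul_assoc, mul_smul_comm, smul_sub, smul_add]
    abel
  rw [Finset.sum_congr rfl fun i _ => e i, Finset.sum_add_distrib, Finset.sum_sub_distrib,
    ← Finset.sum_mul, ← Finset.mul_sum, ← Finset.smul_sum, h2, h1]
  simp
end divs

namespace Geo
variable {n m : ℕ} (d : Geo n m) {F : Type*} [NormedAddCommGroup F] [InnerProductSpace ℝ F]
  {γ : Fin n → F →L[ℝ] F}

theorem hom (i : Fin n) : MC 1 (d.om i) := by
  have hE := d.hE.mono (l := 1) (by norm_num)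
  have hH : MC 1 (d.H i) := (MC.md (k := 1) d.hA i).tr
  have hdE : MC 1 (md d.E i) := MC.md (k := 1) d.hE i
  exact (hdE.mul ((d.hg.mono (by norm_num)).mul hE.tr)).add
    ((hE.mul (hH.mul (d.hA.mono (by norm_num)))).mul hE.tr)

theorem vd_spin {M : (𝔼 n) → Matrix (Fin n) (Fin n) ℝ} (h : MC 1 M)
    (i : Fin n) (x : (𝔼 n)) :
    vd (fun y => spin γ (M y)) i x = spin γ (md M i x) := by
  have hd : ∀ a b, DifferentiableAt ℝ (fun y => M y a b / 4) x := fun a b =>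
    (h.diff a b x).mul_const _
  unfold spin
  rw [vd_sum fun a _ => DifferentiableAt.fun_sum fun b _ =>
    (hd a b).smul_const _]
  refine Finset.sum_congr rfl fun a _ => ?_
  rw [vd_sum fun b _ => (hd a b).smul_const _]
  refine Finset.sum_congr rfl fun b _ => ?_
  rw [vd_smul (hd a b) (by fun_prop), vd_const, smul_zero, zero_add]
  congr 1
  have := vd_mul (h.diff a b x) (differentiableAt_const (4⁻¹ : ℝ)) i
  rw [vd_const, mul_zero, zero_add] at this
  simp only [div_eq_mul_inv]; exact this

theorem vd_c (i j : Fin n) (x : (𝔼 n)) :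
    vd (fun y => ∑ a, d.E y a j • γ a) i x = ∑ a, md d.E i x a j • γ a := by
  have h := d.hE.mono (l := 1) (by norm_num)
  rw [vd_sum fun a _ => (h.diff a j x).smul_const _]
  refine Finset.sum_congr rfl fun a _ => ?_
  rw [vd_smul (h.diff a j x) (by fun_prop), vd_const, smul_zero, zero_add]; rfl

theorem Nc (hγ : ∀ a b, γ a * γ b + γ b * γ a = (if a = b then (-2 : ℝ) else 0) • 1)
    (i j : Fin n) (x : (𝔼 n)) :
    vd (fun y => ∑ a, d.E y a j • γ a) i x + spin γ (d.om i x) * (∑ a, d.E x a j • γ a)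
      - (∑ a, d.E x a j • γ a) * spin γ (d.om i x) =
    - ∑ k, (d.H i x * d.A x * ((d.E x)ᵀ * d.E x)) k j • ∑ a, d.E x a k • γ a := by
  have h1 : spin γ (d.om i x) * (∑ a, d.E x a j • γ a)
      - (∑ a, d.E x a j • γ a) * spin γ (d.om i x) = - ∑ b, (d.om i x * d.E x) b j • γ b := by
    have : - (d.om i x * d.E x) = (d.om i x)ᵀ * d.E x := by rw [om_skew, Matrix.neg_mul]
    simp only [← Finset.sum_neg_distrib, ← neg_smul]
    simp only [← Matrix.neg_apply, this]
    simp only [Finset.mul_sum, Finset.sum_mul, mul_smul_comm, smul_mul_assoc,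
      ← Finset.sum_sub_distrib, ← smul_sub, spin_comm hγ (d.om_skew i x)]
    simp only [mul_apply, transpose_apply, Finset.sum_smul, Finset.smul_sum, smul_smul]
    rw [Finset.sum_comm]
    exact Finset.sum_congr rfl fun a _ => Finset.sum_congr rfl fun b _ => by rw [mul_comm]
  rw [add_sub_assoc, h1, vd_c, om_E]
  simp only [Matrix.add_apply, add_smul, Finset.sum_add_distrib]
  have h2 : ∑ a, (d.E x * (d.H i x * d.A x) * ((d.E x)ᵀ * d.E x)) a j • γ a =
      ∑ k, (d.H i x * d.A x * ((d.E x)ᵀ * d.E x)) k j • ∑ a, d.E x a k • γ a := by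
    rw [Matrix.mul_assoc]
    generalize d.H i x * d.A x * ((d.E x)ᵀ * d.E x) = Y
    simp only [mul_apply, Finset.sum_smul, Finset.smul_sum, smul_smul]
    rw [Finset.sum_comm]
    exact Finset.sum_congr rfl fun a _ => Finset.sum_congr rfl fun b _ => by rw [mul_comm]
  rw [h2]; abel

theorem Gam_symm (x : (𝔼 n)) (i k j : Fin n) :
    (d.H i x * d.A x * ((d.E x)ᵀ * d.E x)) k j = (d.H k x * d.A x * ((d.E x)ᵀ * d.E x)) i j := by
  rw [Matrix.mul_assoc, Matrix.mul_assoc, mul_apply, mul_apply]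
  exact Finset.sum_congr rfl fun α _ => by
    rw [show d.H i x k α = d.H k x i α from d.sym i k x α]

/-- Scalar curvature. -/
def S (x : (𝔼 n)) : ℝ :=
  ∑ i, ∑ j, ∑ k, ∑ l, ∑ α, ∑ β, ((d.E x)ᵀ * d.E x) i j * ((d.E x)ᵀ * d.E x) k l * d.V x α β *
    (md d.A i x β j * md d.A k x α l - md d.A i x β k * md d.A j x α l)

theorem spin_skew (hsk : ∀ a u v, inner ℝ (γ a u) v = - inner ℝ u (γ a v))
    {M : Matrix (Fin n) (Fin n) ℝ} (hM : Mᵀ = - M) (u v : F) :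
    inner ℝ (spin γ M u) v = - inner ℝ u (spin γ M v) := by
  have hm : ∀ a b, M a b = - M b a := fun a b => by
    have := congrFun (congrFun hM b) a
    simpa using this
  have hmul : ∀ (A B : F →L[ℝ] F) (u : F), (A * B) u = A (B u) := fun _ _ _ => rfl
  simp only [spin, _root_.sum_apply, _root_.smul_apply, hmul, sum_inner, inner_sum,
    real_inner_smul_left, real_inner_smul_right, hsk, neg_neg,
    ← Finset.sum_neg_distrib]
  rw [Finset.sum_comm]
  exact Finset.sum_congr rfl fun a _ => Finset.sum_congr rfl fun b _ => by rw [hm]; ring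

/-- The Dirac structure of the graph. -/
def toDS (hγ : ∀ a b, γ a * γ b + γ b * γ a = (if a = b then (-2 : ℝ) else 0) • 1)
    (hsk : ∀ a u v, inner ℝ (γ a u) v = - inner ℝ u (γ a v)) : DS n F where
  c i x := ∑ a, d.E x a i • γ a
  Om i x := spin γ (d.om i x)
  w := d.w
  S := d.S
  hc i := ContDiff.sum fun a _ => ((d.hE a i).of_le (by norm_num)).smul contDiff_const
  hOm i := ContDiff.sum fun a _ => ContDiff.sum fun b _ =>
    ((d.hom i a b).div_const 4).smul contDiff_const
  hw := d.hw.of_le (by norm_num)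
  c_skew i x u v := by
    simp only [_root_.sum_apply, _root_.smul_apply, sum_inner, inner_sum, real_inner_smul_left,
      real_inner_smul_right, hsk, mul_neg, Finset.sum_neg_distrib]
  Om_skew i x u v := spin_skew hsk (d.om_skew i x) u v
  divc x := by
    have := divc_alg (d.Gam_symm x) (fun i j => d.Nc hγ i j x) (d.w x)
    simp only [vdw]; exact this
  divs x j := by
    have := divs_alg (d.Gam_symm x) (fun i j => d.Nc hγ i j x) (d.w x) j
    simp only [vdw]
    refine Eq.trans (Finset.sum_congr rfl fun i _ => ?_) this
    have hc : ∀ j, DifferentiableAt ℝ (fun y => ∑ a, d.E y a j • γ a) x := fun j =>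
      DifferentiableAt.fun_sum fun a _ => ((d.hE.mono (l := 1) (by norm_num)).diff a j x).smul_const _
    rw [vd_sub ((hc i).fun_mul (hc j)) ((hc j).fun_mul (hc i)), vd_mul (hc i) (hc j),
      vd_mul (hc j) (hc i)]
    congr 2
    noncomm_ring
  curv x := by
    set c : Fin n → F →L[ℝ] F := fun i => ∑ a, d.E x a i • γ a with hcdef
    have hB : ∀ i j, (vd (fun y => spin γ (d.om j y)) i x + spin γ (d.om i x) * spin γ (d.om j x)) -
        (vd (fun y => spin γ (d.om i y)) j x + spin γ (d.om j x) * spin γ (d.om i x)) =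
        ∑ k, ∑ l, ((∑ α, ∑ β, d.V x α β * (md d.A j x α k * md d.A i x β l -
          md d.A i x α k * md d.A j x β l)) / 4) • (c k * c l) := by
      intro i j
      have h1 := spin_spin hγ (o2 := d.om j x) (d.om_skew i x)
      rw [vd_spin (d.hom j), vd_spin (d.hom i)]
      have h2 := d.curv i j x
      have h3 := d.curv j i x
      have h4 : md (d.om j) i x - md (d.om i) j x + (d.om j x * d.om i x - d.om i x * d.om j x) =
          d.E x * (d.H j x * d.V x * (d.H i x)ᵀ - d.H i x * d.V x * (d.H j x)ᵀ) * (d.E x)ᵀ := by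
        rw [Matrix.mul_sub, Matrix.sub_mul]
        have : ∀ p q r s t u z : Matrix (Fin n) (Fin n) ℝ, p + q = z + t → r + s = z + u →
            p - r + (q - s) = t - u := fun p q r s t u z h h' => by
          rw [show p - r + (q - s) = (p + q) - (r + s) by abel, h, h']; abel
        exact this _ _ _ _ _ _ _ h2 (by rw [h3, Z_symm])
      have h5 : (spin γ (md (d.om j) i x) + spin γ (d.om i x) * spin γ (d.om j x)) -
        (spin γ (md (d.om i) j x) + spin γ (d.om j x) * spin γ (d.om i x)) =
          spin γ (md (d.om j) i x - md (d.om i) j x + (d.om j x * d.om i x - d.om i x * d.om j x)) := by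
        rw [spin_add, spin_sub γ (md _ _ _), ← h1]; abel
      rw [h5, h4, spin_conj]
      refine Finset.sum_congr rfl fun k _ => Finset.sum_congr rfl fun l _ => ?_
      congr 2
      simp only [Matrix.sub_apply, mul_apply, H, transpose_apply, Finset.sum_mul,
        ← Finset.sum_sub_distrib]
      rw [Finset.sum_comm]
      exact Finset.sum_congr rfl fun α _ => Finset.sum_congr rfl fun β _ => by ring
    have hcc := curv_contract (c := c) (gi := (d.E x)ᵀ * d.E x) (V := d.V x)
      (f := fun α i j => md d.A i x α j) (fun i j => cliff_c hγ (d.E x) i j)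
      (fun i j => by
        have : ((d.E x)ᵀ * d.E x)ᵀ = (d.E x)ᵀ * d.E x := by simp [transpose_mul]
        exact (congrFun (congrFun this i) j).symm)
      (fun α β => (congrFun (congrFun (d.V_symm x) α) β).symm) (fun α i j => d.sym i j x α)
    simp only [← hB] at hcc
    refine Eq.trans ?_ hcc
    simp only [sub_mul, mul_sub, Finset.sum_sub_distrib]
    congr 1
    rw [Finset.sum_comm]
end Geo

/-- Decay of order a for vector valued functions. -/
def OV {n : ℕ} {G : Type*} [NormedAddCommGroup G] (a : ℝ) (Φ : (𝔼 n) → G) :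
    Prop := OO a (fun x => ‖Φ x‖)

section OVl
variable {n : ℕ} {a b : ℝ} {G : Type*} [NormedAddCommGroup G] {Φ Ψ : (𝔼 n) → G}
  {φ : (𝔼 n) → ℝ}

theorem OV.of_le (h : OO a φ) (hle : ∀ x, ‖Φ x‖ ≤ φ x) : OV a Φ :=
  OO.of_le h fun x => by rw [abs_norm]; exact (hle x).trans (le_abs_self _)

theorem OO.ov (h : OO a φ) : OV a φ := OO.of_le h fun x => by rw [Real.norm_eq_abs, abs_abs]

theorem OV.oo (h : OV a φ) : OO a φ := OO.of_le h fun x => by rw [Real.norm_eq_abs, abs_abs]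

theorem OV.add (h : OV a Φ) (k : OV a Ψ) : OV a (fun x => Φ x + Ψ x) :=
  OV.of_le (OO.add h k) fun x => norm_add_le _ _

theorem OV.sub (h : OV a Φ) (k : OV a Ψ) : OV a (fun x => Φ x - Ψ x) :=
  OV.of_le (OO.add h k) fun x => norm_sub_le _ _

theorem OV.sum {ι : Type*} {s : Finset ι} {Φ : ι → (𝔼 n) → G}
    (h : ∀ i, OV a (Φ i)) : OV a (fun x => ∑ i ∈ s, Φ i x) :=
  OV.of_le (OO.sum h) fun x => norm_sum_le _ _

theorem OV.mul {𝔸 : Type*} [NormedRing 𝔸] {Φ Ψ : (𝔼 n) → 𝔸}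
    (h : OV a Φ) (k : OV b Ψ) : OV (a + b) (fun x => Φ x * Ψ x) :=
  OV.of_le (OO.mul h k) fun x => norm_mul_le _ _

theorem OV.smul [NormedSpace ℝ G] (h : OO a φ) (k : OV b Φ) : OV (a + b) (fun x => φ x • Φ x) :=
  OV.of_le (OO.mul h.ov k) fun x => (norm_smul _ _).le

theorem OV.const (v : G) : OV 0 (fun _ : (𝔼 n) => v) := OO.const _

theorem OV.smul_const [NormedSpace ℝ G] (h : OO a φ) (v : G) : OV a (fun x => φ x • v) := by
  have := OV.smul h (OV.const v); rwa [add_zero] at this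

theorem OV.glob (h : OV a Φ) (ha : 0 ≤ a) (hc : Continuous Φ) :
    ∃ B, 0 ≤ B ∧ ∀ x, ‖Φ x‖ ≤ B * (1 + ‖x‖) ^ (-a) := by
  obtain ⟨C, hC, h⟩ := h
  obtain ⟨M, hM⟩ := (isCompact_closedBall (0 : (𝔼 n)) 1).exists_bound_of_continuousOn
    hc.continuousOn
  have hM0 : 0 ≤ M := (norm_nonneg _).trans (hM 0 (by simp))
  have h2 : ∀ t : ℝ, 0 ≤ t → t ≤ 1 → 1 ≤ 2 ^ a * (1 + t) ^ (-a) := by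
    intro t h0 h1
    rw [Real.rpow_neg (by linarith), ← div_eq_mul_inv, one_le_div (by positivity)]
    exact Real.rpow_le_rpow (by linarith) (by linarith) ha
  refine ⟨(C + M) * 2 ^ a, by positivity, fun x => ?_⟩
  by_cases hx : 1 ≤ ‖x‖
  · have h3 := h x hx
    rw [abs_norm] at h3
    refine h3.trans ?_
    have : ‖x‖ ^ (-a) ≤ 2 ^ a * (1 + ‖x‖) ^ (-a) := by
      rw [Real.rpow_neg (by linarith), Real.rpow_neg (by linarith), ← div_eq_mul_inv,
        inv_eq_one_div, div_le_div_iff₀ (by positivity) (by positivity),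
        ← Real.mul_rpow (by norm_num) (by positivity), one_mul]
      exact Real.rpow_le_rpow (by linarith) (by linarith) ha
    rw [mul_assoc]
    gcongr
    linarith
  · push Not at hx
    have h3 := hM x (by simpa using hx.le)
    have h4 := h2 ‖x‖ (norm_nonneg x) hx.le
    rw [mul_assoc]
    nlinarith [norm_nonneg (Φ x)]

theorem OV.bdd (h : OV 0 Φ) (hc : Continuous Φ) : ∃ B, ∀ x, ‖Φ x‖ ≤ B := by
  obtain ⟨B, _, h⟩ := h.glob le_rfl hc
  exact ⟨B, fun x => by simpa using h x⟩

theorem OV.tendsto (h : OV a Φ) (ha : 0 < a) (hc : Continuous Φ) :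
    Tendsto Φ (cocompact _) (𝓝 0) := by
  obtain ⟨B, _, h⟩ := h.glob ha.le hc
  refine squeeze_zero_norm h ?_
  have h1 : Tendsto (fun t : ℝ => (1 + t) ^ (-a)) atTop (𝓝 0) :=
    (tendsto_rpow_neg_atTop ha).comp (tendsto_atTop_add_const_left _ _ tendsto_id)
  have := (h1.comp (tendsto_norm_cocompact_atTop (E := (𝔼 n)))).const_mul B
  simpa using this

theorem OV.integrable (h : OV a Φ) (ha : (n : ℝ) < a) (hc : Continuous Φ) : Integrable Φ := by
  obtain ⟨B, _, h⟩ := h.glob ((Nat.cast_nonneg n).trans ha.le) hc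
  have := (integrable_one_add_norm (E := (𝔼 n)) (μ := volume) (r := a)
    (by simpa using ha)).const_mul B
  exact this.mono' hc.aestronglyMeasurable (Eventually.of_forall h)

theorem OV.memLp (h : OV a Φ) (ha : (n : ℝ) < 2 * a) (hc : Continuous Φ) : MemLp Φ 2 := by
  rw [← memLp_norm_iff hc.aestronglyMeasurable,
    memLp_two_iff_integrable_sq hc.norm.aestronglyMeasurable]
  have : OV (a + a) (fun x => ‖Φ x‖ * ‖Φ x‖) := (OO.mul h h).ov
  have h2 := this.integrable (by linarith) (by fun_prop)
  simpa only [pow_two] using h2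
end OVl

/-- Entrywise decay. -/
def MO {n : ℕ} {ι κ : Type*} (a : ℝ) (M : (𝔼 n) → Matrix ι κ ℝ) : Prop :=
  ∀ i j, OO a (fun x => M x i j)

section MOl
variable {n : ℕ} {a b : ℝ} {ι κ μ : Type*} [Fintype ι] [Fintype κ] [Fintype μ]
  {M N : (𝔼 n) → Matrix ι κ ℝ} {P : (𝔼 n) → Matrix κ μ ℝ}

theorem MO.add (h : MO a M) (k : MO a N) : MO a (fun x => M x + N x) := fun i j => (h i j).add (k i j)

theorem MO.sub (h : MO a M) (k : MO a N) : MO a (fun x => M x - N x) := fun i j => (h i j).sub (k i j)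

theorem MO.mul (h : MO a M) (k : MO b P) : MO (a + b) (fun x => M x * P x) := fun i j => by
  simp only [mul_apply]; exact OO.sum fun l => (h i l).mul (k l j)

theorem MO.tr (h : MO a M) : MO a (fun x => (M x)ᵀ) := fun i j => h j i

theorem MO.mono (h : MO a M) (hb : b ≤ a) : MO b M := fun i j => (h i j).mono hb

theorem MO.const (c : Matrix ι κ ℝ) : MO 0 (fun _ : (𝔼 n) => c) :=
  fun _ _ => OO.const _

theorem MO.congr (h : MO a M) (e : ∀ x, N x = M x) : MO a N := by
  rwa [show N = M from funext e]

theorem MO.spin {R : Type*} [NormedRing R] [NormedAlgebra ℝ R] (γ : Fin n → R)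
    {M : (𝔼 n) → Matrix (Fin n) (Fin n) ℝ} (h : MO a M) :
    OV a (fun x => spin γ (M x)) :=
  OV.sum fun i => OV.sum fun j => OV.smul_const
    (((h i j).cmul (4⁻¹)).congr fun x => by rw [div_eq_inv_mul]) _
end MOl

set_option linter.unusedVariables false
section OVl2
variable {n : ℕ} {a b : ℝ} {G : Type*} [NormedAddCommGroup G] [InnerProductSpace ℝ G]

theorem OV.inner {Φ Ψ : (𝔼 n) → G} (h : OV a Φ) (k : OV b Ψ) :
    OO (a + b) (fun x => inner ℝ (Φ x) (Ψ x)) :=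
  (OV.of_le (OO.mul h k) fun x => norm_inner_le_norm _ _).oo

theorem OV.clm {T : (𝔼 n) → G →L[ℝ] G} {Ψ : (𝔼 n) → G}
    (h : OV a T) (k : OV b Ψ) : OV (a + b) (fun x => T x (Ψ x)) :=
  OV.of_le (OO.mul h k) fun x => (T x).le_opNorm _
end OVl2

namespace Geo
/-- Decay of the geometry. -/
structure Dec {n m : ℕ} (d : Geo n m) (q : ℝ) : Prop where
  hA : ∀ α i, O1 q (fun x => d.A x α i)
  hE : ∀ i j, O1 (2 * q) (fun x => d.E x i j - (1 : Matrix (Fin n) (Fin n) ℝ) i j)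
  hEa : ∀ i j, O1 (4 * q) (fun x => d.E x i j - d.E x j i)
  hw : O1 (2 * q) (fun x => d.w x - 1)
  hw1 : ∀ x, 1 ≤ d.w x
  hq : 0 < q

variable {n m : ℕ} {d : Geo n m} {q : ℝ}

/-- Leading part of the connection. -/
def kap (d : Geo n m) (i : Fin n) (x : (𝔼 n)) : Matrix (Fin n) (Fin n) ℝ :=
  (1 / 2 : ℝ) • (d.H i x * d.A x - (d.H i x * d.A x)ᵀ)

namespace Dec
theorem oA (h : d.Dec q) : MO q d.A := fun α i => (h.hA α i).2.1

theorem oH (h : d.Dec q) (i : Fin n) : MO (q + 1) (d.H i) := fun j α => (h.hA α j).2.2 i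

theorem oK (h : d.Dec q) (i : Fin n) : MO (2 * q + 1) (fun x => d.H i x * d.A x) :=
  ((h.oH i).mul h.oA).mono (by linarith)

theorem oE1 (h : d.Dec q) : MO (2 * q) (fun x => d.E x - 1) := fun i j => (h.hE i j).2.1

theorem oE (h : d.Dec q) : MO 0 d.E :=
  ((h.oE1.mono (by linarith [h.hq])).add (MO.const 1)).congr fun x => (sub_add_cancel _ _).symm

theorem odE (h : d.Dec q) (i : Fin n) : MO (2 * q + 1) (md d.E i) := fun a b =>
  ((h.hE a b).2.2 i).congr fun x => by
    rw [pd_eq_vd, vd_sub ((d.hE.mono (l := 1) (by norm_num)).diff a b x) (by fun_prop), vd_const,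
      sub_zero]; rfl

theorem odEa (h : d.Dec q) (i : Fin n) : MO (4 * q + 1) (fun x => md d.E i x - (md d.E i x)ᵀ) :=
  fun a b => ((h.hEa a b).2.2 i).congr fun x => by
    have hE := d.hE.mono (l := 1) (by norm_num)
    rw [pd_eq_vd, vd_sub (hE.diff a b x) (hE.diff b a x)]; rfl

theorem og1 (h : d.Dec q) : MO (2 * q) (fun x => d.g x - 1) :=
  ((h.oA.tr.mul h.oA).mono (by linarith)).congr fun x => by rw [g, add_sub_cancel_left]

theorem oG1 (h : d.Dec q) : MO (2 * q) (fun x => d.g x * (d.E x)ᵀ - 1) :=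
  (((h.og1.mul h.oE.tr).mono (by linarith)).add h.oE1.tr).congr fun x => by
    simp only [transpose_sub, transpose_one]; noncomm_ring

theorem oG (h : d.Dec q) : MO 0 (fun x => d.g x * (d.E x)ᵀ) :=
  ((h.oG1.mono (by linarith [h.hq])).add (MO.const 1)).congr fun x => (sub_add_cancel _ _).symm

theorem oom (h : d.Dec q) (i : Fin n) : MO (2 * q + 1) (d.om i) :=
  (((h.odE i).mul h.oG).mono (by linarith)).add
    (((h.oE.mul (h.oK i)).mul h.oE.tr).mono (by linarith))

theorem oN (h : d.Dec q) (i : Fin n) :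
    MO (4 * q + 1) (fun x => d.om i x - md d.E i x - d.H i x * d.A x) :=
  (((((h.odE i).mul h.oG1).mono (by linarith)).add
    (((h.oE1.mul (h.oK i)).mul h.oE.tr).mono (by linarith))).add
    (((h.oK i).mul h.oE1.tr).mono (by linarith))).congr fun x => by
      simp only [om, transpose_sub, transpose_one]
      generalize d.H i x * d.A x = K
      noncomm_ring

theorem okap (h : d.Dec q) (i : Fin n) : MO (4 * q + 1) (fun x => d.om i x - d.kap i x) := by
  intro a b
  have h1 := ((((h.oN i).sub (h.oN i).tr).add (h.odEa i)) a b).cmul (1 / 2)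
  refine h1.congr fun x => ?_
  have := congrFun (congrFun (d.om_skew i x) a) b
  simp only [kap, Matrix.sub_apply, Matrix.add_apply, Matrix.smul_apply, transpose_apply,
    Matrix.neg_apply, smul_eq_mul] at this ⊢
  rw [this]; ring

variable {F : Type*} [NormedAddCommGroup F] [InnerProductSpace ℝ F] {γ : Fin n → F →L[ℝ] F}

theorem ow (h : d.Dec q) : OO 0 d.w :=
  ((h.hw.2.1.mono (by linarith [h.hq])).add (OO.const 1)).congr fun x => (sub_add_cancel _ _).symm

theorem odw (h : d.Dec q) (i : Fin n) : OO 0 (vd d.w i) :=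
  ((h.hw.2.2 i).mono (by linarith [h.hq])).congr fun x => by
    rw [pd_eq_vd, vd_sub (d.hw.differentiable (by norm_num) x) (by fun_prop), vd_const, sub_zero]

theorem oc (h : d.Dec q) (i : Fin n) : OV 0 (fun x => ∑ a, d.E x a i • γ a) :=
  OV.sum fun a => OV.smul_const (h.oE a i) _

theorem odc (h : d.Dec q) (i j : Fin n) :
    OV 0 (vd (fun x => ∑ a, d.E x a i • γ a) j) := by
  rw [show vd (fun x => ∑ a, d.E x a i • γ a) j = fun x => ∑ a, md d.E j x a i • γ a from
    funext fun x => d.vd_c j i x]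
  exact OV.sum fun a => OV.smul_const ((h.odE j a i).mono (by linarith [h.hq])) _

variable (hγ : ∀ a b, γ a * γ b + γ b * γ a = (if a = b then (-2 : ℝ) else 0) • 1)
    (hsk : ∀ a u v, inner ℝ (γ a u) v = - inner ℝ u (γ a v))

theorem Q_eq (x : (𝔼 n)) (v : Fin n → F) :
    (d.toDS hγ hsk).Q x v = ∑ a, ‖∑ i, d.E x a i • v i‖ ^ 2 := by
  have e : ∀ i j, (d.toDS hγ hsk).c i x * (d.toDS hγ hsk).c j x +
      (d.toDS hγ hsk).c j x * (d.toDS hγ hsk).c i x = (-2 * ((d.E x)ᵀ * d.E x) i j) • 1 :=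
    fun i j => cliff_c hγ (d.E x) i j
  simp only [DS.Q, e, _root_.smul_apply, one_apply_eq_self, real_inner_smul_right]
  have e2 : ∀ a, ‖∑ i, d.E x a i • v i‖ ^ 2 =
      ∑ i, ∑ j, d.E x a i * d.E x a j * inner ℝ (v i) (v j) := fun a => by
    rw [← real_inner_self_eq_norm_sq, sum_inner]
    refine Finset.sum_congr rfl fun i _ => ?_
    rw [inner_sum]
    exact Finset.sum_congr rfl fun j _ => by
      rw [real_inner_smul_left, real_inner_smul_right]; ring
  simp only [e2]
  rw [← Finset.sum_neg_distrib]
  symm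
  rw [Finset.sum_comm]
  refine Finset.sum_congr rfl fun i _ => ?_
  rw [Finset.sum_comm, ← Finset.sum_neg_distrib]
  refine Finset.sum_congr rfl fun j _ => ?_
  rw [← Finset.sum_mul, mul_apply]
  simp only [transpose_apply]; ring

theorem Q_low (h : d.Dec q) : ∃ lam, 0 < lam ∧ lam ≤ 1 ∧
    ∀ x v, lam * ∑ i, ‖v i‖ ^ 2 ≤ (d.toDS hγ hsk).Q x v := by
  have hG : MC 1 (fun x => d.g x * (d.E x)ᵀ) :=
    (d.hg.mono (by norm_num)).mul (d.hE.tr.mono (by norm_num))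
  obtain ⟨B, hB⟩ := OV.bdd (Φ := fun x => ∑ k, ∑ a, ((d.g x * (d.E x)ᵀ) k a) ^ 2)
    (OO.sum fun k => OO.sum fun a => by
      have := (h.oG k a).mul (h.oG k a); rw [add_zero] at this
      simpa only [pow_two] using this).ov
    (continuous_finsetSum _ fun k _ => continuous_finsetSum _ fun a _ => (hG k a).continuous.pow 2)
  have hB0 : 0 ≤ B := (norm_nonneg _).trans (hB 0)
  refine ⟨1 / (B + 1), by positivity, by rw [div_le_one] <;> linarith, fun x v => ?_⟩
  rw [Q_eq]
  set G := d.g x * (d.E x)ᵀ with hGd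
  set u : Fin n → F := fun a => ∑ i, d.E x a i • v i with hu
  have hv : ∀ k, v k = ∑ a, G k a • u a := by
    intro k
    simp only [hu, Finset.smul_sum, smul_smul]
    rw [Finset.sum_comm]
    have h1 : ∀ i, ∑ a, G k a * d.E x a i = if k = i then 1 else 0 := fun i => by
      rw [← mul_apply, d.GE x, one_apply]
    simp only [← Finset.sum_smul, h1, ite_smul, one_smul, zero_smul]
    simp
  have h2 : ∀ k, ‖v k‖ ^ 2 ≤ (∑ a, G k a ^ 2) * ∑ a, ‖u a‖ ^ 2 := by
    intro k
    have h3 : ‖v k‖ ≤ ∑ a, |G k a| * ‖u a‖ := by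
      rw [hv k]; exact (norm_sum_le _ _).trans (Finset.sum_le_sum fun a _ => (norm_smul _ _).le)
    have h4 := Finset.sum_mul_sq_le_sq_mul_sq Finset.univ (fun a => |G k a|) (fun a => ‖u a‖)
    simp only [sq_abs] at h4
    exact (pow_le_pow_left₀ (norm_nonneg _) h3 2).trans h4
  have h5 : ∑ k, ‖v k‖ ^ 2 ≤ B * ∑ a, ‖u a‖ ^ 2 := by
    refine (Finset.sum_le_sum fun k _ => h2 k).trans ?_
    rw [← Finset.sum_mul]
    gcongr
    exact (le_abs_self _).trans (hB x)
  rw [div_mul_eq_mul_div, one_mul, div_le_iff₀ (by positivity)]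
  nlinarith [Finset.sum_nonneg fun a (_ : a ∈ Finset.univ) => sq_nonneg ‖u a‖]
end Dec
end Geo

namespace Geo.Dec
variable {n m : ℕ} {d : Geo n m} {q : ℝ} {F : Type*} [NormedAddCommGroup F] [InnerProductSpace ℝ F]
  {γ : Fin n → F →L[ℝ] F}
  (hγ : ∀ a b, γ a * γ b + γ b * γ a = (if a = b then (-2 : ℝ) else 0) • 1)
  (hsk : ∀ a u v, inner ℝ (γ a u) v = - inner ℝ u (γ a v))

theorem oOm (h : d.Dec q) (i : Fin n) : OV (2 * q + 1) ((d.toDS hγ hsk).Om i) :=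
  (h.oom i).spin γ

theorem osg (h : d.Dec q) (i j : Fin n) : OV 0 ((d.toDS hγ hsk).sg i j) := by
  have e := fun i j => (h.oc (γ := γ) i).mul (h.oc (γ := γ) j)
  simp only [add_zero] at e
  exact (e i j).sub (e j i)

theorem nab_const (ψ : F) (i : Fin n) :
    (d.toDS hγ hsk).nab i (fun _ => ψ) = fun x => (d.toDS hγ hsk).Om i x ψ := by
  funext x; simp only [DS.nab, vd_const, zero_add]

theorem onab (h : d.Dec q) (ψ : F) (i : Fin n) :
    OV (2 * q + 1) ((d.toDS hγ hsk).nab i (fun _ => ψ)) := by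
  rw [nab_const]
  simpa only [add_zero] using (h.oOm hγ hsk i).clm (OV.const ψ)

theorem int_div (h : d.Dec q) (hq : (n : ℝ) < 2 * (2 * q + 1)) (hS : Integrable d.S) (ψ : F) :
    Integrable fun x => ∑ i, pd ((d.toDS hγ hsk).W (fun _ => ψ) i) i x := by
  set e := d.toDS hγ hsk with he
  have hc : ContDiff ℝ 2 (fun _ : (𝔼 n) => ψ) := contDiff_const
  have e1 : (fun x => ∑ i, pd (e.W (fun _ => ψ) i) i x) = fun x =>
      d.w x * (∑ i, ∑ j, inner ℝ (e.nab i (fun _ => ψ) x) (e.sg i j x (e.nab j (fun _ => ψ) x)))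
        * (1 / 2) + d.w x * d.S x * (‖ψ‖ ^ 2 / 4) := by
    funext x
    rw [e.div_W hc x, e.sum_sg x (fun i => e.nab i (fun _ => ψ) x)]
    change d.w x * (_ - ‖∑ i, e.c i x _‖ ^ 2 + d.S x / 4 * _) = _
    ring
  rw [e1]
  have hwc : Continuous d.w := d.hw.continuous
  obtain ⟨B, hB⟩ := h.ow.ov.bdd hwc
  refine Integrable.add (Integrable.mul_const ?_ _) (Integrable.mul_const ?_ _)
  · refine OV.integrable (a := 0 + ((2 * q + 1) + (0 + (2 * q + 1)))) ?_ (by linarith) ?_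
    · exact (OO.mul h.ow (OO.sum fun i => OO.sum fun j => OV.inner (h.onab hγ hsk ψ i)
        ((h.osg hγ hsk i j).clm (h.onab hγ hsk ψ j)))).ov
    · exact hwc.mul (continuous_finsetSum _ fun i _ => continuous_finsetSum _ fun j _ =>
        (e.hnab i hc).continuous.inner ((e.hsg i j).continuous.clm_apply (e.hnab j hc).continuous))
  · exact hS.bdd_mul hwc.aestronglyMeasurable (Eventually.of_forall hB)

theorem int_pos [FiniteDimensional ℝ F] (h : d.Dec q) (hn : 3 ≤ n)
    (hq : (n : ℝ) < 2 * (2 * q + 1)) (hS : Integrable d.S)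
    (hS0 : ∀ x, 0 ≤ d.S x) (ψ : F) :
    0 ≤ ∫ x, ∑ i, pd ((d.toDS hγ hsk).W (fun _ => ψ) i) i x := by
  have hI := h.int_div hγ hsk hq hS ψ
  set e := d.toDS hγ hsk with he
  obtain ⟨lam, h0, h1, hQ⟩ := h.Q_low hγ hsk
  obtain ⟨B1, hB1⟩ := h.ow.ov.bdd d.hw.continuous
  choose B2 hB2 using fun j => (h.odw j).ov.bdd (vd_continuous (d.hw.of_le (by norm_num)) j)
  choose B3 hB3 using fun i => OV.bdd (Φ := e.c i) (h.oc i) (e.hc i).continuous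
  choose B4 hB4 using fun i j => OV.bdd (Φ := vd (e.c i) j) (h.odc i j) (vd_continuous (e.hc i) j)
  have p1 : 0 ≤ B1 := (norm_nonneg _).trans (hB1 0)
  have p2 : ∀ j, 0 ≤ B2 j := fun j => (norm_nonneg _).trans (hB2 j 0)
  have p3 : ∀ j, 0 ≤ B3 j := fun j => (norm_nonneg _).trans (hB3 j 0)
  have p4 : ∀ i j, 0 ≤ B4 i j := fun i j => (norm_nonneg _).trans (hB4 i j 0)
  have s2 : 0 ≤ ∑ j, B2 j := Finset.sum_nonneg fun j _ => p2 j
  have s3 : 0 ≤ ∑ j, B3 j := Finset.sum_nonneg fun j _ => p3 j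
  have s4' : ∀ i, 0 ≤ ∑ j, B4 i j := fun i => Finset.sum_nonneg fun j _ => p4 i j
  have s4 : 0 ≤ ∑ i, ∑ j, B4 i j := Finset.sum_nonneg fun i _ => s4' i
  refine e.pos_mass hn (lam := lam) (A := B1 + ∑ j, B2 j + ∑ j, B3 j + ∑ i, ∑ j, B4 i j) h0
    (fun x => h1.trans (h.hw1 x)) hQ hS0 (fun x => ?_) (fun j x => ?_) (fun i x => ?_)
    (fun i j x => ?_) (fun i => (h.oOm hγ hsk i).tendsto (by linarith [h.hq]) (e.hOm i).continuous)
    (fun i => (h.oOm hγ hsk i).memLp hq (e.hOm i).continuous) ψ hI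
  · have := (le_abs_self _).trans (hB1 x)
    change d.w x ≤ _
    linarith
  · have := (hB2 j x).trans (Finset.single_le_sum (fun j _ => p2 j) (Finset.mem_univ j))
    change ‖vd d.w j x‖ ≤ _
    linarith
  · have := (hB3 i x).trans (Finset.single_le_sum (fun j _ => p3 j) (Finset.mem_univ i))
    linarith
  · have := ((hB4 i j x).trans (Finset.single_le_sum (fun j _ => p4 i j) (Finset.mem_univ j))).trans
      (Finset.single_le_sum (f := fun i => ∑ j, B4 i j) (fun i _ => s4' i) (Finset.mem_univ i))
    linarith
end Geo.Dec

theorem OV.congr {n : ℕ} {a : ℝ} {G : Type*} [NormedAddCommGroup G]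
    {Φ Ψ : (𝔼 n) → G} (h : OV a Φ) (e : ∀ x, Ψ x = Φ x) : OV a Ψ := by
  rwa [show Ψ = Φ from funext e]

section fluxalg
variable {n : ℕ} {R : Type*} [Ring R] [Algebra ℝ R] {γ : Fin n → R}

theorem spin_half (hγ : ∀ a b, γ a * γ b + γ b * γ a = (if a = b then (-2 : ℝ) else 0) • (1 : R))
    (K : Matrix (Fin n) (Fin n) ℝ) :
    spin γ ((1 / 2 : ℝ) • (K - Kᵀ)) = spin γ K + ((∑ c, K c c) / 4) • 1 := by
  have e1 : spin γ Kᵀ = - spin γ K - ((∑ c, K c c) / 2) • (1 : R) := by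
    have : spin γ Kᵀ + spin γ K = - ((∑ c, K c c) / 2) • (1 : R) := by
      unfold spin
      rw [Finset.sum_comm]
      simp only [transpose_apply, ← Finset.sum_add_distrib, ← smul_add, hγ, smul_smul,
        ← Finset.sum_smul]
      congr 1
      simp only [mul_ite, mul_zero, Finset.sum_ite_eq', Finset.mem_univ, if_true, Finset.sum_div,
        ← Finset.sum_neg_distrib]
      exact Finset.sum_congr rfl fun c _ => by ring
    rw [eq_sub_of_add_eq this, neg_smul]; abel
  have e2 : spin γ ((1 / 2 : ℝ) • (K - Kᵀ)) = (1 / 2 : ℝ) • (spin γ K - spin γ Kᵀ) := by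
    rw [← spin_sub]
    simp only [spin, Finset.smul_sum, smul_smul, Matrix.smul_apply, smul_eq_mul, mul_div_assoc]
  rw [e2, e1]
  match_scalars <;> ring

theorem dirac_contract
    (hγ : ∀ a b, γ a * γ b + γ b * γ a = (if a = b then (-2 : ℝ) else 0) • (1 : R))
    {K : Fin n → Matrix (Fin n) (Fin n) ℝ} (hK : ∀ j c e, K j c e = K c j e) :
    ∑ j, γ j * spin γ ((1 / 2 : ℝ) • (K j - (K j)ᵀ)) =
      (-(1 / 4) : ℝ) • ∑ e, (∑ j, (K j j e - K j e j)) • γ e := by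
  have hc : ∀ i j, γ i * γ j + γ j * γ i = (-2 * (if i = j then (1 : ℝ) else 0)) • (1 : R) :=
    fun i j => by rw [hγ]; congr 1; split_ifs <;> norm_num
  have e1 : ∑ j, γ j * spin γ (K j) = (-(1 / 4) : ℝ) • ∑ e, (∑ j, K j j e) • γ e := by
    have e2 : ∑ j, γ j * spin γ (K j) =
        ∑ e, (∑ j, ∑ c, (K j c e / 4) • (γ j * γ c)) * γ e := by
      simp only [spin, Finset.mul_sum, Finset.sum_mul, mul_smul_comm, smul_mul_assoc, mul_assoc]
      symm
      rw [Finset.sum_comm]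
      exact Finset.sum_congr rfl fun j _ => Finset.sum_comm
    rw [e2, Finset.smul_sum]
    refine Finset.sum_congr rfl fun e _ => ?_
    rw [sym_contract hc (f := fun j c => K j c e / 4) fun i j => by rw [hK]]
    rw [smul_mul_assoc, one_mul, smul_smul]
    congr 1
    simp only [ite_mul, one_mul, zero_mul, Finset.sum_ite_eq, Finset.mem_univ, if_true,
      ← Finset.sum_div]
    ring
  simp only [spin_half hγ, mul_add, Finset.sum_add_distrib, e1, mul_smul_comm, mul_one]
  rw [Finset.smul_sum, Finset.smul_sum, ← Finset.sum_add_distrib]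
  refine Finset.sum_congr rfl fun e _ => ?_
  rw [smul_smul, smul_smul, ← add_smul, Finset.sum_sub_distrib]
  congr 1
  simp only [hK _ e]
  ring
end fluxalg

section fluxalg2
variable {n : ℕ} {F : Type*} [NormedAddCommGroup F] [InnerProductSpace ℝ F] {γ : Fin n → F →L[ℝ] F}

theorem flux_lead (hγ : ∀ a b, γ a * γ b + γ b * γ a = (if a = b then (-2 : ℝ) else 0) • 1)
    (hsk : ∀ a u v, inner ℝ (γ a u) v = - inner ℝ u (γ a v)) {ψ : F} (hψ : ‖ψ‖ = 1)
    {K : Fin n → Matrix (Fin n) (Fin n) ℝ} (hK : ∀ j c e, K j c e = K c j e) (i : Fin n) :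
    2 * inner ℝ ψ ((∑ j, (γ i * γ j - γ j * γ i) * spin γ ((1 / 2 : ℝ) • (K j - (K j)ᵀ))) ψ) =
      ∑ j, (K j j i - K j i j) := by
  have hmul : ∀ (A B : F →L[ℝ] F) (u : F), (A * B) u = A (B u) := fun _ _ _ => rfl
  set s : Fin n → F →L[ℝ] F := fun j => spin γ ((1 / 2 : ℝ) • (K j - (K j)ᵀ)) with hs
  have e0 : ∀ j, γ i * γ j - γ j * γ i =
      (2 : ℝ) • (γ i * γ j) + (if j = i then (2 : ℝ) else 0) • 1 := fun j => by
    have := hγ j i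
    rw [eq_sub_of_add_eq this, sub_sub_eq_add_sub, two_smul]
    split_ifs
    · rw [neg_smul, sub_neg_eq_add]
    · simp
  have e1 : ∑ j, (γ i * γ j - γ j * γ i) * s j = (2 : ℝ) • (γ i * ∑ j, γ j * s j) + (2 : ℝ) • s i := by
    simp only [e0, add_mul, Finset.sum_add_distrib, smul_mul_assoc, one_mul, ite_smul, zero_smul,
      ite_mul, zero_mul, Finset.sum_ite_eq', Finset.mem_univ, if_true, Finset.mul_sum, Finset.smul_sum, mul_assoc]
  have e2 : inner ℝ ψ (s i ψ) = 0 := by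
    have := Geo.spin_skew hsk (M := (1 / 2 : ℝ) • (K i - (K i)ᵀ))
      (by rw [transpose_smul, transpose_sub, transpose_transpose, ← smul_neg, neg_sub]) ψ ψ
    rw [real_inner_comm] at this
    change inner ℝ ψ (s i ψ) = - inner ℝ ψ (s i ψ) at this
    linarith
  have e3 : ∀ e, inner ℝ ψ (γ i (γ e ψ)) = if i = e then (-1 : ℝ) else 0 := by
    intro e
    have a1 : inner ℝ ψ (γ i (γ e ψ)) = inner ℝ ψ (γ e (γ i ψ)) := by
      have a := hsk i ψ (γ e ψ)
      have b := hsk e ψ (γ i ψ)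
      rw [real_inner_comm] at b
      linarith
    have a2 := congrArg (fun T : F →L[ℝ] F => inner ℝ ψ (T ψ)) (hγ i e)
    simp only [_root_.add_apply, hmul, _root_.smul_apply, one_apply_eq_self, inner_add_right,
      real_inner_smul_right, real_inner_self_eq_norm_sq, hψ] at a2
    split_ifs at a2 ⊢ <;> linarith
  have e4 := dirac_contract hγ hK
  rw [e1, show ∑ j, γ j * s j = _ from e4]
  simp only [_root_.add_apply, _root_.smul_apply, hmul, inner_add_right, real_inner_smul_right,
    e2, _root_.sum_apply, map_smul, map_sum, inner_sum, e3, mul_ite, mul_zero, Finset.sum_ite_eq,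
    Finset.mem_univ, if_true]
  ring
end fluxalg2

namespace Geo
variable {n m : ℕ} (d : Geo n m)

/-- The leading flux density. -/
def y (i : Fin n) (x : (𝔼 n)) : ℝ :=
  ∑ j, ((d.H j x * d.A x) j i - (d.H j x * d.A x) i j)

variable {d} {q : ℝ} {F : Type*} [NormedAddCommGroup F] [InnerProductSpace ℝ F]
  {γ : Fin n → F →L[ℝ] F}
  (hγ : ∀ a b, γ a * γ b + γ b * γ a = (if a = b then (-2 : ℝ) else 0) • 1)
  (hsk : ∀ a u v, inner ℝ (γ a u) v = - inner ℝ u (γ a v))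

theorem Dec.flux (h : d.Dec q) {ψ : F} (hψ : ‖ψ‖ = 1) (i : Fin n) :
    OO (4 * q + 1) (fun x => d.y i x - 4 * (d.toDS hγ hsk).W (fun _ => ψ) i x) := by
  have hmul : ∀ (A B : F →L[ℝ] F) (u : F), (A * B) u = A (B u) := fun _ _ _ => rfl
  have hK : ∀ x j c e, (d.H j x * d.A x) c e = (d.H c x * d.A x) j e := fun x j c e => by
    simp only [mul_apply, H, transpose_apply, d.sym j c]
  have ocg : ∀ i, OV (2 * q) (fun x => (d.toDS hγ hsk).c i x - γ i) := fun i => by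
    have : OV (2 * q) (fun x => ∑ a, (d.E x - 1) a i • γ a) :=
      OV.sum fun a => OV.smul_const (h.oE1 a i) _
    refine this.congr fun x => ?_
    simp only [Matrix.sub_apply, sub_smul, Finset.sum_sub_distrib, one_apply, ite_smul, one_smul,
      zero_smul, Finset.sum_ite_eq', Finset.mem_univ, if_true]
    rfl
  have ocm : ∀ i j, OV (2 * q) (fun x => (d.toDS hγ hsk).c i x * (d.toDS hγ hsk).c j x - γ i * γ j) :=
    fun i j => by
      have a := (ocg i).mul (h.oc (γ := γ) j)
      have b := (OV.const (γ i)).mul (ocg j)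
      rw [add_zero] at a
      rw [zero_add] at b
      refine (a.add b).congr fun x => ?_
      change _ = ((d.toDS hγ hsk).c i x - γ i) * (d.toDS hγ hsk).c j x + _
      noncomm_ring
  have osg1 : ∀ i j, OV (2 * q) (fun x => (d.toDS hγ hsk).sg i j x - (γ i * γ j - γ j * γ i)) :=
    fun i j => by
      refine ((ocm i j).sub (ocm j i)).congr fun x => ?_
      rw [DS.sg]; abel
  have oT : OV (4 * q + 1) (fun x => ∑ j, (γ i * γ j - γ j * γ i) * spin γ (d.kap j x) -
      ∑ j, d.w x • ((d.toDS hγ hsk).sg i j x * (d.toDS hγ hsk).Om j x)) := by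
    simp only [← Finset.sum_sub_distrib]
    refine OV.sum fun j => ?_
    have t1 : OV (4 * q + 1) (fun x => (d.w x - 1) •
        ((d.toDS hγ hsk).sg i j x * (d.toDS hγ hsk).Om j x)) :=
      OO.mono (OV.smul h.hw.2.1 ((h.osg hγ hsk i j).mul (h.oOm hγ hsk j))) (by linarith)
    have t2 : OV (4 * q + 1) (fun x => ((d.toDS hγ hsk).sg i j x - (γ i * γ j - γ j * γ i)) *
        (d.toDS hγ hsk).Om j x) :=
      OO.mono ((osg1 i j).mul (h.oOm hγ hsk j)) (by linarith)
    have t3 : OV (4 * q + 1) (fun x => (γ i * γ j - γ j * γ i) * spin γ (d.om j x - d.kap j x)) :=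
      OO.mono ((OV.const (γ i * γ j - γ j * γ i)).mul ((h.okap j).spin γ)) (by linarith)
    have t0 : OV (4 * q + 1) (fun _ : (𝔼 n) => (0 : F →L[ℝ] F)) :=
      OV.of_le OO.zero fun x => by simp
    refine (t0.sub ((t1.add t2).add t3)).congr fun x => ?_
    rw [spin_sub, sub_smul, one_smul]
    change _ = 0 - (_ + _ + (γ i * γ j - γ j * γ i) * ((d.toDS hγ hsk).Om j x - _))
    noncomm_ring
  have := (OV.inner (OV.const ψ) (oT.clm (OV.const ψ))).cmul 2
  rw [zero_add, add_zero] at this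
  refine this.congr fun x => ?_
  rw [y, ← flux_lead hγ hsk hψ (hK x) i]
  simp only [DS.W, Dec.nab_const, _root_.sub_apply, _root_.sum_apply, _root_.smul_apply, hmul,
    inner_sub_right, inner_sum, real_inner_smul_right, kap, Finset.mul_sum, Finset.sum_div, mul_sub,
    ← Finset.sum_sub_distrib]
  refine Finset.sum_congr rfl fun j _ => ?_
  change _ - 4 * (d.w x * _ / 2) = _
  ring
end Geo

namespace Geo
variable {n m : ℕ} {d : Geo n m} {q : ℝ}

theorem hy (j : Fin n) : ContDiff ℝ 1 (d.y j) := by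
  have hK : ∀ j, MC 1 (fun x => d.H j x * d.A x) := fun j =>
    ((d.hA.md (k := 1) j).tr).mul (d.hA.mono (by norm_num))
  exact ContDiff.sum fun i _ => (hK i i j).sub (hK i j i)

theorem Dec.mass (h : d.Dec q) (hn : 3 ≤ n)
    (hq : (n : ℝ) < 2 * (2 * q + 1)) (hS : Integrable d.S)
    (hS0 : ∀ x, 0 ≤ d.S x) : ∃ M : ℝ, 0 ≤ M ∧
      Tendsto (fun r : ℝ => (1 / sphereVol n) *
        ∫ x in Metric.sphere (0 : (𝔼 n)) r,
          ∑ j, d.y j x * (x j / r) ∂μH[(n : ℝ) - 1]) atTop (𝓝 M) := by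
  obtain ⟨ι, _, ψ, γ, hψ, hsk, hγ⟩ := clifford_exists n
  obtain ⟨κ, hκ, hflux⟩ := haus_flux (n := n) (by omega)
  have hI := h.int_div hγ hsk hq hS ψ
  have hP := h.int_pos hγ hsk hn hq hS hS0 ψ
  have hZ := fun i => h.flux hγ hsk hψ i
  have hWc : ∀ i, ContDiff ℝ 1 ((d.toDS hγ hsk).W (fun _ => ψ) i) :=
    fun i => (d.toDS hγ hsk).hW i contDiff_const
  set W := (d.toDS hγ hsk).W (fun _ => ψ) with hW
  set Z : Fin n → (𝔼 n) → ℝ := fun i x => d.y i x - 4 * W i x with hZd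
  have hZc : ∀ i, ContDiff ℝ 1 (Z i) := fun i => (hy i).sub (contDiff_const.mul (hWc i))
  choose B hB0 hB using hZ
  refine ⟨κ * (4 * ∫ x, ∑ i, pd (W i) i x), by positivity, ?_⟩
  have hlim : Tendsto (fun r : ℝ => ∫ x in Metric.ball 0 r, ∑ i, pd (W i) i x) atTop
      (𝓝 (∫ x, ∑ i, pd (W i) i x)) :=
    (aecover_ball tendsto_id).integral_tendsto_of_countably_generated hI
  have herr : Tendsto (fun r : ℝ => (1 / sphereVol n) *
      ∫ x in Metric.sphere (0 : (𝔼 n)) r,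
        ∑ j, Z j x * (x j / r) ∂μH[(n : ℝ) - 1]) atTop (𝓝 0) := by
    have ht : Tendsto (fun r : ℝ => (∑ j, B j) * r ^ (-((4 * q + 1) - ((n : ℝ) - 1)))) atTop (𝓝 0) := by
      simpa using (tendsto_rpow_neg_atTop (show 0 < (4 * q + 1) - ((n : ℝ) - 1) by linarith)).const_mul
        (∑ j, B j)
    refine squeeze_zero_norm' ?_ ht
    filter_upwards [eventually_ge_atTop 1] with r hr
    have hr0 : 0 < r := by linarith
    have hBs : 0 ≤ ∑ j, B j := Finset.sum_nonneg fun j _ => hB0 j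
    refine (haus_bound (by omega) hr0 (ε := (∑ j, B j) * r ^ (-(4 * q + 1))) (by positivity) _
      fun x hx => ?_).trans (le_of_eq ?_)
    · rw [Finset.sum_mul]
      refine (Finset.abs_sum_le_sum_abs _ _).trans (Finset.sum_le_sum fun j _ => ?_)
      have h1 := hB j x (by rw [hx]; exact hr)
      rw [hx] at h1
      have h2 : |x j / r| ≤ 1 := by
        rw [abs_div, abs_of_pos hr0, div_le_one hr0, ← hx]
        exact PiLp.norm_apply_le x j
      rw [abs_mul]
      exact (mul_le_of_le_one_right (abs_nonneg _) h2).trans h1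
    · rw [show -((4 * q + 1) - ((n : ℝ) - 1)) = ((n - 1 : ℕ) : ℝ) + -(4 * q + 1) by
        rw [Nat.cast_sub (by omega)]; push_cast; ring, Real.rpow_add hr0, Real.rpow_natCast]
      ring
  have hsum := ((hlim.const_mul 4).const_mul κ).add herr
  rw [add_zero] at hsum
  refine hsum.congr' ?_
  filter_upwards [eventually_gt_atTop 0] with r hr
  rw [hflux d.y hy r hr, hflux Z hZc r hr, ← mul_add]
  congr 1
  have hci : ∀ V : Fin n → (𝔼 n) → ℝ, (∀ i, ContDiff ℝ 1 (V i)) →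
      IntegrableOn (fun x => ∑ i, pd (V i) i x) (Metric.ball 0 r) := fun V hV =>
    ((continuous_finsetSum _ fun i _ => pd_continuous (hV i) i).continuousOn.integrableOn_compact
      (isCompact_closedBall 0 r)).mono_set Metric.ball_subset_closedBall
  rw [← integral_const_mul, ← integral_add ((hci W hWc).const_mul 4) (hci Z hZc)]
  refine integral_congr_ae (Eventually.of_forall fun x => ?_)
  simp only [Finset.mul_sum, ← Finset.sum_add_distrib]
  refine Finset.sum_congr rfl fun i _ => ?_
  have h1 : pd (Z i) i x = pd (d.y i) i x - pd (fun x => 4 * W i x) i x :=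
    vd_sub ((hy i).differentiable (by norm_num) x)
      ((contDiff_const.mul (hWc i)).differentiable (by norm_num) x) i
  have h2 : pd (fun x => 4 * W i x) i x = 4 * pd (W i) i x := by
    have : pd (fun x => 4 * W i x) i x = 4 * vd (W i) i x + vd (fun _ => (4 : ℝ)) i x * W i x :=
      vd_mul (by fun_prop) ((hWc i).differentiable (by norm_num) x) i
    rw [this, vd_const, zero_mul, add_zero]; rfl
  rw [h1, h2]; ring
end Geo

/-- positive mass theorem for graphs, Corollary 1.4: if the graph
of an asymptotically flat C³ map has nonnegative scalar curvature and S^⊥ ≡ 0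
(e.g. flat normal bundle), then the ADM mass exists and is nonnegative. -/
theorem positive_mass_graph (n m : ℕ) (hn : 3 ≤ n) (hm : 1 ≤ m)
    (f : Fin m → EuclideanSpace ℝ (Fin n) → ℝ)
    (hf : ∀ α, ContDiff ℝ 3 (f α))
    (C p : ℝ) (hC : 0 < C) (hp : ((n : ℝ) - 2) / 2 < p)
    (hd1 : ∀ x : EuclideanSpace ℝ (Fin n), 1 ≤ ‖x‖ → ∀ α i,
      |pd (f α) i x| ≤ C * ‖x‖ ^ (-(p / 2)))
    (hd2 : ∀ x : EuclideanSpace ℝ (Fin n), 1 ≤ ‖x‖ → ∀ α i j,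
      |pd2 (f α) i j x| ≤ C * ‖x‖ ^ (-(p / 2) - 1))
    (hS : Integrable (Sc f))
    (hSnonneg : ∀ x, 0 ≤ Sc f x)
    (hSperp : ∀ x, Sperp f x = 0) :
    ∃ mADM : ℝ, 0 ≤ mADM ∧
      Tendsto
        (fun r : ℝ => (1 / (2 * ((n : ℝ) - 1) * sphereVol n)) *
          ∫ x in Metric.sphere (0 : EuclideanSpace ℝ (Fin n)) r,
            admIntegrand f r x ∂μH[(n : ℝ) - 1])
        atTop (nhds mADM) := by
  have hn' : (3 : ℝ) ≤ n := by exact_mod_cast hn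
  have hq : 0 < p / 2 := by linarith
  have ha : ∀ α i, O1 (p / 2) (pd (f α) i) := fun α i =>
    ⟨vd_contDiff (k := 2) (hf α) i, ⟨C, hC.le, fun x hx => hd1 x hx α i⟩,
      fun j => ⟨C, hC.le, fun x hx => by
        rw [neg_add, ← sub_eq_add_neg]; exact hd2 x hx α j i⟩⟩
  obtain ⟨E, w, h1, h2, h3, h4, h5, h6⟩ := frame_exists hq (fun α i => pd (f α) i) ha Finset.univ
  let d : Geo n m :=
    { A := fun x => of fun α i => pd (f α) i x
      E := E
      w := w
      hA := fun α i => (ha α i).1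
      hE := fun i j => by
        have := (h1 i j).1.add (contDiff_const (c := (1 : Matrix (Fin n) (Fin n) ℝ) i j))
        simp only [sub_add_cancel] at this; exact this
      hw := by
        have := h4.1.add (contDiff_const (c := (1 : ℝ)))
        simpa only [sub_add_cancel] using this
      sym := fun i j x α => vd_symm ((hf α).of_le (by norm_num)) j i x
      hEg := fun x => by
        refine Eq.trans ?_ (h3 x)
        congr 3
        ext i j
        simp only [mul_apply, transpose_apply, of_apply, Matrix.sum_apply, vecMulVec_apply]
      hdet := h6 }
  have hD : d.Dec (p / 2) := ⟨ha, h1, h2, h4, h5, hq⟩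
  have hg : ∀ x, gmat f x = d.g x := fun x => by
    ext i j
    simp only [gmat, Geo.g, of_apply, Matrix.add_apply, one_apply, mul_apply, transpose_apply]
    rfl
  have hU : ∀ x, Umat f x = 1 + d.A x * (d.A x)ᵀ := fun x => by
    ext i j
    simp only [Umat, of_apply, Matrix.add_apply, one_apply, mul_apply, transpose_apply]
    rfl
  have hSd : Sc f = d.S := funext fun x => by
    simp only [Sc, hg, hU, d.g_inv, d.V_inv]; rfl
  rw [hSd] at hS hSnonneg
  obtain ⟨M, hM, hlim⟩ := hD.mass hn (by linarith) hS hSnonneg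
  have hK : ∀ x j c e, (d.H j x * d.A x) c e = (d.H c x * d.A x) j e := fun x j c e => by
    simp only [mul_apply, Geo.H, transpose_apply, d.sym j c]
  have hadm : ∀ r x, admIntegrand f r x = ∑ j, d.y j x * (x j / r) := fun r x => by
    unfold admIntegrand Geo.y
    rw [Finset.sum_comm]
    simp only [Finset.sum_mul]
    refine Finset.sum_congr rfl fun j _ => Finset.sum_congr rfl fun i _ => ?_
    congr 1
    simp only [hg]
    change md d.g i x i j - md d.g j x i i = _
    rw [d.mdg, d.mdg]
    simp only [Matrix.add_apply, transpose_apply]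
    rw [hK x j i i]
    ring
  refine ⟨1 / (2 * ((n : ℝ) - 1)) * M, mul_nonneg (by
    apply div_nonneg <;> linarith) hM, (hlim.const_mul _).congr fun r => ?_⟩
  simp only [hadm]
  rw [← mul_assoc, one_div_mul_one_div]
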